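/- Under the stated hypotheses on Ω, φ, a^{ij}, b^i and f, there exists a constant C > 0 such that every function u ∈ C²(Ω) ∩ L^∞(Ω) with u > 0 in Ω solving a^{ij}(x)∂_{ij}u + b^i(x)∂_iu + f(x,u) = 0 in Ω satisfies sup_Ω u ≤ C. -/

import Mathlib

open Bornology

/-- First partial derivative in the `k`-th coordinate, for functions on `ℝ²`. -/
noncomputable def pd (k : Fin 2) (f : (Fin 2 → ℝ) → ℝ) (x : Fin 2 → ℝ) : ℝ :=
  deriv (fun t => f (Function.update x k t)) (x k)

/-- Second partial derivative in the coordinates `i`, `j`, for functions on `ℝ²`. -/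
noncomputable def pd2 (i j : Fin 2) (f : (Fin 2 → ℝ) → ℝ) (x : Fin 2 → ℝ) : ℝ :=
  pd i (fun z => pd j f z) x

/-- The boundary invariant `g(x) = (bⁱ∂ᵢφ - ∂ⱼaⁱʲ·∂ᵢφ) / (∂ₖaⁱʲ·∂ᵢφ∂ⱼφ·φᵏ)`,
where `φᵏ = ∂ₖφ/|∇φ|²`; its numerator is the Fichera number. -/
noncomputable def ficheraG (A : Fin 2 → Fin 2 → (Fin 2 → ℝ) → ℝ)
    (B : Fin 2 → (Fin 2 → ℝ) → ℝ) (φ : (Fin 2 → ℝ) → ℝ) (x : Fin 2 → ℝ) : ℝ :=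
  ((∑ i, B i x * pd i φ x) - ∑ i, ∑ j, pd j (A i j) x * pd i φ x) /
    (∑ k, ∑ i, ∑ j, pd k (A i j) x * pd i φ x * pd j φ x *
      (pd k φ x / ∑ l, (pd l φ x) ^ 2))

section DegSec

open Filter Topology

namespace Deg

/-- Second-order one-dimensional jet at `0`. -/
def J (g : ℝ → ℝ) (g1 g2 : ℝ) : Prop :=
  ∃ d : ℝ → ℝ, (∀ᶠ t in 𝓝 (0:ℝ), HasDerivAt g (d t) t) ∧ d 0 = g1 ∧ HasDerivAt d g2 0

lemma J.const (c : ℝ) : J (fun _ => c) 0 0 :=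
  ⟨fun _ => 0, Eventually.of_forall fun t => hasDerivAt_const t c, rfl, hasDerivAt_const 0 0⟩

lemma J.affine (a b : ℝ) : J (fun t => a + t * b) b 0 := by
  refine ⟨fun _ => b, Eventually.of_forall fun t => ?_, rfl, hasDerivAt_const 0 b⟩
  simpa using ((hasDerivAt_id t).mul_const b).const_add a

lemma J.add {f g : ℝ → ℝ} {f1 f2 g1 g2 : ℝ} (hf : J f f1 f2) (hg : J g g1 g2) :
    J (fun t => f t + g t) (f1 + g1) (f2 + g2) := by
  obtain ⟨d, h1, h2, h3⟩ := hf
  obtain ⟨e, k1, k2, k3⟩ := hg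
  refine ⟨fun t => d t + e t, ?_, by simp [h2, k2], h3.add k3⟩
  filter_upwards [h1, k1] with t a b using a.add b

lemma J.sub {f g : ℝ → ℝ} {f1 f2 g1 g2 : ℝ} (hf : J f f1 f2) (hg : J g g1 g2) :
    J (fun t => f t - g t) (f1 - g1) (f2 - g2) := by
  obtain ⟨d, h1, h2, h3⟩ := hf
  obtain ⟨e, k1, k2, k3⟩ := hg
  refine ⟨fun t => d t - e t, ?_, by simp [h2, k2], h3.sub k3⟩
  filter_upwards [h1, k1] with t a b using a.sub b

lemma J.mul {f g : ℝ → ℝ} {f1 f2 g1 g2 : ℝ} (hf : J f f1 f2) (hg : J g g1 g2) :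
    J (fun t => f t * g t) (f1 * g 0 + f 0 * g1) (f2 * g 0 + 2 * f1 * g1 + f 0 * g2) := by
  obtain ⟨d, h1, h2, h3⟩ := hf
  obtain ⟨e, k1, k2, k3⟩ := hg
  refine ⟨fun t => d t * g t + f t * e t, ?_, by simp [h2, k2], ?_⟩
  · filter_upwards [h1, k1] with t a b using a.mul b
  · have := (h3.mul k1.self_of_nhds).add (h1.self_of_nhds.mul k3)
    refine this.congr_deriv ?_
    rw [h2, k2]; ring

lemma J.const_mul {f : ℝ → ℝ} {f1 f2 : ℝ} (c : ℝ) (hf : J f f1 f2) :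
    J (fun t => c * f t) (c * f1) (c * f2) := by
  obtain ⟨d, h1, h2, h3⟩ := hf
  refine ⟨fun t => c * d t, ?_, by simp [h2], h3.const_mul c⟩
  filter_upwards [h1] with t a using a.const_mul c

lemma J.comp {f ψ ψ' : ℝ → ℝ} {f1 f2 ψ2 : ℝ} (hf : J f f1 f2)
    (hψ : ∀ᶠ y in 𝓝 (f 0), HasDerivAt ψ (ψ' y) y) (hψ2 : HasDerivAt ψ' ψ2 (f 0)) :
    J (fun t => ψ (f t)) (ψ' (f 0) * f1) (ψ2 * f1 ^ 2 + ψ' (f 0) * f2) := by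
  obtain ⟨d, h1, h2, h3⟩ := hf
  refine ⟨fun t => ψ' (f t) * d t, ?_, by simp [h2], ?_⟩
  · have hc : ContinuousAt f 0 := h1.self_of_nhds.continuousAt
    filter_upwards [h1, hc.eventually hψ] with t a b using b.comp t a
  · have := (hψ2.comp (0:ℝ) h1.self_of_nhds).mul h3
    refine this.congr_deriv ?_
    simp only [Function.comp_apply, h2]; ring

lemma J.congr {f g : ℝ → ℝ} {f1 f2 : ℝ} (hf : J f f1 f2) (h : g =ᶠ[𝓝 0] f) : J g f1 f2 := by
  obtain ⟨d, h1, h2, h3⟩ := hf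
  refine ⟨d, ?_, h2, h3⟩
  filter_upwards [h1, h.eventually_nhds] with t a b using a.congr_of_eventuallyEq b

lemma J.congr_vals {f : ℝ → ℝ} {f1 f2 g1 g2 : ℝ} (hf : J f f1 f2) (h1 : g1 = f1) (h2 : g2 = f2) :
    J f g1 g2 := by subst h1; subst h2; exact hf

lemma J.max_test {f : ℝ → ℝ} {f1 f2 : ℝ} (hf : J f f1 f2) (hm : IsLocalMax f 0) :
    f1 = 0 ∧ f2 ≤ 0 := by
  obtain ⟨d, h1, h2, h3⟩ := hf
  have hd0 : d 0 = 0 := hm.hasDerivAt_eq_zero h1.self_of_nhds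
  refine ⟨h2 ▸ hd0, ?_⟩
  by_contra hpos
  push Not at hpos
  have hdeq : deriv f =ᶠ[𝓝 0] d := h1.mono fun t ht => ht.deriv
  have hdd : deriv (deriv f) 0 = f2 := by
    rw [hdeq.deriv_eq]; exact h3.deriv
  have hmin : IsLocalMin f 0 := isLocalMin_of_deriv_deriv_pos (by rw [hdd]; exact hpos)
    (by rw [hdeq.self_of_nhds]; exact hd0) h1.self_of_nhds.continuousAt
  have hconst : f =ᶠ[𝓝 0] fun _ => f 0 := by
    filter_upwards [hm, hmin] with t a b using le_antisymm a b
  have hd0' : d =ᶠ[𝓝 0] fun _ => 0 := by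
    filter_upwards [h1, hconst.eventually_nhds] with t a b
    exact a.unique ((hasDerivAt_const t (f 0)).congr_of_eventuallyEq b)
  have := h3.unique ((hasDerivAt_const (0:ℝ) (0:ℝ)).congr_of_eventuallyEq hd0')
  linarith

/-- value of a two-dimensional jet -/
structure Jt where
  p1 : ℝ
  p2 : ℝ
  h11 : ℝ
  h12 : ℝ
  h22 : ℝ

def Jet (V : ℝ × ℝ → ℝ) (z : ℝ × ℝ) (j : Jt) : Prop :=
  ∀ a1 a2 : ℝ, J (fun t => V (z.1 + t * a1, z.2 + t * a2)) (a1 * j.p1 + a2 * j.p2)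
    (a1 ^ 2 * j.h11 + 2 * a1 * a2 * j.h12 + a2 ^ 2 * j.h22)

structure Op where
  a11 : ℝ
  a12 : ℝ
  a22 : ℝ
  b1 : ℝ
  b2 : ℝ

def Op.L (o : Op) (j : Jt) : ℝ :=
  o.a11 * j.h11 + 2 * o.a12 * j.h12 + o.a22 * j.h22 + o.b1 * j.p1 + o.b2 * j.p2

def Op.Q (o : Op) (j : Jt) : ℝ :=
  o.a11 * j.p1 ^ 2 + 2 * o.a12 * j.p1 * j.p2 + o.a22 * j.p2 ^ 2

def Jt.add (i j : Jt) : Jt := ⟨i.p1 + j.p1, i.p2 + j.p2, i.h11 + j.h11, i.h12 + j.h12, i.h22 + j.h22⟩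
def Jt.smul (c : ℝ) (j : Jt) : Jt := ⟨c * j.p1, c * j.p2, c * j.h11, c * j.h12, c * j.h22⟩
/-- jet of `ψ ∘ V` where `s1 = ψ'`, `s2 = ψ''`. -/
def Jt.cmp (s1 s2 : ℝ) (j : Jt) : Jt :=
  ⟨s1 * j.p1, s1 * j.p2, s2 * j.p1 ^ 2 + s1 * j.h11, s2 * (j.p1 * j.p2) + s1 * j.h12,
    s2 * j.p2 ^ 2 + s1 * j.h22⟩

lemma Op.L_add (o : Op) (i j : Jt) : o.L (i.add j) = o.L i + o.L j := by
  simp only [Op.L, Jt.add]; ring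
lemma Op.L_smul (o : Op) (c : ℝ) (j : Jt) : o.L (j.smul c) = c * o.L j := by
  simp only [Op.L, Jt.smul]; ring
lemma Op.L_cmp (o : Op) (s1 s2 : ℝ) (j : Jt) : o.L (j.cmp s1 s2) = s1 * o.L j + s2 * o.Q j := by
  simp only [Op.L, Op.Q, Jt.cmp]; ring
lemma Op.Q_cmp (o : Op) (s1 s2 : ℝ) (j : Jt) : o.Q (j.cmp s1 s2) = s1 ^ 2 * o.Q j := by
  simp only [Op.Q, Jt.cmp]; ring

lemma Jet.add {V U : ℝ × ℝ → ℝ} {z : ℝ × ℝ} {i j : Jt} (hV : Jet V z i) (hU : Jet U z j) :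
    Jet (fun x => V x + U x) z (i.add j) := fun a1 a2 =>
  ((hV a1 a2).add (hU a1 a2)).congr_vals (by simp only [Jt.add]; ring) (by simp only [Jt.add]; ring)

lemma Jet.smul {V : ℝ × ℝ → ℝ} {z : ℝ × ℝ} {i : Jt} (c : ℝ) (hV : Jet V z i) :
    Jet (fun x => c * V x) z (i.smul c) := fun a1 a2 =>
  ((hV a1 a2).const_mul c).congr_vals (by simp only [Jt.smul]; ring) (by simp only [Jt.smul]; ring)

lemma Jet.cmp {V : ℝ × ℝ → ℝ} {z : ℝ × ℝ} {i : Jt} {ψ ψ' : ℝ → ℝ} {ψ2 : ℝ} (hV : Jet V z i)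
    (hψ : ∀ᶠ y in 𝓝 (V z), HasDerivAt ψ (ψ' y) y) (hψ2 : HasDerivAt ψ' ψ2 (V z)) :
    Jet (fun x => ψ (V x)) z (i.cmp (ψ' (V z)) ψ2) := fun a1 a2 => by
  have h0 : V (z.1 + 0 * a1, z.2 + 0 * a2) = V z := by simp
  have := (hV a1 a2).comp (ψ := ψ) (ψ' := ψ') (ψ2 := ψ2) (by rw [h0]; exact hψ) (by rw [h0]; exact hψ2)
  refine this.congr_vals ?_ ?_
  · simp only [Jt.cmp, h0]; ring
  · simp only [Jt.cmp, h0]; ring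

/-- jet of the squared distance to `w` -/
def sq (z w : ℝ × ℝ) : ℝ := (z.1 - w.1) ^ 2 + (z.2 - w.2) ^ 2

lemma sq_nonneg' (z w : ℝ × ℝ) : 0 ≤ sq z w := by unfold sq; positivity
lemma sq_comm' (z w : ℝ × ℝ) : sq z w = sq w z := by unfold sq; ring
lemma sq_self (z : ℝ × ℝ) : sq z z = 0 := by unfold sq; ring
lemma continuous_sq (w : ℝ × ℝ) : Continuous (fun z => sq z w) := by unfold sq; fun_prop
lemma continuous_sq2 : Continuous (fun z : (ℝ × ℝ) × (ℝ × ℝ) => sq z.1 z.2) := by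
  unfold sq; fun_prop

lemma sq_eq_zero {z w : ℝ × ℝ} (h : sq z w = 0) : z = w := by
  unfold sq at h
  have h1 : (z.1 - w.1) = 0 := by nlinarith [sq_nonneg (z.1 - w.1), sq_nonneg (z.2 - w.2)]
  have h2 : (z.2 - w.2) = 0 := by nlinarith [sq_nonneg (z.1 - w.1), sq_nonneg (z.2 - w.2)]
  ext <;> linarith

lemma jet_sq (z w : ℝ × ℝ) :
    Jet (fun x => sq x w) z ⟨2 * (z.1 - w.1), 2 * (z.2 - w.2), 2, 0, 2⟩ := fun a1 a2 => by
  have e1 := J.affine (z.1 - w.1) a1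
  have e2 := J.affine (z.2 - w.2) a2
  refine (((e1.mul e1).add (e2.mul e2)).congr ?_).congr_vals ?_ ?_
  · exact Eventually.of_forall fun t => by simp only [sq]; ring
  · simp; ring
  · simp; ring

/-- the barrier `-log r + c` -/
noncomputable def bar (c : ℝ) (z : ℝ × ℝ) : ℝ := c - Real.log z.2

lemma jet_bar (c : ℝ) (z : ℝ × ℝ) (hz : 0 < z.2) :
    Jet (bar c) z ⟨0, -(1 / z.2), 0, 0, 1 / z.2 ^ 2⟩ := fun a1 a2 => by
  have e2 := J.affine z.2 a2
  have h0 : z.2 + 0 * a2 = z.2 := by ring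
  have := (e2.comp (ψ := fun y => c - Real.log y) (ψ' := fun y => - (1/y)) (ψ2 := 1 / z.2^2)
    (by
      filter_upwards [lt_mem_nhds (a := 0) (b := z.2 + 0 * a2) (by rw [h0]; exact hz)] with y hy
      simpa using (Real.hasDerivAt_log hy.ne').const_sub c)
    (by
      rw [h0]
      have := (hasDerivAt_inv hz.ne').fun_neg
      simpa [one_div] using this))
  refine this.congr_vals ?_ ?_
  · simp only [h0]; ring
  · simp only [h0]; ring

lemma Jet.max_test {V : ℝ × ℝ → ℝ} {z : ℝ × ℝ} {j : Jt} (hV : Jet V z j) (hm : IsLocalMax V z) :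
    j.p1 = 0 ∧ j.p2 = 0 ∧ ∀ a1 a2 : ℝ, a1 ^ 2 * j.h11 + 2 * a1 * a2 * j.h12 + a2 ^ 2 * j.h22 ≤ 0 := by
  have key : ∀ a1 a2 : ℝ, IsLocalMax (fun t => V (z.1 + t * a1, z.2 + t * a2)) 0 := fun a1 a2 => by
    have hc : ContinuousAt (fun t : ℝ => (z.1 + t * a1, z.2 + t * a2)) 0 := by fun_prop
    have h0 : (z.1 + 0 * a1, z.2 + 0 * a2) = z := by simp
    have hc' : Tendsto (fun t : ℝ => (z.1 + t * a1, z.2 + t * a2)) (𝓝 0) (𝓝 z) := by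
      have := hc.tendsto
      simpa using this
    have : ∀ᶠ t in 𝓝 (0:ℝ), V (z.1 + t * a1, z.2 + t * a2) ≤ V z :=
      hc'.eventually hm
    unfold IsLocalMax IsMaxFilter
    simpa [h0] using this
  refine ⟨?_, ?_, fun a1 a2 => ((hV a1 a2).max_test (key a1 a2)).2⟩
  · simpa using ((hV 1 0).max_test (key 1 0)).1
  · simpa using ((hV 0 1).max_test (key 0 1)).1

/-- closeness of an operator to the model `Δ + κ₀/r ∂_r` -/
def OpClose (o : Op) (r κ0 ε : ℝ) : Prop :=
  |o.a11 - 1| ≤ ε ∧ |o.a12| ≤ ε ∧ |o.a22 - 1| ≤ ε ∧ |o.b1| ≤ ε ∧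
    ∃ κ β : ℝ, o.b2 = κ / r + β ∧ |κ - κ0| ≤ ε ∧ |β| ≤ ε

/-- `W` is a normalized approximate solution on a half ball. -/
def Sol (W : ℝ × ℝ → ℝ) (z0 : ℝ × ℝ) (ρ κ0 α ε : ℝ) : Prop :=
  ∀ z : ℝ × ℝ, 0 < z.2 → sq z z0 < ρ ^ 2 → ContinuousAt W z ∧ 0 < W z ∧ W z ≤ 1 ∧
    ∃ (j : Jt) (o : Op), Jet W z j ∧ OpClose o z.2 κ0 ε ∧ |o.L j + W z ^ α| ≤ ε

/-- At a local max, `L j ≤ 0`. -/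
lemma Jet.max_L {V : ℝ × ℝ → ℝ} {z : ℝ × ℝ} {j : Jt} (hV : Jet V z j) (hm : IsLocalMax V z)
    {o : Op} {r κ0 ε : ℝ} (ho : OpClose o r κ0 ε) (hε : ε ≤ 1 / 2) : o.L j ≤ 0 := by
  obtain ⟨h1, h2, h3⟩ := hV.max_test hm
  obtain ⟨q1, q2, q3, -, -⟩ := ho
  rw [abs_le] at q1 q3
  have a := h3 1 0
  have b := h3 0 1
  have c := h3 1 1
  have d := h3 1 (-1)
  simp only [Op.L, h1, h2]
  norm_num at a b c d
  have hle := abs_le.mp q2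
  rcases le_total 0 o.a12 with h | h
  · linarith [mul_nonneg h (neg_nonneg.mpr c),
      mul_nonneg (show 0 ≤ o.a11 - o.a12 by linarith) (neg_nonneg.mpr a),
      mul_nonneg (show 0 ≤ o.a22 - o.a12 by linarith) (neg_nonneg.mpr b)]
  · linarith [mul_nonneg (neg_nonneg.mpr h) (neg_nonneg.mpr d),
      mul_nonneg (show 0 ≤ o.a11 + o.a12 by linarith) (neg_nonneg.mpr a),
      mul_nonneg (show 0 ≤ o.a22 + o.a12 by linarith) (neg_nonneg.mpr b)]

end Deg

open Filter Topology

namespace Deg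

/-- jets along a line for the coupled function -/
lemma J_sqpow (x y : ℝ × ℝ) (hq : 0 < sq x y) (γ : ℝ) (a1 a2 b1 b2 : ℝ) :
    J (fun t => (sq (x.1 + t * a1, x.2 + t * a2) (y.1 + t * b1, y.2 + t * b2)) ^ (γ / 2))
      (γ * (sq x y) ^ (γ / 2 - 1) * ((x.1 - y.1) * (a1 - b1) + (x.2 - y.2) * (a2 - b2)))
      (γ * (sq x y) ^ (γ / 2 - 1) * ((a1 - b1) ^ 2 + (a2 - b2) ^ 2 -
        (2 - γ) * ((x.1 - y.1) * (a1 - b1) + (x.2 - y.2) * (a2 - b2)) ^ 2 / sq x y)) := by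
  have e1 := J.affine (x.1 - y.1) (a1 - b1)
  have e2 := J.affine (x.2 - y.2) (a2 - b2)
  have e3 := (e1.mul e1).add (e2.mul e2)
  have h0 : (x.1 - y.1 + 0 * (a1 - b1)) * (x.1 - y.1 + 0 * (a1 - b1)) +
      (x.2 - y.2 + 0 * (a2 - b2)) * (x.2 - y.2 + 0 * (a2 - b2)) = sq x y := by
    unfold sq; ring
  have key := e3.comp (ψ := fun q => q ^ (γ / 2)) (ψ' := fun q => γ / 2 * q ^ (γ / 2 - 1))
    (ψ2 := γ / 2 * ((γ / 2 - 1) * (sq x y) ^ (γ / 2 - 1 - 1)))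
    (by
      rw [h0]
      filter_upwards [lt_mem_nhds hq] with q hq
      exact Real.hasDerivAt_rpow_const (Or.inl hq.ne'))
    (by
      rw [h0]
      exact (Real.hasDerivAt_rpow_const (Or.inl hq.ne')).const_mul _)
  have hS : (sq x y) ^ (γ / 2 - 1 - 1) = (sq x y) ^ (γ / 2 - 1) / sq x y := by
    rw [Real.rpow_sub_one hq.ne']
  refine (key.congr ?_).congr_vals ?_ ?_
  · refine Eventually.of_forall fun t => ?_
    simp only [sq]
    congr 1; ring
  · simp only [h0]; ring
  · simp only [h0, hS]; field_simp; ring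

lemma IsLocalMax.line {G : (ℝ × ℝ) × (ℝ × ℝ) → ℝ} {x y : ℝ × ℝ} (hm : IsLocalMax G (x, y))
    (a1 a2 b1 b2 : ℝ) :
    IsLocalMax (fun t : ℝ => G ((x.1 + t * a1, x.2 + t * a2), (y.1 + t * b1, y.2 + t * b2))) 0 := by
  have hc : ContinuousAt (fun t : ℝ =>
    ((x.1 + t * a1, x.2 + t * a2), (y.1 + t * b1, y.2 + t * b2))) 0 := by fun_prop
  have hc' : Tendsto (fun t : ℝ => ((x.1 + t * a1, x.2 + t * a2), (y.1 + t * b1, y.2 + t * b2)))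
      (𝓝 0) (𝓝 (x, y)) := by
    have := hc.tendsto
    simpa using this
  have := hc'.eventually hm
  unfold IsLocalMax IsMaxFilter
  simpa using this

lemma engine_H {V1 V2 mf : ℝ × ℝ → ℝ} {x y : ℝ × ℝ} {j1 j2 jm : Jt} (h1 : Jet V1 x j1)
    (h2 : Jet V2 y j2) (h3 : Jet mf x jm) (hq : 0 < sq x y) {K γ : ℝ}
    (hm : IsLocalMax (fun p : (ℝ × ℝ) × (ℝ × ℝ) =>
      V1 p.1 - V2 p.2 - K * ((sq p.1 p.2) ^ (γ / 2) * mf p.1)) (x, y)) (a1 a2 b1 b2 : ℝ) :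
    (a1 * j1.p1 + a2 * j1.p2) - (b1 * j2.p1 + b2 * j2.p2) =
      K * (γ * (sq x y) ^ (γ / 2 - 1) *
        ((x.1 - y.1) * (a1 - b1) + (x.2 - y.2) * (a2 - b2)) * mf x +
        (sq x y) ^ (γ / 2 - 1) * sq x y * (a1 * jm.p1 + a2 * jm.p2)) ∧
    (a1 ^ 2 * j1.h11 + 2 * a1 * a2 * j1.h12 + a2 ^ 2 * j1.h22) -
      (b1 ^ 2 * j2.h11 + 2 * b1 * b2 * j2.h12 + b2 ^ 2 * j2.h22) ≤
      K * (sq x y) ^ (γ / 2 - 1) * (γ * mf x * ((a1 - b1) ^ 2 + (a2 - b2) ^ 2 -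
        (2 - γ) * ((x.1 - y.1) * (a1 - b1) + (x.2 - y.2) * (a2 - b2)) ^ 2 / sq x y) +
        2 * γ * ((x.1 - y.1) * (a1 - b1) + (x.2 - y.2) * (a2 - b2)) * (a1 * jm.p1 + a2 * jm.p2) +
        sq x y * (a1 ^ 2 * jm.h11 + 2 * a1 * a2 * jm.h12 + a2 ^ 2 * jm.h22)) := by
  have hS : (sq x y) ^ (γ / 2) = (sq x y) ^ (γ / 2 - 1) * sq x y := by
    rw [Real.rpow_sub_one hq.ne']; field_simp
  have key := ((h1 a1 a2).sub (h2 b1 b2)).sub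
    (((J_sqpow x y hq γ a1 a2 b1 b2).mul (h3 a1 a2)).const_mul K)
  have ⟨k1, k2⟩ := key.max_test (IsLocalMax.line hm a1 a2 b1 b2)
  simp only [zero_mul, add_zero, Prod.mk.eta, hS] at k1 k2
  constructor
  · linarith
  · have : ∀ u v : ℝ, u - v ≤ 0 → u ≤ v := fun u v h => by linarith
    refine (this _ _ k2).trans (le_of_eq ?_)
    ring

end Deg

open Filter Topology

namespace Deg

lemma op_pert {ε h11 h12 h22 c P1 P2 P3 : ℝ} (hc : 0 ≤ c) (q1 : |P1 - 1| ≤ ε) (q2 : |P2| ≤ ε)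
    (q3 : |P3 - 1| ≤ ε)
    (h : ∀ a1 a2 : ℝ, a1 ^ 2 * h11 + 2 * a1 * a2 * h12 + a2 ^ 2 * h22 ≤ c * (a1 ^ 2 + a2 ^ 2)) :
    P1 * h11 + 2 * P2 * h12 + P3 * h22 ≤ (1 - 2 * ε) * (h11 + h22) + c * (6 * ε) := by
  rw [abs_le] at q1 q3
  have e1 := h 1 0
  have e2 := h 0 1
  have e3 := h 1 1
  have e4 := h 1 (-1)
  norm_num at e1 e2 e3 e4
  have hle := abs_le.mp q2
  have hP1 : c * (P1 + P3 - 2) ≤ c * (2 * ε) := mul_le_mul_of_nonneg_left (by linarith) hc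
  rcases le_total 0 P2 with h | h
  · linarith [mul_le_mul_of_nonneg_left e3 h,
      mul_le_mul_of_nonneg_left e1 (show 0 ≤ P1 - 1 + 2 * ε - P2 by linarith),
      mul_le_mul_of_nonneg_left e2 (show 0 ≤ P3 - 1 + 2 * ε - P2 by linarith)]
  · linarith [mul_le_mul_of_nonneg_left e4 (neg_nonneg.mpr h),
      mul_le_mul_of_nonneg_left e1 (show 0 ≤ P1 - 1 + 2 * ε + P2 by linarith),
      mul_le_mul_of_nonneg_left e2 (show 0 ≤ P3 - 1 + 2 * ε + P2 by linarith)]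

set_option maxHeartbeats 1000000 in
lemma engine_trace {Q1 Q2 : Jt} {d1 d2 q N γ η μ ε : ℝ} {o o' : Op}
    (hq : 0 < q) (hqd : q = d1 ^ 2 + d2 ^ 2) (hN : 0 ≤ N) (hγ : γ < 1) (hγ2 : 1 / 2 ≤ γ)
    (hη : 0 ≤ η) (hη4 : η ≤ 1 / 4) (hμ0 : 0 ≤ μ) (hμ1 : μ ≤ 1) (hε : 0 ≤ ε) (hε4 : ε ≤ 1 / 4)
    (o1 : |o.a11 - 1| ≤ ε) (o2 : |o.a12| ≤ ε) (o3 : |o.a22 - 1| ≤ ε)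
    (o1' : |o'.a11 - 1| ≤ ε) (o2' : |o'.a12| ≤ ε) (o3' : |o'.a22 - 1| ≤ ε)
    (H : ∀ a1 a2 b1 b2 : ℝ, (a1 ^ 2 * Q1.h11 + 2 * a1 * a2 * Q1.h12 + a2 ^ 2 * Q1.h22) -
      (b1 ^ 2 * Q2.h11 + 2 * b1 * b2 * Q2.h12 + b2 ^ 2 * Q2.h22) ≤
      N * ((a1 - b1) ^ 2 + (a2 - b2) ^ 2 - (2 - γ) * (d1 * (a1 - b1) + d2 * (a2 - b2)) ^ 2 / q +
        η * (2 * ((a1 - b1) ^ 2 + (a2 - b2) ^ 2) + 6 * (a1 ^ 2 + a2 ^ 2)))) :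
    (o.a11 * Q1.h11 + 2 * o.a12 * Q1.h12 + o.a22 * Q1.h22) -
      μ ^ 2 * (o'.a11 * Q2.h11 + 2 * o'.a12 * Q2.h12 + o'.a22 * Q2.h22) ≤
      N * ((1 - μ) ^ 2 - (1 - γ) / 2 + 27 * ε + 22 * η) := by
  have hμ2 : μ ^ 2 ≤ 1 := pow_le_one₀ hμ0 hμ1
  -- uncoupled bounds
  have Hq : ∀ u : ℝ, 0 ≤ (2 - γ) * u ^ 2 / q := fun u => by
    apply div_nonneg _ hq.le
    apply mul_nonneg (by linarith) (_root_.sq_nonneg u)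
  have U1 : ∀ a1 a2 : ℝ, a1 ^ 2 * Q1.h11 + 2 * a1 * a2 * Q1.h12 + a2 ^ 2 * Q1.h22 ≤
      N * (3 * (a1 ^ 2 + a2 ^ 2)) := fun a1 a2 => by
    have := H a1 a2 0 0
    simp only [sub_zero] at this
    have h2 : N * (a1 ^ 2 + a2 ^ 2 - (2 - γ) * (d1 * a1 + d2 * a2) ^ 2 / q +
        η * (2 * (a1 ^ 2 + a2 ^ 2) + 6 * (a1 ^ 2 + a2 ^ 2))) ≤ N * (3 * (a1 ^ 2 + a2 ^ 2)) := by
      apply mul_le_mul_of_nonneg_left _ hN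
      linarith [Hq (d1 * a1 + d2 * a2), mul_le_mul_of_nonneg_right hη4 (show 0 ≤ a1^2+a2^2 by positivity)]
    linarith
  have U2 : ∀ b1 b2 : ℝ, -(b1 ^ 2 * Q2.h11 + 2 * b1 * b2 * Q2.h12 + b2 ^ 2 * Q2.h22) ≤
      N * (3 / 2 * (b1 ^ 2 + b2 ^ 2)) := fun a1 a2 => by
    have := H 0 0 a1 a2
    have h2 : N * ((0 - a1) ^ 2 + (0 - a2) ^ 2 - (2 - γ) * (d1 * (0 - a1) + d2 * (0 - a2)) ^ 2 / q +
        η * (2 * ((0 - a1) ^ 2 + (0 - a2) ^ 2) + 6 * ((0:ℝ) ^ 2 + 0 ^ 2))) ≤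
        N * (3 / 2 * (a1 ^ 2 + a2 ^ 2)) := by
      apply mul_le_mul_of_nonneg_left _ hN
      linarith [Hq (d1 * (0 - a1) + d2 * (0 - a2)),
        mul_le_mul_of_nonneg_right hη4 (show 0 ≤ a1^2+a2^2 by positivity)]
    linarith
  have p1 := op_pert (h11 := Q1.h11) (h12 := Q1.h12) (h22 := Q1.h22) (c := 3 * N) (by positivity) o1 o2 o3
    (fun a1 a2 => by have := U1 a1 a2; linarith)
  have p2 := op_pert (h11 := -Q2.h11) (h12 := -Q2.h12) (h22 := -Q2.h22) (c := 3 / 2 * N) (by positivity)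
    o1' o2' o3' (fun a1 a2 => by have := U2 a1 a2; linarith)
  -- coupled bounds
  have C1 := H d1 d2 (-(μ * d1)) (-(μ * d2))
  have C2 := H (-d2) d1 (-(μ * d2)) (μ * d1)
  have E1 : (d1 - -(μ * d1)) ^ 2 + (d2 - -(μ * d2)) ^ 2 -
      (2 - γ) * (d1 * (d1 - -(μ * d1)) + d2 * (d2 - -(μ * d2))) ^ 2 / q +
        η * (2 * ((d1 - -(μ * d1)) ^ 2 + (d2 - -(μ * d2)) ^ 2) + 6 * (d1 ^ 2 + d2 ^ 2)) =
      q * (-(1 - γ) * (1 + μ) ^ 2 + η * (2 * (1 + μ) ^ 2 + 6)) := by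
    have : (d1 * (d1 - -(μ * d1)) + d2 * (d2 - -(μ * d2))) = (1 + μ) * q := by rw [hqd]; ring
    rw [this]
    field_simp
    rw [hqd]; ring
  have E2 : (-d2 - -(μ * d2)) ^ 2 + (d1 - μ * d1) ^ 2 -
      (2 - γ) * (d1 * (-d2 - -(μ * d2)) + d2 * (d1 - μ * d1)) ^ 2 / q +
        η * (2 * ((-d2 - -(μ * d2)) ^ 2 + (d1 - μ * d1) ^ 2) + 6 * ((-d2) ^ 2 + d1 ^ 2)) =
      q * ((1 - μ) ^ 2 + η * (2 * (1 - μ) ^ 2 + 6)) := by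
    have : (d1 * (-d2 - -(μ * d2)) + d2 * (d1 - μ * d1)) = 0 := by ring
    rw [this, hqd]; ring
  rw [E1] at C1
  rw [E2] at C2
  have C3 : q * ((Q1.h11 + Q1.h22) - μ ^ 2 * (Q2.h11 + Q2.h22)) ≤
      q * (N * ((1 - μ) ^ 2 - (1 - γ) * (1 + μ) ^ 2 + 22 * η)) := by
    have e : N * (q * (-(1 - γ) * (1 + μ) ^ 2 + η * (2 * (1 + μ) ^ 2 + 6))) +
        N * (q * ((1 - μ) ^ 2 + η * (2 * (1 - μ) ^ 2 + 6))) ≤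
        q * (N * ((1 - μ) ^ 2 - (1 - γ) * (1 + μ) ^ 2 + 22 * η)) := by
      have : N * q * (η * (4 + 4 * μ ^ 2 + 12)) ≤ N * q * (22 * η) := by
        apply mul_le_mul_of_nonneg_left _ (by positivity)
        linarith [mul_le_mul_of_nonneg_left hμ2 hη]
      linarith
    refine le_trans (le_of_eq ?_) ((add_le_add C1 C2).trans e)
    rw [hqd]; ring
  have C4 := le_of_mul_le_mul_left C3 hq
  have g1 : (1 - 2 * ε) * ((Q1.h11 + Q1.h22) - μ ^ 2 * (Q2.h11 + Q2.h22)) ≤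
      (1 - 2 * ε) * (N * ((1 - μ) ^ 2 - (1 - γ) * (1 + μ) ^ 2 + 22 * η)) :=
    mul_le_mul_of_nonneg_left C4 (by linarith)
  have g2 : (1 - 2 * ε) * (N * ((1 - μ) ^ 2 - (1 - γ) * (1 + μ) ^ 2 + 22 * η)) ≤
      N * ((1 - μ) ^ 2 - (1 - γ) / 2 + 22 * η) := by
    have : (1 - 2 * ε) * ((1 - μ) ^ 2 - (1 - γ) * (1 + μ) ^ 2 + 22 * η) ≤
        (1 - μ) ^ 2 - (1 - γ) / 2 + 22 * η := by
      have a1 : (1-γ) * 1 ≤ (1 - γ) * (1 + μ) ^ 2 :=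
        mul_le_mul_of_nonneg_left (one_le_pow₀ (by linarith)) (by linarith)
      have a2 : (1/2) * ((1 - γ) * (1 + μ) ^ 2) ≤ (1 - 2 * ε) * ((1 - γ) * (1 + μ) ^ 2) :=
        mul_le_mul_of_nonneg_right (by linarith)
          (mul_nonneg (by linarith) (_root_.sq_nonneg _))
      linarith [mul_nonneg hε (_root_.sq_nonneg (1 - μ)), mul_nonneg hε hη]
    linarith [mul_le_mul_of_nonneg_left this hN]
  have g3 : μ ^ 2 * (3 / 2 * N * (6 * ε)) ≤ 1 * (3 / 2 * N * (6 * ε)) :=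
    mul_le_mul_of_nonneg_right hμ2 (by positivity)
  linarith [mul_le_mul_of_nonneg_left p2 (_root_.sq_nonneg μ)]

end Deg

open Filter Topology

namespace Deg

lemma drift_bound {κ κ' κ0 ε μ r r' : ℝ} (hr : 0 < r) (hr' : 0 < r') (hμ0 : 0 ≤ μ) (hμ1 : μ ≤ 1)
    (hε : 0 ≤ ε) (hεκ : ε ≤ κ0) (h1 : |κ - κ0| ≤ ε) (h2 : |κ' - κ0| ≤ ε) :
    κ / r * (r - r') - μ ^ 2 * (κ' / r' * (r - r')) ≤ κ0 * (1 - μ) ^ 2 + 4 * ε := by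
  rw [abs_le] at h1 h2
  have ht : 0 < r' / r := by positivity
  set t := r' / r with htd
  have e : κ / r * (r - r') - μ ^ 2 * (κ' / r' * (r - r')) =
      κ * (1 - t) + μ ^ 2 * κ' * (1 - 1 / t) := by
    rw [htd]; field_simp; ring
  rw [e]
  have hti : 0 < 1 / t := by positivity
  have hμ2 : μ ^ 2 ≤ 1 := pow_le_one₀ hμ0 hμ1
  have a1 : 2 * μ ≤ t + μ ^ 2 * (1 / t) := by
    have : t + μ ^ 2 * (1 / t) - 2 * μ = (t - μ) ^ 2 / t := by field_simp; ring
    have h := div_nonneg (_root_.sq_nonneg (t - μ)) ht.le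
    linarith
  have a2 := mul_le_mul_of_nonneg_left a1 (show 0 ≤ κ0 - ε by linarith)
  have a3 : (κ0 - ε) * t ≤ κ * t := mul_le_mul_of_nonneg_right (by linarith) ht.le
  have a4 : (κ0 - ε) * (μ ^ 2 * (1 / t)) ≤ κ' * (μ ^ 2 * (1 / t)) :=
    mul_le_mul_of_nonneg_right (by linarith) (by positivity)
  have a5 : κ' * μ ^ 2 ≤ (κ0 + ε) * μ ^ 2 :=
    mul_le_mul_of_nonneg_right (by linarith) (by positivity)
  have a6 : ε * (1 + μ) ^ 2 ≤ ε * 4 := mul_le_mul_of_nonneg_left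
    (by calc (1 + μ) ^ 2 ≤ 2 ^ 2 := by gcongr; linarith
          _ = 4 := by norm_num) hε
  linarith

lemma eng_t1 {d1 d2 c1 c2 a1 a2 p1 p2 q η m : ℝ} (hqd : q = d1 ^ 2 + d2 ^ 2) (hη : 0 ≤ η)
    (hm0 : 0 < m) (m1 : q * (p1 ^ 2 + p2 ^ 2) ≤ (η * m) ^ 2) :
    (d1 * c1 + d2 * c2) * (a1 * p1 + a2 * p2) ≤
        η * m * ((c1 ^ 2 + c2 ^ 2) + (a1 ^ 2 + a2 ^ 2)) := by
  refine (le_abs_self _).trans (abs_le_of_sq_le_sq ?_ (by positivity))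
  have e1 : (d1 * c1 + d2 * c2) ^ 2 ≤ (d1 ^ 2 + d2 ^ 2) * (c1 ^ 2 + c2 ^ 2) := by
    linarith [_root_.sq_nonneg (d1 * c2 - d2 * c1)]
  have e2 : (a1 * p1 + a2 * p2) ^ 2 ≤ (p1 ^ 2 + p2 ^ 2) * (a1 ^ 2 + a2 ^ 2) := by
    linarith [_root_.sq_nonneg (a1 * p2 - a2 * p1)]
  calc ((d1 * c1 + d2 * c2) * (a1 * p1 + a2 * p2)) ^ 2
      = (d1 * c1 + d2 * c2) ^ 2 * (a1 * p1 + a2 * p2) ^ 2 := by ring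
    _ ≤ ((d1 ^ 2 + d2 ^ 2) * (c1 ^ 2 + c2 ^ 2)) *
        ((p1 ^ 2 + p2 ^ 2) * (a1 ^ 2 + a2 ^ 2)) := by gcongr
    _ = (q * (p1 ^ 2 + p2 ^ 2)) * ((c1 ^ 2 + c2 ^ 2) * (a1 ^ 2 + a2 ^ 2)) := by
        rw [hqd]; ring
    _ ≤ (η * m) ^ 2 * ((c1 ^ 2 + c2 ^ 2) * (a1 ^ 2 + a2 ^ 2)) := by gcongr
    _ ≤ (η * m) ^ 2 * ((c1 ^ 2 + c2 ^ 2) + (a1 ^ 2 + a2 ^ 2)) ^ 2 := by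
        gcongr
        have u1 : 0 ≤ c1 ^ 2 + c2 ^ 2 := by positivity
        have u2 : 0 ≤ a1 ^ 2 + a2 ^ 2 := by positivity
        generalize c1 ^ 2 + c2 ^ 2 = u at *
        generalize a1 ^ 2 + a2 ^ 2 = v at *
        linarith [_root_.sq_nonneg u, _root_.sq_nonneg v, mul_nonneg u1 u2]
    _ = _ := by ring

lemma eng_km {κ κ0 r K S q p2 η m N γ : ℝ} (hκp : 0 < κ) (hκu : κ ≤ κ0 + 1) (hr : 0 < r)
    (hK : 0 < K) (hSp : 0 < S) (hη : 0 ≤ η) (hm0 : 0 < m) (hγ2 : 1 / 2 ≤ γ)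
    (m3 : q * p2 ≤ η * m * r) (hN : N = K * γ * S * m) :
    κ / r * (K * (S * q) * p2) ≤ N * ((2 + 2 * κ0) * η) := by
  have hκ0 : 0 < κ0 + 1 := by linarith
  calc κ / r * (K * (S * q) * p2) = (κ / r * (K * S)) * (q * p2) := by ring
    _ ≤ (κ / r * (K * S)) * (η * m * r) := by gcongr
    _ = (K * S * m * η) * κ := by field_simp
    _ ≤ (K * S * m * η) * (κ0 + 1) := by gcongr
    _ = (K * S * m) * (κ0 + 1) * η * 1 := by ring
    _ ≤ (K * S * m) * (κ0 + 1) * η * (2 * γ) := by gcongr; linarith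
    _ = N * ((2 + 2 * κ0) * η) := by rw [hN]; ring

theorem engine {V1 V2 mf : ℝ × ℝ → ℝ} {x y : ℝ × ℝ} {j1 j2 jm : Jt} (h1 : Jet V1 x j1)
    (h2 : Jet V2 y j2) (h3 : Jet mf x jm) (hq : 0 < sq x y) {K γ κ0 ε η μ : ℝ}
    (hm : IsLocalMax (fun p : (ℝ × ℝ) × (ℝ × ℝ) =>
      V1 p.1 - V2 p.2 - K * ((sq p.1 p.2) ^ (γ / 2) * mf p.1)) (x, y))
    {o o' : Op} (ho : OpClose o x.2 κ0 ε) (ho' : OpClose o' y.2 κ0 ε)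
    (hx : 0 < x.2) (hy : 0 < y.2) (hK : 0 < K) (hm0 : 0 < mf x)
    (hγ : γ < 1) (hγ2 : 1 / 2 ≤ γ) (hη : 0 ≤ η) (hη4 : η ≤ 1 / 4) (hμ0 : 0 ≤ μ) (hμ1 : μ ≤ 1)
    (hε : 0 ≤ ε) (hε4 : ε ≤ 1 / 4) (hκ : 1 < κ0)
    (m1 : sq x y * (jm.p1 ^ 2 + jm.p2 ^ 2) ≤ (η * mf x) ^ 2)
    (m2 : ∀ a1 a2 : ℝ, sq x y * (a1 ^ 2 * jm.h11 + 2 * a1 * a2 * jm.h12 + a2 ^ 2 * jm.h22) ≤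
      η * mf x * (a1 ^ 2 + a2 ^ 2))
    (m3 : sq x y * jm.p2 ≤ η * mf x * x.2)
    {N S s : ℝ} (hS : S = (sq x y) ^ (γ / 2 - 1)) (hN : N = K * γ * S * mf x)
    (hs : s = √(sq x y)) :
    j1.p1 = N * (x.1 - y.1) + K * (S * sq x y) * jm.p1 ∧
    j1.p2 = N * (x.2 - y.2) + K * (S * sq x y) * jm.p2 ∧
    j2.p1 = N * (x.1 - y.1) ∧ j2.p2 = N * (x.2 - y.2) ∧
    o.L j1 - μ ^ 2 * o'.L j2 ≤ N * ((1 + κ0) * (1 - μ) ^ 2 - (1 - γ) / 2 + (31 + 6 * s) * ε +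
      (24 + 2 * κ0) * η) := by
  have HH := engine_H h1 h2 h3 hq hm
  rw [← hS] at HH
  have hSp : 0 < S := by rw [hS]; exact Real.rpow_pos_of_pos hq _
  have hγp : 0 < γ := by linarith
  have hNp : 0 < N := by rw [hN]; positivity
  have g1 : j1.p1 = N * (x.1 - y.1) + K * (S * sq x y) * jm.p1 := by
    have := (HH 1 0 0 0).1
    norm_num at this
    rw [this, hN]; ring
  have g2 : j1.p2 = N * (x.2 - y.2) + K * (S * sq x y) * jm.p2 := by
    have := (HH 0 1 0 0).1
    norm_num at this
    rw [this, hN]; ring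
  have g3 : j2.p1 = N * (x.1 - y.1) := by
    have := (HH 0 0 1 0).1
    norm_num at this
    rw [hN]; linarith
  have g4 : j2.p2 = N * (x.2 - y.2) := by
    have := (HH 0 0 0 1).1
    norm_num at this
    rw [hN]; linarith
  refine ⟨g1, g2, g3, g4, ?_⟩
  obtain ⟨o1, o2, o3, o4, κ, β, o5, o6, o7⟩ := ho
  obtain ⟨o1', o2', o3', o4', κ', β', o5', o6', o7'⟩ := ho'
  have hKS : 0 < K * S := by positivity
  have tr := engine_trace (Q1 := j1) (Q2 := j2) (d1 := x.1 - y.1) (d2 := x.2 - y.2) (μ := μ)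
    (N := N) hq rfl hNp.le hγ hγ2 hη hη4 hμ0 hμ1 hε hε4 o1 o2 o3 o1' o2' o3' (by
    intro a1 a2 b1 b2
    refine (HH a1 a2 b1 b2).2.trans ?_
    set c1 := a1 - b1
    set c2 := a2 - b2
    set d1 := x.1 - y.1
    set d2 := x.2 - y.2
    have hqd : sq x y = d1 ^ 2 + d2 ^ 2 := rfl
    have t1 := eng_t1 (c1 := c1) (c2 := c2) (a1 := a1) (a2 := a2) hqd hη hm0 m1
    have t2 := mul_le_mul_of_nonneg_left t1 (show 0 ≤ 2 * γ * (K * S) by positivity)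
    have t3 := mul_le_mul_of_nonneg_left (m2 a1 a2) hKS.le
    have t4 : (K * S) * (η * mf x * (a1 ^ 2 + a2 ^ 2)) ≤
        (2 * γ) * ((K * S) * (η * mf x * (a1 ^ 2 + a2 ^ 2))) := by
      refine le_mul_of_one_le_left (by positivity) (by linarith)
    have t5 : 0 ≤ (2 * γ) * ((K * S) * (η * mf x * (a1 ^ 2 + a2 ^ 2))) := by positivity
    rw [hN]
    linarith)
  have hsp : 0 < s := by rw [hs]; exact Real.sqrt_pos.mpr hq
  have hss : s ^ 2 = sq x y := by rw [hs]; exact Real.sq_sqrt hq.le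
  have d1s : |x.1 - y.1| ≤ s := by
    apply abs_le_of_sq_le_sq _ hsp.le
    rw [hss]; unfold sq; linarith [_root_.sq_nonneg (x.2 - y.2)]
  have d2s : |x.2 - y.2| ≤ s := by
    apply abs_le_of_sq_le_sq _ hsp.le
    rw [hss]; unfold sq; linarith [_root_.sq_nonneg (x.1 - y.1)]
  have mb : ∀ p : ℝ, sq x y * p ^ 2 ≤ (η * mf x) ^ 2 → |K * (S * sq x y) * p| ≤ N * s := by
    intro p hp
    have : |s * p| ≤ η * mf x := by
      apply abs_le_of_sq_le_sq _ (by positivity)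
      rw [mul_pow, hss]; exact hp
    calc |K * (S * sq x y) * p| = (K * S * s) * |s * p| := by
          rw [← hss, show K * (S * s ^ 2) * p = (K * S * s) * (s * p) by ring, abs_mul,
            abs_of_pos (show 0 < K * S * s by positivity)]
      _ ≤ (K * S * s) * (η * mf x) := by gcongr
      _ = (K * S * s * mf x) * η := by ring
      _ ≤ (K * S * s * mf x) * γ := by gcongr; linarith
      _ = N * s := by rw [hN]; ring
  have mb1 := mb jm.p1 (by
    refine le_trans ?_ m1
    gcongr; linarith [_root_.sq_nonneg jm.p2])
  have mb2 := mb jm.p2 (by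
    refine le_trans ?_ m1
    gcongr; linarith [_root_.sq_nonneg jm.p1])
  have nd1 : |N * (x.1 - y.1)| ≤ N * s := by
    rw [abs_mul, abs_of_pos hNp]; gcongr
  have nd2 : |N * (x.2 - y.2)| ≤ N * s := by
    rw [abs_mul, abs_of_pos hNp]; gcongr
  have B : ∀ b p c : ℝ, |b| ≤ ε → |p| ≤ c → b * p ≤ ε * c := fun b p c hb hp =>
    (le_abs_self _).trans (by rw [abs_mul]; gcongr)
  have B' : ∀ b p c : ℝ, |b| ≤ ε → |p| ≤ c → -(μ ^ 2 * (b * p)) ≤ ε * c := fun b p c hb hp => by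
    have hμ2 : μ ^ 2 ≤ 1 := pow_le_one₀ hμ0 hμ1
    have := (neg_abs_le (b * p))
    have h2 : |b * p| ≤ ε * c := by rw [abs_mul]; gcongr
    have h3 : μ ^ 2 * |b * p| ≤ 1 * |b * p| := by gcongr
    have h4 := mul_le_mul_of_nonneg_left this (_root_.sq_nonneg μ)
    linarith
  have b1 := B o.b1 _ _ o4 ((abs_add_le _ _).trans (add_le_add nd1 mb1))
  have b2 := B β _ _ o7 ((abs_add_le _ _).trans (add_le_add nd2 mb2))
  have b3 := B' o'.b1 _ _ o4' nd1
  have b4 := B' β' _ _ o7' nd2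
  have dr := mul_le_mul_of_nonneg_left
    (drift_bound (r := x.2) (r' := y.2) hx hy hμ0 hμ1 hε (by linarith) o6 o6') hNp.le
  have hκp : 0 < κ := by rw [abs_le] at o6; linarith
  have hκu : κ ≤ κ0 + 1 := by rw [abs_le] at o6; linarith
  have km := eng_km hκp hκu hx hK hSp hη hm0 hγ2 m3 hN
  have fin : o.L j1 - μ ^ 2 * o'.L j2 = ((o.a11 * j1.h11 + 2 * o.a12 * j1.h12 + o.a22 * j1.h22) -
      μ ^ 2 * (o'.a11 * j2.h11 + 2 * o'.a12 * j2.h12 + o'.a22 * j2.h22)) +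
      o.b1 * (N * (x.1 - y.1) + K * (S * sq x y) * jm.p1) +
      β * (N * (x.2 - y.2) + K * (S * sq x y) * jm.p2) +
      (-(μ ^ 2 * (o'.b1 * (N * (x.1 - y.1))))) + (-(μ ^ 2 * (β' * (N * (x.2 - y.2))))) +
      N * (κ / x.2 * (x.2 - y.2) - μ ^ 2 * (κ' / y.2 * (x.2 - y.2))) +
      κ / x.2 * (K * (S * sq x y) * jm.p2) := by
    simp only [Op.L, g1, g2, g3, g4, o5, o5']; ring
  rw [fin]
  linarith

end Deg

open Filter Topology

namespace Deg

lemma sq_bdd (c : ℝ × ℝ) (R : ℝ) (z : ℝ × ℝ) (h : sq z c ≤ R) :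
    z ∈ Set.Icc (c.1 - (R + 1), c.2 - (R + 1)) (c.1 + (R + 1), c.2 + (R + 1)) := by
  have : ∀ u v : ℝ, u ^ 2 + v ^ 2 ≤ R → |u| ≤ R + 1 := fun u v h => by
    apply abs_le_of_sq_le_sq
    · nlinarith [_root_.sq_nonneg v, _root_.sq_nonneg u, _root_.sq_nonneg R]
    · nlinarith [_root_.sq_nonneg v, _root_.sq_nonneg u]
  unfold sq at h
  have h1 := abs_le.mp (this _ _ h)
  have h2 := abs_le.mp (this (z.2 - c.2) (z.1 - c.1) (by linarith))
  refine ⟨⟨?_, ?_⟩, ⟨?_, ?_⟩⟩ <;> simp only <;> linarith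

lemma isCompact_dom (c : ℝ × ℝ) (la lb r0 : ℝ) :
    IsCompact {z : ℝ × ℝ | r0 ≤ z.2 ∧ la ≤ sq z c ∧ sq z c ≤ lb} := by
  refine IsCompact.of_isClosed_subset
    (isCompact_Icc (a := (c.1 - (lb + 1), c.2 - (lb + 1))) (b := (c.1 + (lb + 1), c.2 + (lb + 1))))
    ?_ (fun z hz => sq_bdd c lb z hz.2.2)
  exact (isClosed_le continuous_const continuous_snd).inter
    ((isClosed_le continuous_const (continuous_sq c)).inter
      (isClosed_le (continuous_sq c) continuous_const))

/-- one-point interior maximum -/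
lemma one_point_max {F : ℝ × ℝ → ℝ} {c p : ℝ × ℝ} {la lb r0 : ℝ} (hr0 : 0 < r0)
    (hc : ∀ z : ℝ × ℝ, 0 < z.2 → la ≤ sq z c → sq z c ≤ lb → ContinuousAt F z)
    (hb : ∀ z : ℝ × ℝ, 0 < z.2 → la ≤ sq z c → sq z c ≤ lb →
      (sq z c = la ∨ sq z c = lb ∨ z.2 ≤ r0) → F z ≤ 0)
    (hp : 0 < p.2) (hp1 : la ≤ sq p c) (hp2 : sq p c ≤ lb) (hF : 0 < F p) :
    ∃ z : ℝ × ℝ, 0 < z.2 ∧ la < sq z c ∧ sq z c < lb ∧ 0 < F z ∧ IsLocalMax F z := by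
  have hpr : r0 ≤ p.2 := by
    by_contra h
    exact absurd hF (not_lt.mpr (hb p hp hp1 hp2 (Or.inr (Or.inr (not_le.mp h).le))))
  obtain ⟨z, hz, hmax⟩ := (isCompact_dom c la lb r0).exists_isMaxOn ⟨p, hpr, hp1, hp2⟩
    (f := F) (fun z hz => (hc z (hr0.trans_le hz.1) hz.2.1 hz.2.2).continuousWithinAt)
  have hFz : 0 < F z := hF.trans_le (hmax ⟨hpr, hp1, hp2⟩)
  have hz2 : 0 < z.2 := hr0.trans_le hz.1
  have key : ¬ (sq z c = la ∨ sq z c = lb ∨ z.2 ≤ r0) := fun h =>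
    absurd hFz (not_lt.mpr (hb z hz2 hz.2.1 hz.2.2 h))
  push Not at key
  have k1 : la < sq z c := lt_of_le_of_ne hz.2.1 (Ne.symm key.1)
  have k2 : sq z c < lb := lt_of_le_of_ne hz.2.2 key.2.1
  refine ⟨z, hz2, k1, k2, hFz, hmax.isLocalMax ?_⟩
  filter_upwards [continuous_snd.continuousAt.eventually (lt_mem_nhds key.2.2),
    (continuous_sq c).continuousAt.eventually (lt_mem_nhds k1),
    (continuous_sq c).continuousAt.eventually (gt_mem_nhds k2)] with w w1 w2 w3
  exact ⟨le_of_lt w1, le_of_lt w2, le_of_lt w3⟩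

/-- two-point interior maximum -/
lemma two_point_max {F : (ℝ × ℝ) × (ℝ × ℝ) → ℝ} {c p p' : ℝ × ℝ} {l l' r0 : ℝ} (hr0 : 0 < r0)
    (hc : ∀ x y : ℝ × ℝ, 0 < x.2 → sq x c ≤ l → 0 < y.2 → sq y c ≤ l' → ContinuousAt F (x, y))
    (hb : ∀ x y : ℝ × ℝ, 0 < x.2 → sq x c ≤ l → 0 < y.2 → sq y c ≤ l' →
      (sq x c = l ∨ sq y c = l' ∨ x.2 ≤ r0 ∨ y.2 ≤ r0) → F (x, y) ≤ 0)
    (hp : 0 < p.2) (hp1 : sq p c ≤ l) (hp' : 0 < p'.2) (hp1' : sq p' c ≤ l') (hF : 0 < F (p, p')) :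
    ∃ x y : ℝ × ℝ, 0 < x.2 ∧ 0 < y.2 ∧ sq x c < l ∧ sq y c < l' ∧ 0 < F (x, y) ∧
      IsLocalMax F (x, y) := by
  have h0 : ¬ (p.2 ≤ r0 ∨ p'.2 ≤ r0) := fun h =>
    absurd hF (not_lt.mpr (hb p p' hp hp1 hp' hp1' (Or.inr (Or.inr h))))
  push Not at h0
  have hmem : (p, p') ∈ {z : ℝ × ℝ | r0 ≤ z.2 ∧ -1 ≤ sq z c ∧ sq z c ≤ l} ×ˢ
      {z : ℝ × ℝ | r0 ≤ z.2 ∧ -1 ≤ sq z c ∧ sq z c ≤ l'} :=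
    ⟨⟨h0.1.le, by linarith [sq_nonneg' p c], hp1⟩, ⟨h0.2.le, by linarith [sq_nonneg' p' c], hp1'⟩⟩
  obtain ⟨⟨x, y⟩, ⟨hx, hy⟩, hmax⟩ :=
    ((isCompact_dom c (-1) l r0).prod (isCompact_dom c (-1) l' r0)).exists_isMaxOn ⟨(p, p'), hmem⟩
    (f := F) (fun z hz => (hc z.1 z.2 (hr0.trans_le hz.1.1) hz.1.2.2
      (hr0.trans_le hz.2.1) hz.2.2.2).continuousWithinAt)
  simp only at hx hy
  have hFz : 0 < F (x, y) := hF.trans_le (hmax hmem)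
  have hx2 : 0 < x.2 := hr0.trans_le hx.1
  have hy2 : 0 < y.2 := hr0.trans_le hy.1
  have key : ¬ (sq x c = l ∨ sq y c = l' ∨ x.2 ≤ r0 ∨ y.2 ≤ r0) := fun h =>
    absurd hFz (not_lt.mpr (hb x y hx2 hx.2.2 hy2 hy.2.2 h))
  push Not at key
  have k1 : sq x c < l := lt_of_le_of_ne hx.2.2 key.1
  have k2 : sq y c < l' := lt_of_le_of_ne hy.2.2 key.2.1
  refine ⟨x, y, hx2, hy2, k1, k2, hFz, hmax.isLocalMax ?_⟩
  refine prod_mem_nhds ?_ ?_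
  · filter_upwards [continuous_snd.continuousAt.eventually (lt_mem_nhds key.2.2.1),
      (continuous_sq c).continuousAt.eventually (gt_mem_nhds k1)] with w w1 w3
    exact ⟨le_of_lt w1, by linarith [sq_nonneg' w c], le_of_lt w3⟩
  · filter_upwards [continuous_snd.continuousAt.eventually (lt_mem_nhds key.2.2.2),
      (continuous_sq c).continuousAt.eventually (gt_mem_nhds k2)] with w w1 w3
    exact ⟨le_of_lt w1, by linarith [sq_nonneg' w c], le_of_lt w3⟩

lemma L_bar {o : Op} {r κ0 ε : ℝ} (ho : OpClose o r κ0 ε) (hr : 0 < r) (hε : 0 ≤ ε)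
    (hε1 : ε ≤ 1) (hε2 : 6 * ε ≤ κ0 - 1) :
    o.L ⟨0, -(1 / r), 0, 0, 1 / r ^ 2⟩ ≤ -((κ0 - 1) / 2 * (1 / r) ^ 2) + 1 := by
  obtain ⟨o1, o2, o3, o4, κ, β, o5, o6, o7⟩ := ho
  rw [abs_le] at o3 o6 o7
  have e : o.L ⟨0, -(1 / r), 0, 0, 1 / r ^ 2⟩ = (o.a22 - κ) * (1 / r) ^ 2 + (-β) * (1 / r) := by
    simp only [Op.L, o5]; field_simp; ring
  rw [e]
  have hi : 0 < 1 / r := by positivity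
  generalize 1 / r = i at *
  have a1 : (o.a22 - κ) * i ^ 2 ≤ (1 + 2 * ε - κ0) * i ^ 2 :=
    mul_le_mul_of_nonneg_right (by linarith) (by positivity)
  have a2 : (-β) * i ≤ ε * i := mul_le_mul_of_nonneg_right (by linarith) hi.le
  have a3 : ε * i ≤ ε * (i ^ 2 + 1) := mul_le_mul_of_nonneg_left (by nlinarith) hε
  have a4 : (6 * ε) * i ^ 2 ≤ (κ0 - 1) * i ^ 2 := mul_le_mul_of_nonneg_right hε2 (by positivity)
  linarith

lemma L_sq {o : Op} {z w : ℝ × ℝ} {κ0 ε s : ℝ} (ho : OpClose o z.2 κ0 ε) (hz : 0 < z.2)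
    (hw : 0 ≤ w.2) (hε : 0 ≤ ε) (hκ : ε ≤ κ0) (hs : 0 ≤ s) (hzs : sq z w ≤ s ^ 2) :
    o.L ⟨2 * (z.1 - w.1), 2 * (z.2 - w.2), 2, 0, 2⟩ ≤ 4 + 2 * κ0 + (6 + 4 * s) * ε := by
  obtain ⟨o1, o2, o3, o4, κ, β, o5, o6, o7⟩ := ho
  have d1 : |z.1 - w.1| ≤ s := by
    apply abs_le_of_sq_le_sq _ hs
    unfold sq at hzs; linarith [_root_.sq_nonneg (z.2 - w.2)]
  have d2 : |z.2 - w.2| ≤ s := by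
    apply abs_le_of_sq_le_sq _ hs
    unfold sq at hzs; linarith [_root_.sq_nonneg (z.1 - w.1)]
  have B : ∀ b p : ℝ, |b| ≤ ε → |p| ≤ s → b * p ≤ ε * s := fun b p hb hp =>
    (le_abs_self _).trans (by rw [abs_mul]; gcongr)
  have b1 := B _ _ o4 d1
  have b2 := B _ _ o7 d2
  rw [abs_le] at o1 o3 o6
  have e : o.L ⟨2 * (z.1 - w.1), 2 * (z.2 - w.2), 2, 0, 2⟩ = 2 * o.a11 + 2 * o.a22 +
      2 * (o.b1 * (z.1 - w.1)) + 2 * (β * (z.2 - w.2)) + 2 * κ - 2 * (κ * (w.2 / z.2)) := by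
    simp only [Op.L, o5]; field_simp; ring
  rw [e]
  have : 0 ≤ κ * (w.2 / z.2) := mul_nonneg (by linarith) (by positivity)
  linarith

lemma Q_lower {o : Op} {r κ0 ε : ℝ} (ho : OpClose o r κ0 ε) (j : Jt) :
    (1 - 2 * ε) * (j.p1 ^ 2 + j.p2 ^ 2) ≤ o.Q j ∧ o.Q j ≤ (1 + 2 * ε) * (j.p1 ^ 2 + j.p2 ^ 2) := by
  obtain ⟨o1, o2, o3, -, -⟩ := ho
  rw [abs_le] at o1 o2 o3
  have h1 : (1 - ε) * j.p1 ^ 2 ≤ o.a11 * j.p1 ^ 2 :=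
    mul_le_mul_of_nonneg_right (by linarith) (_root_.sq_nonneg _)
  have h2 : (1 - ε) * j.p2 ^ 2 ≤ o.a22 * j.p2 ^ 2 :=
    mul_le_mul_of_nonneg_right (by linarith) (_root_.sq_nonneg _)
  have h1' : o.a11 * j.p1 ^ 2 ≤ (1 + ε) * j.p1 ^ 2 :=
    mul_le_mul_of_nonneg_right (by linarith) (_root_.sq_nonneg _)
  have h2' : o.a22 * j.p2 ^ 2 ≤ (1 + ε) * j.p2 ^ 2 :=
    mul_le_mul_of_nonneg_right (by linarith) (_root_.sq_nonneg _)
  have h3 := mul_nonneg (show 0 ≤ ε - o.a12 by linarith) (_root_.sq_nonneg (j.p1 - j.p2))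
  have h4 := mul_nonneg (show 0 ≤ ε + o.a12 by linarith) (_root_.sq_nonneg (j.p1 + j.p2))
  have h5 := mul_nonneg (show 0 ≤ ε - o.a12 by linarith) (_root_.sq_nonneg (j.p1 + j.p2))
  have h6 := mul_nonneg (show 0 ≤ ε + o.a12 by linarith) (_root_.sq_nonneg (j.p1 - j.p2))
  unfold Op.Q
  constructor <;> linarith

/-- auxiliary: the barrier dominates near `r = 0` -/
lemma bar_large {c ζ M r : ℝ} {z : ℝ × ℝ} (hζ : 0 < ζ) (hr : r = Real.exp (c - M / ζ))
    (hz : 0 < z.2) (hzr : z.2 ≤ r) : M ≤ ζ * bar c z := by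
  have h1 : Real.log z.2 ≤ c - M / ζ := by
    rw [Real.log_le_iff_le_exp hz, ← hr]; exact hzr
  unfold bar
  have : ζ * (M / ζ) ≤ ζ * (c - Real.log z.2) := mul_le_mul_of_nonneg_left (by linarith) hζ.le
  rwa [mul_div_cancel₀ _ hζ.ne'] at this

lemma bar_nonneg {H : ℝ} {z : ℝ × ℝ} (hz : 0 < z.2) (hzr : z.2 ≤ H) : 0 ≤ bar (Real.log H) z := by
  unfold bar
  linarith [Real.log_le_log hz hzr]

lemma bar_cont {c : ℝ} {z : ℝ × ℝ} (hz : 0 < z.2) : ContinuousAt (bar c) z := by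
  unfold bar
  exact continuousAt_const.sub ((continuous_snd.continuousAt).log hz.ne')

lemma sq_snd_le {z c : ℝ × ℝ} {s : ℝ} (hs : 0 ≤ s) (h : sq z c ≤ s ^ 2) : z.2 ≤ c.2 + s := by
  have : |z.2 - c.2| ≤ s := by
    apply abs_le_of_sq_le_sq _ hs
    unfold sq at h; linarith [_root_.sq_nonneg (z.1 - c.1)]
  rw [abs_le] at this; linarith

lemma sq_tri {x y z : ℝ × ℝ} {s t : ℝ} (hs : 0 ≤ s) (ht : 0 ≤ t) (h1 : sq x y ≤ s ^ 2)
    (h2 : sq y z ≤ t ^ 2) : sq x z ≤ (s + t) ^ 2 := by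
  unfold sq at *
  have e1 : ((x.1 - y.1) * (y.1 - z.1) + (x.2 - y.2) * (y.2 - z.2)) ≤ s * t := by
    refine (le_abs_self _).trans (abs_le_of_sq_le_sq ?_ (by positivity))
    rw [mul_pow]
    refine le_trans ?_ (mul_le_mul h1 h2 (by positivity) (by positivity))
    linarith [_root_.sq_nonneg ((x.1 - y.1) * (y.2 - z.2) - (x.2 - y.2) * (y.1 - z.1))]
  linarith

lemma sq_tri_lt {x y z : ℝ × ℝ} {s t : ℝ} (hs : 0 < s) (ht : 0 ≤ t) (h1 : sq x y < s ^ 2)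
    (h2 : sq y z ≤ t ^ 2) : sq x z < (s + t) ^ 2 := by
  have h0 := sq_nonneg' x y
  have h3 : √(sq x y) < s := by
    rw [Real.sqrt_lt' hs]; exact h1
  have := sq_tri (Real.sqrt_nonneg _) ht (le_of_eq (Real.sq_sqrt h0).symm) h2
  refine this.trans_lt ?_
  have h4 := Real.sqrt_nonneg (sq x y)
  gcongr

lemma Sol.mono {W : ℝ × ℝ → ℝ} {z0 z1 : ℝ × ℝ} {ρ ρ1 κ0 α ε t : ℝ} (h : Sol W z0 ρ κ0 α ε)
    (hρ1 : 0 < ρ1) (ht : 0 ≤ t) (h1 : sq z1 z0 ≤ t ^ 2) (h2 : ρ1 + t ≤ ρ) : Sol W z1 ρ1 κ0 α ε :=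
  fun z hz hz1 => h z hz ((sq_tri_lt hρ1 ht hz1 h1).trans_le (by gcongr))

end Deg

open Filter Topology

namespace Deg

lemma jet_const (c : ℝ) (z : ℝ × ℝ) : Jet (fun _ => c) z ⟨0, 0, 0, 0, 0⟩ := fun a1 a2 =>
  (J.const c).congr_vals (by simp) (by simp)

lemma exists_small (B g ζ0 : ℝ) (hB : 0 ≤ B) (hg : 0 < g) (hζ0 : 0 < ζ0) :
    ∃ ζ : ℝ, 0 < ζ ∧ ζ ≤ ζ0 ∧ ζ * B < g := by
  refine ⟨min ζ0 (g / (B + 1)), lt_min hζ0 (by positivity), min_le_left _ _, ?_⟩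
  calc min ζ0 (g / (B + 1)) * B ≤ g / (B + 1) * B := by gcongr; exact min_le_right _ _
    _ < g / (B + 1) * (B + 1) := by gcongr; linarith
    _ = g := by field_simp

lemma sqpow_cont {γ : ℝ} (hγ : 0 ≤ γ) (p : (ℝ × ℝ) × (ℝ × ℝ)) :
    ContinuousAt (fun p : (ℝ × ℝ) × (ℝ × ℝ) => (sq p.1 p.2) ^ (γ / 2)) p :=
  continuous_sq2.continuousAt.rpow_const (Or.inr (by positivity))

theorem holder1 {W : ℝ × ℝ → ℝ} {x1 y1 : ℝ × ℝ} {κ0 α ε γ : ℝ} (H : Sol W x1 3 κ0 α ε)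
    (hα : 0 ≤ α) (hκ : 1 < κ0) (hγ2 : 1 / 2 ≤ γ) (hγ : γ < 1) (hε : 0 ≤ ε) (hε1 : 6 * ε ≤ κ0 - 1)
    (hε2 : 200 * ε ≤ 1 - γ) (hx : 0 < x1.2) (hy : 0 < y1.2) (hxy : sq y1 x1 ≤ 1) :
    W x1 - W y1 ≤ (8 * (40 + 8 * κ0) + 1) / (1 - γ) * (sq x1 y1) ^ (γ / 2) := by
  by_contra hcon
  push Not at hcon
  have hg1 : 0 < 1 - γ := by linarith
  set K := (8 * (40 + 8 * κ0) + 1) / (1 - γ) with hK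
  have hK1 : 1 ≤ K := by
    rw [hK, le_div_iff₀ hg1]; linarith
  have hKg : K * (1 - γ) = 8 * (40 + 8 * κ0) + 1 := by rw [hK]; field_simp
  clear_value K
  set c := Real.log (x1.2 + 2) with hc
  have bn : ∀ z : ℝ × ℝ, 0 < z.2 → sq z x1 ≤ 4 → 0 ≤ bar c z := fun z hz h =>
    bar_nonneg hz (sq_snd_le (by norm_num) (h.trans (by norm_num)))
  have hb1 := bn x1 hx (by rw [sq_self]; norm_num)
  have hb2 := bn y1 hy (by linarith)
  obtain ⟨ζ, hζ, hζ1, hζB⟩ := exists_small (bar c x1 + bar c y1)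
    (W x1 - W y1 - K * (sq x1 y1) ^ (γ / 2)) 1 (by linarith) (by linarith) one_pos
  have hs0 : ∀ z : ℝ × ℝ, 0 < z.2 → sq z x1 ≤ 4 → ContinuousAt W z ∧ 0 < W z ∧ W z ≤ 1 :=
    fun z hz h => let q := H z hz (by linarith); ⟨q.1, q.2.1, q.2.2.1⟩
  obtain ⟨x, y, hx2, hy2, hxl, hyl, hFp, hmax⟩ := two_point_max (c := x1) (p := x1) (p' := y1)
    (F := fun p : (ℝ × ℝ) × (ℝ × ℝ) =>
      (fun z => (W z + (-4) * sq z x1) + (-ζ) * bar c z) p.1 - (fun z => W z + ζ * bar c z) p.2 -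
        K * ((sq p.1 p.2) ^ (γ / 2) * (fun _ => 1) p.1))
    (l := 1) (l' := 4) (r0 := Real.exp (c - 1 / ζ)) (Real.exp_pos _)
    (by
      intro x y hx hxl hy hyl
      have w1 := (hs0 x hx (by linarith)).1
      have w2 := (hs0 y hy hyl).1
      have b1 := bar_cont (c := c) hx
      have b2 := bar_cont (c := c) hy
      have q1 := (continuous_sq x1).continuousAt (x := x)
      have q2 := sqpow_cont (γ := γ) (by linarith) (x, y)
      have f1 : ContinuousAt (fun z => (W z + (-4) * sq z x1) + (-ζ) * bar c z) x :=
        (w1.add (q1.const_mul _)).add (b1.const_mul _)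
      have f2 : ContinuousAt (fun z => W z + ζ * bar c z) y := w2.add (b2.const_mul _)
      refine ContinuousAt.sub (ContinuousAt.sub ?_ ?_) ?_
      · exact ContinuousAt.comp (f := Prod.fst) (x := (x, y)) f1 continuousAt_fst
      · exact ContinuousAt.comp (f := Prod.snd) (x := (x, y)) f2 continuousAt_snd
      · exact (q2.mul continuousAt_const).const_mul _)
    (by
      intro x y hx hxl hy hyl h
      obtain ⟨-, w1, w2⟩ := hs0 x hx (by linarith)
      obtain ⟨-, w3, w4⟩ := hs0 y hy hyl
      have b1 := mul_nonneg hζ.le (bn x hx (by linarith))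
      have b2 := mul_nonneg hζ.le (bn y hy hyl)
      have q0 := sq_nonneg' x x1
      have q1 : 0 ≤ K * ((sq x y) ^ (γ / 2)) := mul_nonneg (by linarith)
        (Real.rpow_nonneg (sq_nonneg' x y) _)
      simp only
      rcases h with h | h | h | h
      · linarith
      · have h1 : 1 ≤ sq x y := by
          by_contra hlt
          push Not at hlt
          have := sq_tri_lt (x := y) (y := x) (z := x1) (s := 1) (t := 1) one_pos zero_le_one
            (by rw [sq_comm']; linarith) (by linarith)
          linarith
        have h2 : 1 ≤ (sq x y) ^ (γ / 2) := Real.one_le_rpow h1 (by linarith)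
        have h3 : K * 1 ≤ K * (sq x y) ^ (γ / 2) := by gcongr
        linarith
      · have := bar_large (M := 1) hζ rfl hx h
        linarith
      · have := bar_large (M := 1) hζ rfl hy h
        linarith)
    hx (by rw [sq_self]; norm_num) hy (by linarith)
    (by simp only [sq_self]; linarith)
  simp only at hFp
  obtain ⟨-, w1, w2, jx, o, hjx, ho, hex⟩ := H x hx2 (by linarith)
  obtain ⟨-, w3, w4, jy, o', hjy, ho', hey⟩ := H y hy2 (by linarith)
  have b1 := mul_nonneg hζ.le (bn x hx2 (by linarith))
  have b2 := mul_nonneg hζ.le (bn y hy2 (by linarith))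
  have q0 := sq_nonneg' x x1
  have hqpos : 0 < sq x y := by
    rcases (sq_nonneg' x y).lt_or_eq with h | h
    · exact h
    · have hxy' := sq_eq_zero h.symm
      subst hxy'
      rw [sq_self, Real.zero_rpow (by linarith)] at hFp
      linarith
  have hq1 : sq x y < 1 := by
    by_contra h
    push Not at h
    have h2 : 1 ≤ (sq x y) ^ (γ / 2) := Real.one_le_rpow h (by linarith)
    have h3 : K * 1 ≤ K * (sq x y) ^ (γ / 2) := by gcongr
    linarith
  have hj1 := (hjx.add ((jet_sq x x1).smul (-4))).add ((jet_bar c x hx2).smul (-ζ))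
  have hj2 := hjy.add ((jet_bar c y hy2).smul ζ)
  have eng := engine hj1 hj2 (jet_const 1 x) hqpos (μ := 1) (η := 0) (ε := ε) (κ0 := κ0) hmax ho ho'
    hx2 hy2 (by linarith) one_pos hγ hγ2 le_rfl (by norm_num) zero_le_one le_rfl hε (by linarith)
    hκ (by simp) (by intro a1 a2; simp) (by simp) rfl rfl rfl
  obtain ⟨-, -, -, -, eng⟩ := eng
  simp only [Op.L_add, Op.L_smul] at eng
  have B1 := L_bar ho hx2 hε (by linarith) hε1
  have B2 := L_bar ho' hy2 hε (by linarith) hε1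
  have B1' : o.L ⟨0, -(1 / x.2), 0, 0, 1 / x.2 ^ 2⟩ ≤ 1 :=
    B1.trans (by linarith [mul_nonneg (show 0 ≤ (κ0 - 1) / 2 by linarith) (_root_.sq_nonneg (1 / x.2))])
  have B2' : o'.L ⟨0, -(1 / y.2), 0, 0, 1 / y.2 ^ 2⟩ ≤ 1 :=
    B2.trans (by linarith [mul_nonneg (show 0 ≤ (κ0 - 1) / 2 by linarith) (_root_.sq_nonneg (1 / y.2))])
  have S1 := L_sq (w := x1) ho hx2 hx.le hε (by linarith) zero_le_one (by linarith)
  have p1 : W x ^ α ≤ 1 := Real.rpow_le_one w1.le w2 hα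
  have p2 : 0 ≤ W y ^ α := Real.rpow_nonneg w3.le _
  rw [abs_le] at hex hey
  have m1 : ζ * o.L ⟨0, -(1 / x.2), 0, 0, 1 / x.2 ^ 2⟩ ≤ 1 := by
    refine (mul_le_mul_of_nonneg_left B1' hζ.le).trans (by linarith)
  have m2 : ζ * o'.L ⟨0, -(1 / y.2), 0, 0, 1 / y.2 ^ 2⟩ ≤ 1 := by
    refine (mul_le_mul_of_nonneg_left B2' hζ.le).trans (by linarith)
  have hsq : √(sq x y) ≤ 1 := Real.sqrt_le_one.mpr hq1.le
  have hsq0 := Real.sqrt_nonneg (sq x y)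
  have hN : K * (1 / 2) ≤ K * γ * sq x y ^ (γ / 2 - 1) * 1 := by
    have : 1 ≤ sq x y ^ (γ / 2 - 1) :=
      Real.one_le_rpow_of_pos_of_le_one_of_nonpos hqpos hq1.le (by linarith)
    rw [mul_one, mul_assoc]
    refine mul_le_mul_of_nonneg_left ?_ (by linarith)
    calc 1 / 2 ≤ γ * 1 := by linarith
      _ ≤ _ := by gcongr
  set N := K * γ * sq x y ^ (γ / 2 - 1) * 1
  have f1 : N * ((1 + κ0) * (1 - 1) ^ 2 - (1 - γ) / 2 + (31 + 6 * √(sq x y)) * ε +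
      (24 + 2 * κ0) * 0) ≤ N * (- (1 - γ) / 4) := by
    refine mul_le_mul_of_nonneg_left ?_ (by linarith)
    have : √(sq x y) * ε ≤ 1 * ε := by gcongr
    linarith
  have f2 : K * (1 / 2) * (1 - γ) ≤ N * (1 - γ) := mul_le_mul_of_nonneg_right hN hg1.le
  linarith

end Deg

open Filter Topology

namespace Deg

lemma jet_sqpow {z w : ℝ × ℝ} (hD : 0 < sq z w) (e : ℝ) :
    Jet (fun x => (sq x w) ^ e) z ((Jt.mk (2 * (z.1 - w.1)) (2 * (z.2 - w.2)) 2 0 2).cmp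
      (e * sq z w ^ (e - 1)) (e * ((e - 1) * sq z w ^ (e - 1 - 1)))) := by
  refine (jet_sq z w).cmp (ψ := fun t => t ^ e) (ψ' := fun t => e * t ^ (e - 1)) ?_ ?_
  · filter_upwards [lt_mem_nhds hD] with t ht
    exact Real.hasDerivAt_rpow_const (Or.inl ht.ne')
  · exact (Real.hasDerivAt_rpow_const (Or.inl hD.ne')).const_mul _

theorem lower_bound {W : ℝ × ℝ → ℝ} {z0 : ℝ × ℝ} {κ0 α ε q R ρ1 : ℝ} (H : Sol W z0 (9 * R) κ0 α ε)
    (hκ : 1 < κ0) (hq : κ0 < q) (hR : 1 ≤ R) (hρ : 0 < ρ1) (hρ1 : ρ1 ≤ 1) (hz0 : 0 < z0.2)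
    (hW : ∀ z : ℝ × ℝ, 0 < z.2 → sq z z0 ≤ ρ1 ^ 2 → 1 / 4 ≤ W z)
    (hε : 0 ≤ ε) (hε1 : 6 * ε ≤ κ0 - 1) (hε4 : ε ≤ 1 / 4)
    (hε2 : (14 + 4 * q + 32 * R) * ε ≤ q - κ0)
    (hε3 : ε < (ρ1 ^ 2) ^ (q / 2) / 4 * (q / 2 * (64 * R ^ 2) ^ (-(q / 2) - 1) * (q - κ0)))
    {z : ℝ × ℝ} (hz : 0 < z.2) (hzR : sq z z0 ≤ 16 * R ^ 2) :
    (ρ1 ^ 2) ^ (q / 2) / 4 * ((16 * R ^ 2) ^ (-(q / 2)) - (64 * R ^ 2) ^ (-(q / 2))) ≤ W z := by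
  set c := (ρ1 ^ 2) ^ (q / 2) / 4 with hc
  have hcp : 0 < c := by positivity
  have hq0 : 0 < q := by linarith
  have hcρ : ∀ D : ℝ, ρ1 ^ 2 ≤ D → c * D ^ (-(q / 2)) ≤ 1 / 4 := fun D hD => by
    have : D ^ (-(q / 2)) ≤ (ρ1 ^ 2) ^ (-(q / 2)) :=
      Real.rpow_le_rpow_of_nonpos (by positivity) hD (by linarith)
    calc c * D ^ (-(q / 2)) ≤ c * (ρ1 ^ 2) ^ (-(q / 2)) := by gcongr
      _ = 1 / 4 * ((ρ1 ^ 2) ^ (q / 2) * (ρ1 ^ 2) ^ (-(q / 2))) := by rw [hc]; ring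
      _ = 1 / 4 := by rw [← Real.rpow_add (by positivity)]; simp
  have hρR : ρ1 ^ 2 ≤ 16 * R ^ 2 := by
    have : ρ1 ^ 2 ≤ 1 := pow_le_one₀ hρ.le hρ1
    have : 1 ≤ R ^ 2 := one_le_pow₀ hR
    linarith
  have h64 : 0 ≤ c * (64 * R ^ 2) ^ (-(q / 2)) := by positivity
  have hR2 : 0 < R ^ 2 := by positivity
  have e64 : (64 * R ^ 2) = (8 * R) ^ 2 := by ring
  by_cases hsm : sq z z0 ≤ ρ1 ^ 2
  · have h1 := hcρ _ hρR
    have h2 := hW z hz hsm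
    linarith
  push Not at hsm
  by_contra hcon
  push Not at hcon
  have hzp : 0 < sq z z0 := by have : 0 < ρ1 ^ 2 := by positivity
                               linarith
  have hmon : c * (16 * R ^ 2) ^ (-(q / 2)) ≤ c * (sq z z0) ^ (-(q / 2)) :=
    mul_le_mul_of_nonneg_left (Real.rpow_le_rpow_of_nonpos hzp hzR (by linarith)) hcp.le
  set cc := Real.log (z0.2 + 8 * R) with hcc
  have bn : ∀ z : ℝ × ℝ, 0 < z.2 → sq z z0 ≤ 64 * R ^ 2 → 0 ≤ bar cc z := fun z hz h =>
    bar_nonneg hz (sq_snd_le (by linarith) (by linarith))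
  obtain ⟨ζ, hζ, hζ1, hζB⟩ := exists_small (bar cc z)
    (c * (sq z z0) ^ (-(q / 2)) - c * (64 * R ^ 2) ^ (-(q / 2)) - W z)
    (c * (q / 2 * (64 * R ^ 2) ^ (-(q / 2) - 1) * (q - κ0)) - ε)
    (bn z hz (by linarith)) (by linarith) (by linarith)
  have hs0 : ∀ z : ℝ × ℝ, 0 < z.2 → sq z z0 ≤ 64 * R ^ 2 → sq z z0 < (9 * R) ^ 2 :=
    fun z hz h => h.trans_lt (by rw [mul_pow]; linarith)
  obtain ⟨x, hx2, hxa, hxb, hF, hmax⟩ := one_point_max (c := z0) (p := z)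
    (F := fun z => (c * (sq z z0) ^ (-(q / 2)) + (-(c * (64 * R ^ 2) ^ (-(q / 2))))) +
      ((-1) * W z + (-ζ) * bar cc z)) (la := ρ1 ^ 2) (lb := 64 * R ^ 2)
    (r0 := Real.exp (cc - 1 / ζ)) (Real.exp_pos _)
    (by
      intro x hx h1 h2
      have hD : 0 < sq x z0 := lt_of_lt_of_le (by positivity) h1
      have q2 : ContinuousAt (fun z => (sq z z0) ^ (-(q / 2))) x :=
        (continuous_sq z0).continuousAt.rpow_const (Or.inl hD.ne')
      exact ((q2.const_mul _).add continuousAt_const).add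
        (((H x hx (hs0 x hx h2)).1.const_mul _).add ((bar_cont hx).const_mul _)))
    (by
      intro x hx h1 h2 h
      have k1 := (H x hx (hs0 x hx h2)).2.1
      have k2 := mul_nonneg hζ.le (bn x hx h2)
      have k3 := hcρ _ h1
      rcases h with h | h | h
      · have := hW x hx h.le
        linarith
      · rw [h]; linarith
      · have := bar_large (M := 1) hζ rfl hx h
        linarith)
    hz hsm.le (by linarith) (by linarith)
  obtain ⟨-, w1, w2, jx, o, hjx, ho, hex⟩ := H x hx2 (hs0 x hx2 hxb.le)
  have hD : 0 < sq x z0 := lt_trans (by positivity) hxa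
  have hj := ((((jet_sqpow hD (-(q / 2))).smul c).add
    (jet_const (-(c * (64 * R ^ 2) ^ (-(q / 2)))) x))).add
    ((hjx.smul (-1)).add ((jet_bar cc x hx2).smul (-ζ)))
  have hL := hj.max_L hmax ho (by linarith)
  simp only [Op.L_add, Op.L_smul, Op.L_cmp] at hL
  have L0 : o.L ⟨0, 0, 0, 0, 0⟩ = 0 := by simp [Op.L]
  rw [L0] at hL
  have B1 := L_bar ho hx2 hε (by linarith) hε1
  have B1' : o.L ⟨0, -(1 / x.2), 0, 0, 1 / x.2 ^ 2⟩ ≤ 1 :=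
    B1.trans (by linarith [mul_nonneg (show 0 ≤ (κ0 - 1) / 2 by linarith) (_root_.sq_nonneg (1 / x.2))])
  have B2 := mul_le_mul_of_nonneg_left B1' hζ.le
  have S1 := L_sq (w := z0) ho hx2 hz0.le hε (by linarith) (show 0 ≤ 8 * R by linarith) (by linarith)
  have Q1 := (Q_lower ho ⟨2 * (x.1 - z0.1), 2 * (x.2 - z0.2), 2, 0, 2⟩).1
  have eD : (2 * (x.1 - z0.1)) ^ 2 + (2 * (x.2 - z0.2)) ^ 2 = 4 * sq x z0 := by unfold sq; ring
  simp only [eD] at Q1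
  have p2 : 0 ≤ W x ^ α := Real.rpow_nonneg w1.le _
  rw [abs_le] at hex
  set D := sq x z0
  set E := D ^ (-(q / 2) - 1) with hE
  have hEp : 0 < E := Real.rpow_pos_of_pos hD _
  have hEE : D ^ (-(q / 2) - 1 - 1) = E / D := by rw [Real.rpow_sub_one hD.ne']
  rw [hEE] at hL
  have hE2 : (64 * R ^ 2) ^ (-(q / 2) - 1) ≤ E :=
    Real.rpow_le_rpow_of_nonpos hD hxb.le (by linarith)
  have key : q / 2 * E * (q - κ0) ≤
      -(q / 2) * E * o.L ⟨2 * (x.1 - z0.1), 2 * (x.2 - z0.2), 2, 0, 2⟩ +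
      -(q / 2) * ((-(q / 2) - 1) * (E / D)) *
        o.Q ⟨2 * (x.1 - z0.1), 2 * (x.2 - z0.2), 2, 0, 2⟩ := by
    have a1 := mul_le_mul_of_nonneg_left S1 (show 0 ≤ q / 2 * E by positivity)
    have a2 := mul_le_mul_of_nonneg_left Q1 (show 0 ≤ q / 2 * ((q / 2 + 1) * (E / D)) by positivity)
    have a3 : q / 2 * ((q / 2 + 1) * (E / D)) * ((1 - 2 * ε) * (4 * D)) =
        q / 2 * E * ((q / 2 + 1) * ((1 - 2 * ε) * 4)) := by field_simp
    rw [a3] at a2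
    have a4 := mul_le_mul_of_nonneg_left hε2 (show 0 ≤ q / 2 * E by positivity)
    linarith
  have k2 := mul_le_mul_of_nonneg_left key hcp.le
  have k3 : c * (q / 2 * (64 * R ^ 2) ^ (-(q / 2) - 1) * (q - κ0)) ≤ c * (q / 2 * E * (q - κ0)) := by
    have : 0 ≤ q - κ0 := by linarith
    gcongr
  have k4 : 0 < ζ * ((κ0 - 1) / 2 * (1 / x.2) ^ 2) :=
    mul_pos hζ (mul_pos (by linarith) (pow_pos (by positivity) 2))
  have k5 := mul_le_mul_of_nonneg_left B1 hζ.le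
  linarith

end Deg

open Filter Topology

namespace Deg

def VSol (v : ℝ × ℝ → ℝ) (z0 : ℝ × ℝ) (ρ κ0 k ε : ℝ) : Prop :=
  ∀ z : ℝ × ℝ, 0 < z.2 → sq z z0 < ρ ^ 2 → ContinuousAt v z ∧ 1 ≤ v z ∧
    ∃ (j : Jt) (o : Op), Jet v z j ∧ OpClose o z.2 κ0 ε ∧
      |v z * o.L j - ((k + 1) * o.Q j + 1 / k)| ≤ ε

lemma OpClose.mono {o : Op} {r κ0 ε ε1 : ℝ} (h : OpClose o r κ0 ε) (h1 : ε ≤ ε1) :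
    OpClose o r κ0 ε1 := by
  obtain ⟨o1, o2, o3, o4, κ, β, o5, o6, o7⟩ := h
  exact ⟨o1.trans h1, o2.trans h1, o3.trans h1, o4.trans h1, κ, β, o5, o6.trans h1, o7.trans h1⟩

lemma toV {W : ℝ × ℝ → ℝ} {z0 : ℝ × ℝ} {ρ κ0 k ε ε1 w0 : ℝ} (hk : 0 < k)
    (H : Sol W z0 ρ κ0 (1 + 2 / k) ε) (hw0 : 0 < w0) (hε0 : 0 ≤ ε) (hε : ε ≤ ε1)
    (hw : ∀ z : ℝ × ℝ, 0 < z.2 → sq z z0 < ρ ^ 2 → w0 ≤ W z)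
    (hε1 : w0 ^ (-(2 / k) - 1) * ε ≤ k * ε1) :
    VSol (fun z => W z ^ (-(1 / k))) z0 ρ κ0 k ε1 := by
  intro z hz hzr
  obtain ⟨hc, w1, w2, j, o, hj, ho, he⟩ := H z hz hzr
  have hwz := hw z hz hzr
  set e := -(1 / k) with hedef
  have hj' := hj.cmp (ψ := fun t => t ^ e) (ψ' := fun t => e * t ^ (e - 1))
    (ψ2 := e * ((e - 1) * W z ^ (e - 1 - 1)))
    (by filter_upwards [lt_mem_nhds w1] with t ht using Real.hasDerivAt_rpow_const (Or.inl ht.ne'))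
    ((Real.hasDerivAt_rpow_const (Or.inl w1.ne')).const_mul _)
  refine ⟨hc.rpow_const (Or.inl w1.ne'), ?_, _, o, hj', ho.mono hε, ?_⟩
  · exact Real.one_le_rpow_of_pos_of_le_one_of_nonpos w1 w2 (by rw [hedef]; simp [hk.le])
  · rw [Op.L_cmp, Op.Q_cmp]
    set w := W z
    have p1 : w ^ (e - 1) = w ^ e / w := Real.rpow_sub_one w1.ne' _
    have p2 : w ^ (e - 1 - 1) = w ^ e / w / w := by rw [Real.rpow_sub_one w1.ne', p1]
    have p3 : w ^ (-(2 / k) - 1) = (w ^ e) ^ 2 / w := by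
      rw [Real.rpow_sub_one w1.ne', ← Real.rpow_natCast, ← Real.rpow_mul w1.le]
      congr 2
      rw [hedef]; push_cast; ring
    have p4 : w ^ (1 + 2 / k) = w / (w ^ e) ^ 2 := by
      rw [Real.rpow_add w1, Real.rpow_one, ← Real.rpow_natCast, ← Real.rpow_mul w1.le,
        eq_div_iff (Real.rpow_pos_of_pos w1 _).ne', mul_assoc, ← Real.rpow_add w1]
      have : 2 / k + e * ((2:ℕ):ℝ) = 0 := by rw [hedef]; push_cast; ring
      rw [this, Real.rpow_zero, mul_one]
    have hwe : 0 < w ^ e := Real.rpow_pos_of_pos w1 _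
    have main : w ^ e * (e * w ^ (e - 1) * o.L j + e * ((e - 1) * w ^ (e - 1 - 1)) * o.Q j) -
        ((k + 1) * ((e * w ^ (e - 1)) ^ 2 * o.Q j) + 1 / k) =
        -(1 / k * (w ^ (-(2 / k) - 1) * (o.L j + w ^ (1 + 2 / k)))) := by
      rw [p1, p2, p3, p4]
      generalize w ^ e = P at *
      rw [hedef]
      field_simp
      ring
    rw [main, abs_neg, abs_mul, abs_mul, abs_of_pos (by positivity : 0 < 1 / k),
      abs_of_pos (Real.rpow_pos_of_pos w1 _)]
    have m1 : w ^ (-(2 / k) - 1) ≤ w0 ^ (-(2 / k) - 1) :=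
      Real.rpow_le_rpow_of_nonpos hw0 hwz (by have : 0 < 2 / k := by positivity
                                              linarith)
    calc 1 / k * (w ^ (-(2 / k) - 1) * |o.L j + w ^ (1 + 2 / k)|)
        ≤ 1 / k * (w0 ^ (-(2 / k) - 1) * ε) := by gcongr
      _ ≤ 1 / k * (k * ε1) := by gcongr
      _ = ε1 := by field_simp

theorem claim0 {v : ℝ × ℝ → ℝ} {z0 : ℝ × ℝ} {κ0 k ε ρ0 δ K γ l : ℝ} (hk : 0 < k)
    (H : VSol v z0 2 κ0 k ε) (hκ : 1 < κ0) (hε : 0 ≤ ε) (hε1 : 6 * ε ≤ κ0 - 1) (hε4 : ε ≤ 1 / 4)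
    (hz0 : 0 < z0.2) (hρ : 0 < ρ0) (hρ1 : ρ0 ≤ 1) (hδ : 0 < δ) (hδ1 : δ < 1) (hK : 0 < K) (hγ : 0 < γ)
    (hl : 0 < l) (hv0 : v z0 ≤ 1 + δ)
    (hB : (√(2 * δ) + K * (ρ0 ^ 2) ^ (γ / 2)) ^ 2 ≤ l * ρ0 ^ 2)
    (hA : l * (4 + 2 * κ0 + 10 * ε) * (1 + l * ρ0 ^ 2) < 1 / k - ε) :
    ∃ x : ℝ × ℝ, 0 < x.2 ∧ sq x z0 ≤ ρ0 ^ 2 ∧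
      K * (sq x z0) ^ (γ / 2) < √(v x - (1 - δ)) - √(v z0 - (1 - δ)) := by
  by_contra hcon
  push Not at hcon
  have hρ2 : ρ0 ^ 2 ≤ 1 := pow_le_one₀ hρ.le hρ1
  have hin : ∀ x : ℝ × ℝ, sq x z0 ≤ ρ0 ^ 2 → sq x z0 < 2 ^ 2 := fun x hx => by linarith
  have hv1 := (H z0 hz0 (by rw [sq_self]; norm_num)).2.1
  have vb : ∀ x : ℝ × ℝ, 0 < x.2 → sq x z0 ≤ ρ0 ^ 2 → v x ≤ 1 - δ + l * ρ0 ^ 2 := by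
    intro x hx hxr
    have h1 := hcon x hx hxr
    have h2 : √(v z0 - (1 - δ)) ≤ √(2 * δ) := Real.sqrt_le_sqrt (by linarith)
    have h3 : (sq x z0) ^ (γ / 2) ≤ (ρ0 ^ 2) ^ (γ / 2) :=
      Real.rpow_le_rpow (sq_nonneg' _ _) hxr (by linarith)
    have h4 : √(v x - (1 - δ)) ≤ √(2 * δ) + K * (ρ0 ^ 2) ^ (γ / 2) := by
      have := mul_le_mul_of_nonneg_left h3 hK.le
      linarith
    have h5 := (H x hx (hin x hxr)).2.1
    have h6 : √(v x - (1 - δ)) ^ 2 ≤ (√(2 * δ) + K * (ρ0 ^ 2) ^ (γ / 2)) ^ 2 := by gcongr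
    rw [Real.sq_sqrt (by linarith)] at h6
    linarith
  set c := Real.log (z0.2 + ρ0)
  have bn : ∀ z : ℝ × ℝ, 0 < z.2 → sq z z0 ≤ ρ0 ^ 2 → 0 ≤ bar c z := fun z hz h =>
    bar_nonneg hz (sq_snd_le hρ.le h)
  have hvb : 0 < 1 + l * ρ0 ^ 2 := by positivity
  have hA' : 0 < (1 / k - ε) / (1 + l * ρ0 ^ 2) - l * (4 + 2 * κ0 + 10 * ε) := by
    rw [sub_pos, lt_div_iff₀ hvb]; exact hA
  obtain ⟨ζ, hζ, hζ1, hζB⟩ := exists_small (bar c z0) δ _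
    (bn z0 hz0 (by rw [sq_self]; positivity)) hδ (half_pos hA')
  obtain ⟨x, hx2, -, hxb, hF, hmax⟩ := one_point_max (c := z0) (p := z0)
    (F := fun z => (v z + (-(v z0 - δ))) + ((-l) * sq z z0 + (-ζ) * bar c z)) (la := -1)
    (lb := ρ0 ^ 2) (r0 := Real.exp (c - (1 + l * ρ0 ^ 2) / ζ)) (Real.exp_pos _)
    (by
      intro x hx _ h2
      exact ((H x hx (hin x h2)).1.add continuousAt_const).add
        (((continuous_sq z0).continuousAt.const_mul _).add ((bar_cont hx).const_mul _)))
    (by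
      intro x hx h1 h2 h
      have k0 := vb x hx h2
      have k2 := mul_nonneg hζ.le (bn x hx h2)
      have k3 := mul_nonneg hl.le (sq_nonneg' x z0)
      rcases h with h | h | h
      · linarith [sq_nonneg' x z0]
      · rw [h]; linarith
      · have := bar_large hζ rfl hx h
        linarith)
    hz0 (by rw [sq_self]; norm_num) (by rw [sq_self]; positivity) (by
      simp only [sq_self]; linarith)
  obtain ⟨-, w1, j, o, hj, ho, he⟩ := H x hx2 (hin x hxb.le)
  have hJ := (hj.add (jet_const (-(v z0 - δ)) x)).add
    (((jet_sq x z0).smul (-l)).add ((jet_bar c x hx2).smul (-ζ)))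
  have hL := hJ.max_L hmax ho (by linarith)
  simp only [Op.L_add, Op.L_smul] at hL
  have L0 : o.L ⟨0, 0, 0, 0, 0⟩ = 0 := by simp [Op.L]
  rw [L0] at hL
  have B1 := L_bar ho hx2 hε (by linarith) hε1
  have B1' : o.L ⟨0, -(1 / x.2), 0, 0, 1 / x.2 ^ 2⟩ ≤ 1 :=
    B1.trans (by linarith [mul_nonneg (show 0 ≤ (κ0 - 1) / 2 by linarith) (_root_.sq_nonneg (1 / x.2))])
  have B2 := mul_le_mul_of_nonneg_left B1' hζ.le
  have S1 := L_sq (w := z0) ho hx2 hz0.le hε (by linarith) (show (0:ℝ) ≤ 1 by norm_num) (by linarith)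
  have S2 := mul_le_mul_of_nonneg_left S1 hl.le
  have Q1 := (Q_lower ho j).1
  have Q2 : 0 ≤ (k + 1) * o.Q j := by
    refine mul_nonneg (by linarith) (le_trans ?_ Q1)
    exact mul_nonneg (by linarith) (by positivity)
  rw [abs_le] at he
  have v1 : v x ≤ 1 + l * ρ0 ^ 2 := by linarith [vb x hx2 hxb.le]
  have hke : 0 < 1 / k - ε := lt_trans (by positivity) hA
  have fin : (1 / k - ε) / (1 + l * ρ0 ^ 2) ≤ o.L j := by
    rw [div_le_iff₀ hvb]
    have h1 : 1 / k - ε ≤ v x * o.L j := by linarith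
    have h2 : 0 < o.L j := by
      by_contra hn
      have := mul_nonpos_of_nonneg_of_nonpos (show 0 ≤ v x by linarith) (not_lt.mp hn)
      linarith
    rw [mul_comm]
    exact h1.trans (mul_le_mul_of_nonneg_right v1 h2.le)
  linarith

end Deg

open Filter Topology

namespace Deg

/-- the equation for `V = √(v - ν)` -/
lemma jetV {v : ℝ × ℝ → ℝ} {z : ℝ × ℝ} {k ε ν K : ℝ} (hk : 0 < k) (hK : 0 < K)
    (hν : ν = 1 / (4 * k * (k + 1) * K ^ 2)) (hz : ν < v z) {j : Jt} {o : Op} (hj : Jet v z j)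
    (he : |v z * o.L j - ((k + 1) * o.Q j + 1 / k)| ≤ ε) :
    ∃ i : Jt, Jet (fun z => √(v z - ν)) z i ∧
      |2 * √(v z - ν) * v z * o.L i - ((4 * k + 2) * v z * o.Q i + 4 * (k + 1) * ν * (K ^ 2 - o.Q i))|
        ≤ ε := by
  have hx : 0 < v z - ν := by linarith
  have hX : 0 < √(v z - ν) := Real.sqrt_pos.mpr hx
  have hd : ∀ t : ℝ, ν < t → HasDerivAt (fun t => √(t - ν)) (1 / (2 * √(t - ν))) t := fun t ht =>
    ((hasDerivAt_id t).sub_const ν).sqrt (by simp only [id]; linarith)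
  have hd2 : HasDerivAt (fun t => 1 / (2 * √(t - ν))) (-(1 / (4 * √(v z - ν) ^ 3))) (v z) := by
    have h1 := ((hd _ hz).const_mul 2).inv (by positivity)
    refine (h1.congr_deriv ?_).congr_of_eventuallyEq (Eventually.of_forall fun t => ?_)
    · field_simp; ring
    · simp
  have hj' := hj.cmp (ψ := fun t => √(t - ν)) (ψ' := fun t => 1 / (2 * √(t - ν)))
    (by filter_upwards [lt_mem_nhds hz] with t ht using hd t ht) hd2
  refine ⟨_, hj', ?_⟩
  rw [Op.L_cmp, Op.Q_cmp]
  have e1 : v z = √(v z - ν) ^ 2 + ν := by rw [Real.sq_sqrt hx.le]; ring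
  have e2 : 1 / k = 4 * (k + 1) * K ^ 2 * ν := by rw [hν]; field_simp
  rw [e2] at he
  generalize √(v z - ν) = X at *
  rw [e1] at he ⊢
  refine le_trans (le_of_eq ?_) he
  congr 1
  field_simp
  ring

lemma low1 {X v L G p2 k ν K2 ε E : ℝ} (hv : 1 ≤ v) (hν : 0 ≤ ν) (hνv : ν ≤ v) (hk : 0 < k)
    (he : |2 * X * v * L - ((4 * k + 2) * v * G + 4 * (k + 1) * ν * (K2 - G))| ≤ ε)
    (hG : |G - p2| ≤ E) :
    |X * L - ((2 * k + 1) * p2 + 2 * (k + 1) * (ν / v) * (K2 - p2))| ≤ (4 * k + 3) * E + ε / 2 := by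
  have hv0 : 0 < v := by linarith
  have hE : 0 ≤ E := (abs_nonneg _).trans hG
  have hε : 0 ≤ ε := (abs_nonneg _).trans he
  have t0 : 0 ≤ ν / v := by positivity
  have t1 : ν / v ≤ 1 := (div_le_one hv0).mpr hνv
  have e : X * L - ((2 * k + 1) * p2 + 2 * (k + 1) * (ν / v) * (K2 - p2)) =
      ((2 * k + 1) - 2 * (k + 1) * (ν / v)) * (G - p2) +
      (2 * X * v * L - ((4 * k + 2) * v * G + 4 * (k + 1) * ν * (K2 - G))) / (2 * v) := by
    field_simp; ring
  rw [e]
  refine (abs_add_le _ _).trans (add_le_add ?_ ?_)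
  · rw [abs_mul]
    refine mul_le_mul ?_ hG (abs_nonneg _) (by linarith)
    have := mul_nonneg (show 0 ≤ 2 * (k + 1) by linarith) t0
    have := mul_le_mul_of_nonneg_left t1 (show 0 ≤ 2 * (k + 1) by linarith)
    rw [abs_le]; constructor <;> linarith
  · rw [abs_div, abs_of_pos (show 0 < 2 * v by linarith), div_le_div_iff₀ (by linarith) (by norm_num)]
    have : ε * 1 ≤ ε * v := mul_le_mul_of_nonneg_left hv hε
    linarith

lemma tdiff {X Y ν : ℝ} (hY : 0 < Y) (hXY : Y ≤ X) (hν : 0 ≤ ν) :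
    |X * (ν / (X ^ 2 + ν)) - Y * (ν / (Y ^ 2 + ν))| ≤ X - Y := by
  have hX : 0 < X := by linarith
  have e : X * (ν / (X ^ 2 + ν)) - Y * (ν / (Y ^ 2 + ν)) =
      (X - Y) * (ν * (ν - X * Y) / ((X ^ 2 + ν) * (Y ^ 2 + ν))) := by
    field_simp; ring
  have a1 : 0 ≤ ν * (X * Y) := by positivity
  have a2 : 0 ≤ X ^ 2 * Y ^ 2 := by positivity
  have a3 : 0 ≤ ν * X ^ 2 := by positivity
  have a4 : 0 ≤ ν * Y ^ 2 := by positivity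
  have a5 : ν * (X * Y) ≤ ν * (X ^ 2 + Y ^ 2) :=
    mul_le_mul_of_nonneg_left (by linarith [sq_nonneg (X - Y), sq_nonneg X, sq_nonneg Y]) hν
  rw [e, abs_mul, abs_of_nonneg (by linarith : 0 ≤ X - Y)]
  refine mul_le_of_le_one_right (by linarith) ?_
  rw [abs_div, abs_of_pos (show 0 < (X ^ 2 + ν) * (Y ^ 2 + ν) by positivity),
    div_le_one (by positivity), abs_le]
  constructor <;> linarith [sq_nonneg ν]

lemma comb {X Y ν Lx Ly P q e1 e2 k : ℝ} (hY : 0 < Y) (hXY : Y ≤ X) (hν : 0 ≤ ν) (hk : 0 < k)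
    (hx : |X * Lx - (P + 2 * (k + 1) * (ν / (X ^ 2 + ν)) * q)| ≤ e1)
    (hy : |Y * Ly - (P + 2 * (k + 1) * (ν / (Y ^ 2 + ν)) * q)| ≤ e2) :
    P * (X - Y) - 2 * (k + 1) * |q| * (X - Y) - X * e1 - Y * e2 ≤ X ^ 2 * Lx - Y ^ 2 * Ly := by
  have t := tdiff hY hXY hν
  generalize ν / (X ^ 2 + ν) = tx at *
  generalize ν / (Y ^ 2 + ν) = ty at *
  have hX : 0 < X := by linarith
  have h1 := mul_le_mul_of_nonneg_left (abs_le.mp hx).1 hX.le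
  have h2 := mul_le_mul_of_nonneg_left (abs_le.mp hy).2 hY.le
  have h3 : |q * (X * tx - Y * ty)| ≤ |q| * (X - Y) := by
    rw [abs_mul]; exact mul_le_mul_of_nonneg_left t (abs_nonneg _)
  have h4 := mul_le_mul_of_nonneg_left (abs_le.mp h3).1 (show 0 ≤ 2 * (k + 1) by linarith)
  linarith

/-- gradient closeness -/
lemma grad_close {o : Op} {r κ0 ε θ p η' ζr : ℝ} (ho : OpClose o r κ0 ε) (hε : 0 ≤ ε) {i : Jt}
    {a1 a2 e1 e2 : ℝ}
    (h1 : i.p1 = a1 + e1) (h2 : i.p2 = a2 + e2) (ha : a1 ^ 2 + a2 ^ 2 = p ^ 2)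
    (he : e1 ^ 2 + e2 ^ 2 ≤ 2 * (η' * p) ^ 2 + 2 * ζr ^ 2) (hθ : 0 < θ) (hθ4 : θ ≤ 1 / 4)
    (hη : 2 * η' ^ 2 ≤ θ ^ 2) (hε8 : 8 * ε ≤ θ) :
    |o.Q i - p ^ 2| ≤ 3 * θ * p ^ 2 + 4 / θ * ζr ^ 2 := by
  obtain ⟨q1, q2⟩ := Q_lower ho i
  have hp := sq_nonneg p
  have hz := sq_nonneg ζr
  have E : e1 ^ 2 + e2 ^ 2 ≤ θ ^ 2 * p ^ 2 + 2 * ζr ^ 2 := by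
    have := mul_le_mul_of_nonneg_right hη hp
    linarith
  have hi : 0 < 1 / θ := by positivity
  have hiθ : 1 / θ * θ = 1 := by field_simp
  have hi4 : 4 ≤ 1 / θ := by rw [le_div_iff₀ hθ]; linarith
  have E' : 1 / θ * (e1 ^ 2 + e2 ^ 2) ≤ θ * p ^ 2 + 2 * (1 / θ) * ζr ^ 2 := by
    have := mul_le_mul_of_nonneg_left E hi.le
    have e : 1 / θ * (θ ^ 2 * p ^ 2 + 2 * ζr ^ 2) = θ * p ^ 2 + 2 * (1 / θ) * ζr ^ 2 := by
      field_simp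
    linarith
  have sqe : ∀ a e : ℝ, 2 * |a * e| ≤ θ * a ^ 2 + 1 / θ * e ^ 2 := by
    intro a e
    have h1 : 0 ≤ 1 / θ * (θ * |a| - |e|) ^ 2 := by positivity
    have h2 : 1 / θ * (θ * |a| - |e|) ^ 2 = θ * a ^ 2 + 1 / θ * e ^ 2 - 2 * |a * e| := by
      rw [abs_mul, ← sq_abs a, ← sq_abs e]; field_simp; ring
    linarith
  have s1 := sqe a1 e1
  have s2 := sqe a2 e2
  have c1 := abs_le.mp (le_refl |a1 * e1|)
  have c2 := abs_le.mp (le_refl |a2 * e2|)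
  have ee : 0 ≤ e1 ^ 2 + e2 ^ 2 := by positivity
  set g := i.p1 ^ 2 + i.p2 ^ 2 with hg
  have ge : g = p ^ 2 + 2 * (a1 * e1) + 2 * (a2 * e2) + (e1 ^ 2 + e2 ^ 2) := by
    rw [hg, h1, h2, ← ha]; ring
  have θa : θ * (a1 ^ 2 + a2 ^ 2) = θ * p ^ 2 := by rw [ha]
  have glo : (1 - 2 * θ) * p ^ 2 - 2 * (1 / θ) * ζr ^ 2 ≤ g := by linarith
  have tp : θ ^ 2 * p ^ 2 ≤ 1 / 4 * (θ * p ^ 2) := by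
    have := mul_le_mul_of_nonneg_right hθ4 (mul_nonneg hθ.le hp)
    linarith
  have iz : 4 * ζr ^ 2 ≤ 1 / θ * ζr ^ 2 := mul_le_mul_of_nonneg_right hi4 hz
  have ghi : g ≤ (1 + 9 / 4 * θ) * p ^ 2 + 5 / 2 * (1 / θ) * ζr ^ 2 := by linarith
  have g0 : 0 ≤ g := by rw [hg]; positivity
  have hpθ := mul_le_mul_of_nonneg_right hθ4 hp
  have hθi : θ * ((1 / θ) * ζr ^ 2) = ζr ^ 2 := by field_simp
  have d1 : 8 * ε * g ≤ θ * g := mul_le_mul_of_nonneg_right hε8 g0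
  have d2 := mul_le_mul_of_nonneg_left ghi hθ.le
  have e4 : 4 / θ * ζr ^ 2 = 4 * (1 / θ * ζr ^ 2) := by ring
  rw [e4, abs_le]
  constructor <;> linarith

/-- final contradiction, algebraic form -/
lemma final_alg {X D P q p k κ0 δ1 γ g N Z ε θ : ℝ} (hD : 0 < D) (hDX : D ≤ X) (hp : 0 < p)
    (hk : 0 < k) (hg : 0 < g) (hP : P = (2 * k + 1) * p ^ 2)
    (hmain : P * D - 2 * (k + 1) * |q| * D - X * ((4 * k + 3) * (6 * θ * p ^ 2) + 2 * ε) ≤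
      N * ((1 + κ0) * D ^ 2 - g / 4 * X ^ 2))
    (hN1 : N * D ≤ p ^ 2 * Z) (hN2 : p ^ 2 ≤ N * D) (hZ : (1 + κ0) * Z ≤ 2 * k + 1 - 8 * (k + 1) * δ1)
    (hκ : 0 < κ0) (hδ : 0 ≤ δ1)
    (hθ : θ * (96 * (4 * k + 3)) = g) (hε : 32 * ε ≤ p ^ 2 * g)
    (hq : |q| ≤ 4 * δ1 * p ^ 2 ∨ (|q| ≤ 4 * p ^ 2 ∧ 64 * (k + 1) * D ^ 2 < g * X ^ 2)) : False := by
  have hX : 0 < X := by linarith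
  have a1 : N * D * ((1 + κ0) * D) ≤ p ^ 2 * Z * ((1 + κ0) * D) :=
    mul_le_mul_of_nonneg_right hN1 (by positivity)
  have a1' : p ^ 2 * D * ((1 + κ0) * Z) ≤ p ^ 2 * D * (2 * k + 1 - 8 * (k + 1) * δ1) :=
    mul_le_mul_of_nonneg_left hZ (by positivity)
  have a2 : p ^ 2 * (g / 4 * X ^ 2 / D) ≤ N * (g / 4 * X ^ 2) := by
    have := mul_le_mul_of_nonneg_right hN2 (show 0 ≤ g / 4 * X ^ 2 / D by positivity)
    refine this.trans (le_of_eq ?_)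
    field_simp
  have a3 : X ≤ X ^ 2 / D := by
    rw [le_div_iff₀ hD, pow_two]; exact mul_le_mul_of_nonneg_left hDX hX.le
  have a4 : p ^ 2 * g / 8 * X ≤ p ^ 2 * g / 8 * (X ^ 2 / D) :=
    mul_le_mul_of_nonneg_left a3 (by positivity)
  have a5 : X * ((4 * k + 3) * (6 * θ * p ^ 2) + 2 * ε) ≤ X * (p ^ 2 * g / 8) := by
    refine mul_le_mul_of_nonneg_left ?_ hX.le
    have : (4 * k + 3) * (6 * θ * p ^ 2) = θ * (96 * (4 * k + 3)) * p ^ 2 / 16 := by ring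
    rw [this, hθ]; linarith
  have e1 : p ^ 2 * (g / 4 * X ^ 2 / D) = 2 * (p ^ 2 * g / 8 * (X ^ 2 / D)) := by ring
  have hb : 0 < p ^ 2 * g / 8 * (X ^ 2 / D) := by positivity
  rw [hP] at hmain
  rcases hq with hq | ⟨hq, hq2⟩
  · have := mul_le_mul_of_nonneg_right hq (show 0 ≤ 2 * (k + 1) * D by positivity)
    linarith
  · have h1 := mul_le_mul_of_nonneg_right hq (show 0 ≤ 2 * (k + 1) * D by positivity)
    have h2 : p ^ 2 * (8 * (k + 1) * D) < p ^ 2 * g / 8 * (X ^ 2 / D) := by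
      have : p ^ 2 * (8 * (k + 1) * D) = p ^ 2 / 8 / D * (64 * (k + 1) * D ^ 2) := by
        field_simp; ring
      rw [this]
      have h3 := mul_lt_mul_of_pos_left hq2 (show 0 < p ^ 2 / 8 / D by positivity)
      refine h3.trans_le (le_of_eq (by ring))
    have h4 : 0 ≤ p ^ 2 * D * (8 * (k + 1) * δ1) := by positivity
    linarith

/-- change of `ν` -/
lemma change_nu {a b ν ν' d c H : ℝ} (hν : ν' ≤ ν) (ha : d ≤ a - ν) (hb : d ≤ b - ν) (hd : 0 < d)
    (hc : 0 ≤ c) (h1 : ν - ν' ≤ 2 * c * d) (hH : √(a - ν') - √(b - ν') ≤ H) (hH0 : 0 ≤ H) :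
    √(a - ν) - √(b - ν) ≤ (1 + c) * H := by
  rcases le_total a b with hab | hab
  · have : √(a - ν) ≤ √(b - ν) := Real.sqrt_le_sqrt (by linarith)
    have : 0 ≤ (1 + c) * H := by positivity
    linarith
  · have key : ∀ t : ℝ, d ≤ t - ν → √(t - ν') ≤ (1 + c) * √(t - ν) := by
      intro t ht
      rw [Real.sqrt_le_left (by positivity), mul_pow, Real.sq_sqrt (by linarith)]
      have h2 : 2 * c * d ≤ 2 * c * (t - ν) := mul_le_mul_of_nonneg_left ht (by positivity)
      have h3 : 0 ≤ c ^ 2 * (t - ν) := mul_nonneg (by positivity) (by linarith)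
      linarith
    have k1 := key a ha
    have k2 := key b hb
    have f1 : (√(a - ν) - √(b - ν)) * (√(a - ν) + √(b - ν)) = a - b := by
      linarith [Real.sq_sqrt (show 0 ≤ a - ν by linarith), Real.sq_sqrt (show 0 ≤ b - ν by linarith)]
    have f2 : (√(a - ν') - √(b - ν')) * (√(a - ν') + √(b - ν')) = a - b := by
      linarith [Real.sq_sqrt (show 0 ≤ a - ν' by linarith),
        Real.sq_sqrt (show 0 ≤ b - ν' by linarith)]
    have pa : 0 < √(a - ν) := Real.sqrt_pos.mpr (by linarith)
    have pb : 0 < √(b - ν) := Real.sqrt_pos.mpr (by linarith)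
    have hs : 0 < √(a - ν) + √(b - ν) := by linarith
    have g1 : a - b ≤ H * ((1 + c) * (√(a - ν) + √(b - ν))) := by
      rw [← f2]
      exact mul_le_mul hH (by linarith) (by positivity) hH0
    refine le_of_mul_le_mul_right ?_ hs
    linarith

end Deg

open Filter Topology

namespace Deg

lemma K_close {K p t δ1 : ℝ} (hp : p = K * t) (h1 : 1 - δ1 ≤ t) (h2 : t ≤ (1 + δ1) ^ 2)
    (hδ : 0 ≤ δ1) (hδ1 : δ1 ≤ 1 / 10) : |K ^ 2 - p ^ 2| ≤ 4 * δ1 * p ^ 2 := by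
  have e : K ^ 2 - p ^ 2 = K ^ 2 * (1 - t ^ 2) := by rw [hp]; ring
  have e2 : 4 * δ1 * p ^ 2 = K ^ 2 * (4 * δ1 * t ^ 2) := by rw [hp]; ring
  rw [e, e2, abs_mul, abs_of_nonneg (sq_nonneg K)]
  refine mul_le_mul_of_nonneg_left ?_ (sq_nonneg K)
  have t2 : t ^ 2 ≤ (1 + δ1) ^ 4 := by
    have : t ^ 2 ≤ ((1 + δ1) ^ 2) ^ 2 := pow_le_pow_left₀ (by linarith) h2 2
    linarith
  have t1 : (1 - δ1) ^ 2 ≤ t ^ 2 := pow_le_pow_left₀ (by linarith) h1 2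
  have t3 : t ^ 2 * (1 - 4 * δ1) ≤ (1 + δ1) ^ 4 * (1 - 4 * δ1) :=
    mul_le_mul_of_nonneg_right t2 (by linarith)
  have t4 : (1 + δ1) ^ 4 * (1 - 4 * δ1) ≤ 1 := by
    have a : 0 ≤ δ1 ^ 2 := by positivity
    have b : 0 ≤ δ1 ^ 3 := by positivity
    have c : 0 ≤ δ1 ^ 4 := by positivity
    have d : 0 ≤ δ1 ^ 5 := by positivity
    linarith
  have t5 : (1 - δ1) ^ 2 * (1 + 4 * δ1) ≤ t ^ 2 * (1 + 4 * δ1) :=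
    mul_le_mul_of_nonneg_right t1 (by linarith)
  have t6 : 1 ≤ (1 - δ1) ^ 2 * (1 + 4 * δ1) := by
    have a : 7 * δ1 * δ1 ≤ 7 * (1 / 10) * δ1 := by
      refine mul_le_mul_of_nonneg_right ?_ hδ; linarith
    have b : 0 ≤ δ1 ^ 3 := by positivity
    linarith
  rw [abs_le]; constructor <;> linarith

lemma bar_absorb {X C ζ u θ B : ℝ} (hX : 0 ≤ X) (hζ : 0 ≤ ζ) (h : C * (4 / θ) * ζ ≤ B * X) :
    X * (C * (4 / θ * (ζ * u) ^ 2)) ≤ X ^ 2 * (ζ * (B * u ^ 2)) := by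
  have h1 := mul_le_mul_of_nonneg_right h (show 0 ≤ X * (ζ * u ^ 2) by positivity)
  linarith

lemma core2 {X Y ν K k κ0 ε γ g d δ1 ζ θ η τ σ Vm q S m s N p u w Lx Ly Gx Gy Bx By vx vy : ℝ}
    (hk : 0 < k) (hκ : 1 < κ0) (hK : 0 < K) (hν0 : 0 ≤ ν) (hd : 0 < d) (hvx : vx = X ^ 2 + ν)
    (hvy : vy = Y ^ 2 + ν) (hvx1 : 1 ≤ vx) (hvy1 : 1 ≤ vy)
    (hg : g = 1 - γ) (hγ : γ < 1) (hγ2 : 1 / 2 ≤ γ) (hε : 0 ≤ ε) (hδ : 0 ≤ δ1) (hδ1 : δ1 ≤ 1 / 10)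
    (hζ : 0 < ζ) (hθ : θ * (96 * (4 * k + 3)) = g)
    (hηg : (24 + 2 * κ0) * η ≤ g / 8) (hετ : (31 + 6 * τ) * ε ≤ g / 8)
    (hεK : 128 * ε ≤ K ^ 2 * g) (hτ : 0 < τ)
    (hlo : 1 - δ1 ≤ γ * (τ ^ 2) ^ ((γ - 1) / 2)) (hσ : 0 < σ) (hhi : σ ^ ((γ - 1) / 2) ≤ 1 + δ1)
    (hσD : 256 * (k + 1) * K ^ 2 * (σ ^ (γ / 2)) ^ 2 < g * d)
    (hZ : (1 + κ0) * ((1 + δ1) / γ) ≤ 2 * k + 1 - 8 * (k + 1) * δ1)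
    (hζ1 : (4 * k + 3) * (4 / θ) * ζ ≤ (κ0 - 1) / 2 * √d) (hζ2 : 2 * ζ * Vm ≤ ε)
    (hYd : √d ≤ Y) (hXY : Y < X) (hXm : X ≤ Vm) (hq : 0 < q) (hqτ : q ≤ τ ^ 2)
    (hS : S = q ^ (γ / 2 - 1)) (hs : s = √q) (hm1 : 1 ≤ m) (hm2 : m ≤ 1 + δ1)
    (hN : N = K * γ * S * m) (hp : p = N * s)
    (hF : K * (S * q * m) < X - Y) (hup : X - Y ≤ (1 + δ1) * (K * (S * q)))
    (hSq : q ^ (γ / 2) = S * q)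
    (Hx : |2 * X * vx * Lx - ((4 * k + 2) * vx * Gx + 4 * (k + 1) * ν * (K ^ 2 - Gx))| ≤ ε)
    (Hy : |2 * Y * vy * Ly - ((4 * k + 2) * vy * Gy + 4 * (k + 1) * ν * (K ^ 2 - Gy))| ≤ ε)
    (hGx : |Gx - p ^ 2| ≤ 3 * θ * p ^ 2 + 4 / θ * (ζ * u) ^ 2)
    (hGy : |Gy - p ^ 2| ≤ 3 * θ * p ^ 2 + 4 / θ * (ζ * w) ^ 2)
    (hBx : Bx ≤ -((κ0 - 1) / 2 * u ^ 2) + 1) (hBy : By ≤ -((κ0 - 1) / 2 * w ^ 2) + 1)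
    (eng : Lx + -ζ * Bx - (Y / X) ^ 2 * (Ly + ζ * By) ≤ N * ((1 + κ0) * (1 - Y / X) ^ 2 -
      (1 - γ) / 2 + (31 + 6 * s) * ε + (24 + 2 * κ0) * η)) : False := by
  have hd0 : 0 < √d := Real.sqrt_pos.mpr hd
  have hY0 : 0 < Y := hd0.trans_le hYd
  have hX0 : 0 < X := hY0.trans hXY
  have hD0 : 0 < X - Y := sub_pos.mpr hXY
  have hg0 : 0 < g := by rw [hg]; exact sub_pos.mpr hγ
  have hγ0 : 0 < γ := by linarith only [hγ2]
  have hm0 : 0 < m := by linarith only [hm1]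
  have hS0 : 0 < S := by rw [hS]; exact Real.rpow_pos_of_pos hq _
  have hN0 : 0 < N := by rw [hN]; positivity
  have hs0 : 0 < s := by rw [hs]; exact Real.sqrt_pos.mpr hq
  have hss : s ^ 2 = q := by rw [hs]; exact Real.sq_sqrt hq.le
  have hsτ : s ≤ τ := by
    rw [hs]; exact (Real.sqrt_le_sqrt hqτ).trans (le_of_eq (Real.sqrt_sq hτ.le))
  have hp0 : 0 < p := by rw [hp]; positivity
  have hp2 : p ^ 2 = N * (γ * (K * (S * q * m))) := by rw [hp, mul_pow, hss, hN]; ring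
  -- lower bound of the left side
  have lx := low1 hvx1 hν0 (by rw [hvx]; linarith only [sq_nonneg X]) hk Hx hGx
  have ly := low1 hvy1 hν0 (by rw [hvy]; linarith only [sq_nonneg Y]) hk Hy hGy
  rw [hvx] at lx
  rw [hvy] at ly
  have cb := comb hY0 hXY.le hν0 hk lx ly
  have ax := bar_absorb (u := u) hX0.le hζ.le (hζ1.trans (mul_le_mul_of_nonneg_left
    (hYd.trans hXY.le) (by linarith only [hκ])))
  have ay := bar_absorb (u := w) hY0.le hζ.le (hζ1.trans (mul_le_mul_of_nonneg_left
    hYd (by linarith only [hκ])))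
  have bx := mul_le_mul_of_nonneg_left hBx (show 0 ≤ X ^ 2 * ζ by positivity)
  have b_y := mul_le_mul_of_nonneg_left hBy (show 0 ≤ Y ^ 2 * ζ by positivity)
  have z1 : X ^ 2 * ζ + Y ^ 2 * ζ ≤ X * ε := by
    have h1 : Y ^ 2 ≤ X ^ 2 := pow_le_pow_left₀ hY0.le hXY.le 2
    have h2 := mul_le_mul_of_nonneg_right h1 hζ.le
    have h3 := mul_le_mul_of_nonneg_left hXm (show 0 ≤ 2 * ζ * X by positivity)
    have h4 := mul_le_mul_of_nonneg_left hζ2 hX0.le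
    linarith only [h2, h3, h4]
  have z2 : Y * ((4 * k + 3) * (3 * θ * p ^ 2)) ≤ X * ((4 * k + 3) * (3 * θ * p ^ 2)) := by
    have hθ0 : 0 ≤ θ * (96 * (4 * k + 3)) := by rw [hθ]; exact hg0.le
    have : 0 ≤ θ * (96 * (4 * k + 3)) * p ^ 2 := mul_nonneg hθ0 (sq_nonneg p)
    exact mul_le_mul_of_nonneg_right hXY.le (by linarith only [this])
  have z3 : Y * ε ≤ X * ε := mul_le_mul_of_nonneg_right hXY.le hε
  -- the engine
  have eng2 : X ^ 2 * (Lx + -ζ * Bx) - Y ^ 2 * (Ly + ζ * By) ≤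
      N * ((1 + κ0) * (X - Y) ^ 2 - g / 4 * X ^ 2) := by
    have h1 : s * ε ≤ τ * ε := mul_le_mul_of_nonneg_right hsτ hε
    have h2 : (1 + κ0) * (1 - Y / X) ^ 2 - (1 - γ) / 2 + (31 + 6 * s) * ε + (24 + 2 * κ0) * η ≤
        (1 + κ0) * (1 - Y / X) ^ 2 - g / 4 := by linarith only [h1, hετ, hηg, hg]
    have h3 := eng.trans (mul_le_mul_of_nonneg_left h2 hN0.le)
    have h4 := mul_le_mul_of_nonneg_left h3 (show 0 ≤ X ^ 2 by positivity)
    have e1 : X ^ 2 * (Lx + -ζ * Bx - (Y / X) ^ 2 * (Ly + ζ * By)) =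
      X ^ 2 * (Lx + -ζ * Bx) - Y ^ 2 * (Ly + ζ * By) := by
      rw [mul_sub, ← mul_assoc (X ^ 2) ((Y / X) ^ 2), ← mul_pow, mul_div_cancel₀ _ hX0.ne']
    have e3 : X ^ 2 * (1 - Y / X) ^ 2 = (X - Y) ^ 2 := by
      rw [← mul_pow, mul_sub, mul_one, mul_div_cancel₀ _ hX0.ne']
    have e2 : X ^ 2 * (N * ((1 + κ0) * (1 - Y / X) ^ 2 - g / 4)) =
      N * ((1 + κ0) * (X - Y) ^ 2 - g / 4 * X ^ 2) := by rw [← e3]; ring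
    rw [e1, e2] at h4
    exact h4
  -- p and K
  have hpt : p = K * (m * (γ * q ^ ((γ - 1) / 2))) := by
    have : S * s = q ^ ((γ - 1) / 2) := by
      rw [hS, hs, Real.sqrt_eq_rpow, ← Real.rpow_add hq]; congr 1; ring
    rw [hp, hN, ← this]; ring
  have ha : 1 - δ1 ≤ γ * q ^ ((γ - 1) / 2) := by
    refine hlo.trans (mul_le_mul_of_nonneg_left ?_ hγ0.le)
    exact Real.rpow_le_rpow_of_nonpos hq hqτ (by linarith only [hγ])
  have hma : 1 - δ1 ≤ m * (γ * q ^ ((γ - 1) / 2)) :=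
    ha.trans (le_mul_of_one_le_left (by linarith only [ha, hδ1]) hm1)
  have hpK : K / 2 ≤ p := by
    rw [hpt]
    have := mul_le_mul_of_nonneg_left (show 1 / 2 ≤ m * (γ * q ^ ((γ - 1) / 2)) by
      linarith only [hma, hδ1]) hK.le
    linarith only [this]
  have hpK2 : K ^ 2 ≤ 4 * p ^ 2 := by
    have := pow_le_pow_left₀ (by positivity) hpK 2
    linarith only [this]
  refine final_alg (X := X) (D := X - Y) (p := p) (k := k) (κ0 := κ0) (δ1 := δ1) (g := g) (N := N)
    (Z := (1 + δ1) / γ) (ε := ε) (θ := θ) (q := K ^ 2 - p ^ 2) (γ := γ) hD0 (by linarith only [hY0]) hp0 hk hg0 rfl ?_ ?_ ?_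
    hZ (by linarith only [hκ]) hδ hθ ?_ ?_
  · linarith only [cb, ax, ay, bx, b_y, z1, z2, z3, eng2]
  · have h1 : p ^ 2 * ((1 + δ1) / γ) = N * ((1 + δ1) * (K * (S * q)) * m) := by
      rw [hp2]; field_simp
    rw [h1]
    refine mul_le_mul_of_nonneg_left (hup.trans (le_mul_of_one_le_right (by positivity) hm1)) hN0.le
  · rw [hp2]
    refine mul_le_mul_of_nonneg_left (le_trans ?_ hF.le) hN0.le
    exact mul_le_of_le_one_left (by positivity) hγ.le
  · have := mul_le_mul_of_nonneg_right hpK2 hg0.le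
    linarith only [this, hεK]
  · rcases le_total σ q with h | h
    · left
      refine K_close hpt hma ?_ hδ hδ1
      have h1 : q ^ ((γ - 1) / 2) ≤ 1 + δ1 :=
        (Real.rpow_le_rpow_of_nonpos hσ h (by linarith only [hγ])).trans hhi
      have h2 : γ * q ^ ((γ - 1) / 2) ≤ 1 + δ1 :=
        (mul_le_of_le_one_left (Real.rpow_nonneg hq.le _) hγ.le).trans h1
      rw [pow_two]
      exact mul_le_mul hm2 h2 (by linarith only [ha, hδ1]) (by linarith only [hδ])
    · right
      constructor
      · rw [abs_le]; constructor <;> linarith only [sq_nonneg K, sq_nonneg p, hpK2]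
      · have h1 : S * q ≤ σ ^ (γ / 2) := by
          rw [← hSq]; exact Real.rpow_le_rpow hq.le h (by linarith only [hγ0])
        have h2 : X - Y ≤ 2 * (K * σ ^ (γ / 2)) := by
          refine hup.trans (mul_le_mul (by linarith only [hδ1]) (mul_le_mul_of_nonneg_left h1 hK.le)
            (by positivity) (by norm_num))
        have h3 := mul_le_mul_of_nonneg_left (pow_le_pow_left₀ hD0.le h2 2)
          (show 0 ≤ 64 * (k + 1) by linarith only [hk])
        have h4 : d ≤ X ^ 2 := by
          have := pow_le_pow_left₀ hd0.le (hYd.trans hXY.le) 2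
          rwa [Real.sq_sqrt hd.le] at this
        have h5 := mul_le_mul_of_nonneg_left h4 hg0.le
        linarith only [h3, h5, hσD]

lemma step_core {v : ℝ × ℝ → ℝ} {x y xh : ℝ × ℝ}
    {κ0 k ε ν K γ g d δ1 ζ c ρ' η τ σ Vm θ : ℝ} (hk : 0 < k) (hκ : 1 < κ0) (hK : 0 < K)
    (hν : ν = 1 / (4 * k * (k + 1) * K ^ 2)) (hd : 0 < d) (hνd : ν ≤ 1 - d)
    (hg : g = 1 - γ) (hγ : γ < 1) (hγ2 : 1 / 2 ≤ γ) (hε : 0 ≤ ε) (hε4 : ε ≤ 1 / 4)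
    (hεκ : 6 * ε ≤ κ0 - 1) (hδ : 0 ≤ δ1) (hδ1 : δ1 ≤ 1 / 10) (hζ : 0 < ζ)
    (hθ : θ * (96 * (4 * k + 3)) = g) (hρ : 0 < ρ') (hτ : 0 < τ) (hη : η = τ / ρ')
    (hηg : (24 + 2 * κ0) * η ≤ g / 8) (hηθ : 3 * η ≤ θ) (hετ : (31 + 6 * τ) * ε ≤ g / 8)
    (hεθ : 8 * ε ≤ θ) (hεK : 128 * ε ≤ K ^ 2 * g)
    (hlo : 1 - δ1 ≤ γ * (τ ^ 2) ^ ((γ - 1) / 2)) (hσ : 0 < σ) (hhi : σ ^ ((γ - 1) / 2) ≤ 1 + δ1)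
    (hσD : 256 * (k + 1) * K ^ 2 * (σ ^ (γ / 2)) ^ 2 < g * d)
    (hZ : (1 + κ0) * ((1 + δ1) / γ) ≤ 2 * k + 1 - 8 * (k + 1) * δ1)
    (hζ1 : (4 * k + 3) * (4 / θ) * ζ ≤ (κ0 - 1) / 2 * √d) (hζ2 : 2 * ζ * Vm ≤ ε)
    (hx : 0 < x.2) (hy : 0 < y.2) (hxh : 0 < xh.2) (hxx : sq x xh ≤ ρ' ^ 2)
    (hq : 0 < sq x y) (hqτ : sq x y ≤ τ ^ 2)
    (hvx : 1 ≤ v x) (hvy : 1 ≤ v y) {jx jy : Jt} {o o' : Op} (hjx : Jet v x jx) (hjy : Jet v y jy)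
    (ho : OpClose o x.2 κ0 ε) (ho' : OpClose o' y.2 κ0 ε)
    (hex : |v x * o.L jx - ((k + 1) * o.Q jx + 1 / k)| ≤ ε)
    (hey : |v y * o'.L jy - ((k + 1) * o'.Q jy + 1 / k)| ≤ ε)
    (hXm : √(v x - ν) ≤ Vm)
    (hF : K * ((sq x y) ^ (γ / 2) * (1 + δ1 / ρ' ^ 2 * sq x xh)) < √(v x - ν) - √(v y - ν))
    (hup : √(v x - ν) - √(v y - ν) ≤ (1 + δ1) * (K * (sq x y) ^ (γ / 2)))
    (hmax : IsLocalMax (fun p : (ℝ × ℝ) × (ℝ × ℝ) =>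
      (fun z => √(v z - ν) + (-ζ) * bar c z) p.1 - (fun z => √(v z - ν) + ζ * bar c z) p.2 -
        K * ((sq p.1 p.2) ^ (γ / 2) * (fun z => 1 + δ1 / ρ' ^ 2 * sq z xh) p.1)) (x, y)) : False := by
  have hν0 : 0 < ν := by rw [hν]; positivity
  have hg0 : 0 < g := by rw [hg]; exact sub_pos.mpr hγ
  have hθ0 : 0 < θ := by
    have h1 : 0 < θ * (96 * (4 * k + 3)) := by rw [hθ]; exact hg0
    exact pos_of_mul_pos_left h1 (by positivity)
  have hη0 : 0 ≤ η := by rw [hη]; positivity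
  have hηρ : η * ρ' = τ := by rw [hη]; field_simp
  have hθ4 : θ ≤ 1 / 4 := by
    have : θ * 288 ≤ θ * (96 * (4 * k + 3)) := mul_le_mul_of_nonneg_left (by linarith only [hk]) hθ0.le
    linarith only [this, hθ, hg, hγ2]
  obtain ⟨ix, hix, Hx⟩ := jetV hk hK hν (by linarith only [hvx, hνd, hd]) hjx hex
  obtain ⟨iy, hiy, Hy⟩ := jetV hk hK hν (by linarith only [hvy, hνd, hd]) hjy hey
  have hX2 : √(v x - ν) ^ 2 = v x - ν := Real.sq_sqrt (by linarith only [hvx, hνd, hd])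
  have hY2 : √(v y - ν) ^ 2 = v y - ν := Real.sq_sqrt (by linarith only [hvy, hνd, hd])
  have hYd : √d ≤ √(v y - ν) := Real.sqrt_le_sqrt (by linarith only [hvy, hνd])
  have hd0 : 0 < √d := Real.sqrt_pos.mpr hd
  have hXd : √d ≤ √(v x - ν) := Real.sqrt_le_sqrt (by linarith only [hvx, hνd])
  have hcρ : 0 ≤ δ1 / ρ' ^ 2 := by positivity
  have hm1 : 1 ≤ 1 + δ1 / ρ' ^ 2 * sq x xh := by
    linarith only [mul_nonneg hcρ (sq_nonneg' x xh)]
  have hm2 : 1 + δ1 / ρ' ^ 2 * sq x xh ≤ 1 + δ1 := by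
    have h1 := mul_le_mul_of_nonneg_left hxx hcρ
    have h2 : δ1 / ρ' ^ 2 * ρ' ^ 2 = δ1 := by field_simp
    linarith only [h1, h2]
  have hj1 := hix.add ((jet_bar c x hx).smul (-ζ))
  have hj2 := hiy.add ((jet_bar c y hy).smul ζ)
  have hjm := (jet_const 1 x).add ((jet_sq x xh).smul (δ1 / ρ' ^ 2))
  -- the three conditions on the cut-off
  have hqρ : δ1 / ρ' ^ 2 * sq x y ≤ δ1 * η ^ 2 := by
    have h1 := mul_le_mul_of_nonneg_left hqτ hcρ
    have h2 : δ1 / ρ' ^ 2 * τ ^ 2 = δ1 * η ^ 2 := by rw [← hηρ]; field_simp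
    linarith only [h1, h2]
  have hη1 : η ≤ 1 / 4 := by linarith only [hηθ, hθ4]
  have hηη : η ^ 2 ≤ η * (1 / 4) := by rw [pow_two]; exact mul_le_mul_of_nonneg_left hη1 hη0
  have hδη : 10 * (δ1 * η ^ 2) ≤ η ^ 2 := by
    have := mul_le_mul_of_nonneg_right hδ1 (sq_nonneg η); linarith only [this]
  have hδη0 : 0 ≤ δ1 * η ^ 2 := by positivity
  set q := sq x y with hqdef
  set S := q ^ (γ / 2 - 1) with hS
  set X := √(v x - ν) with hX
  set Y := √(v y - ν) with hY
  set m := 1 + δ1 / ρ' ^ 2 * sq x xh with hmdef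
  have hX0 : 0 < X := hd0.trans_le hXd
  have hY0 : 0 < Y := hd0.trans_le hYd
  have hS0 : 0 < S := Real.rpow_pos_of_pos hq _
  have hSq : q ^ (γ / 2) = S * q := by
    rw [hS, Real.rpow_sub_one hq.ne']; field_simp
  rw [hSq] at hF hup
  have hD0 : 0 < X - Y := lt_of_le_of_lt (by positivity) hF
  have M1 : q * ((2 * δ1 / ρ' ^ 2 * (x.1 - xh.1)) ^ 2 + (2 * δ1 / ρ' ^ 2 * (x.2 - xh.2)) ^ 2) ≤
      (η * m) ^ 2 := by
    have e : q * ((2 * δ1 / ρ' ^ 2 * (x.1 - xh.1)) ^ 2 + (2 * δ1 / ρ' ^ 2 * (x.2 - xh.2)) ^ 2) =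
        4 * (δ1 / ρ' ^ 2 * q) * (δ1 / ρ' ^ 2 * sq x xh) := by unfold sq; ring
    have h1 : (δ1 / ρ' ^ 2 * q) * (δ1 / ρ' ^ 2 * sq x xh) ≤ (δ1 * η ^ 2) * δ1 :=
      mul_le_mul hqρ (by linarith only [hm2]) (by linarith only [hm1]) hδη0
    have h2 : (δ1 * η ^ 2) * δ1 ≤ (δ1 * η ^ 2) * (1 / 10) := mul_le_mul_of_nonneg_left hδ1 hδη0
    have h3 : η ^ 2 * 1 ≤ η ^ 2 * m ^ 2 := mul_le_mul_of_nonneg_left (one_le_pow₀ hm1) (by positivity)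
    rw [e, mul_pow]
    linarith only [h1, h2, h3, hδη, sq_nonneg η]
  have hm0 : 0 < m := by linarith only [hm1]
  have hηm : η ≤ η * m := le_mul_of_one_le_right hη0 hm1
  have eng := engine hj1 hj2 hjm hq (μ := Y / X) (η := η) (ε := ε) (κ0 := κ0) hmax ho ho'
    hx hy hK hm0 hγ hγ2 hη0 hη1 (by positivity)
    ((div_le_one hX0).mpr (by linarith only [hD0])) hε hε4 hκ
    (by
      refine le_trans (le_of_eq ?_) M1
      simp only [Jt.add, Jt.smul]; ring)
    (by
      intro a1 a2
      have e : sq x y * (a1 ^ 2 * (((⟨0, 0, 0, 0, 0⟩ : Jt).add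
          (Jt.smul (δ1 / ρ' ^ 2) ⟨2 * (x.1 - xh.1), 2 * (x.2 - xh.2), 2, 0, 2⟩))).h11 +
          2 * a1 * a2 * (((⟨0, 0, 0, 0, 0⟩ : Jt).add
          (Jt.smul (δ1 / ρ' ^ 2) ⟨2 * (x.1 - xh.1), 2 * (x.2 - xh.2), 2, 0, 2⟩))).h12 +
          a2 ^ 2 * (((⟨0, 0, 0, 0, 0⟩ : Jt).add
          (Jt.smul (δ1 / ρ' ^ 2) ⟨2 * (x.1 - xh.1), 2 * (x.2 - xh.2), 2, 0, 2⟩))).h22) =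
          2 * (δ1 / ρ' ^ 2 * q) * (a1 ^ 2 + a2 ^ 2) := by
        simp only [Jt.add, Jt.smul, ← hqdef]; ring
      refine (le_of_eq e).trans (mul_le_mul_of_nonneg_right ?_ (by positivity))
      show _ ≤ η * m
      linarith only [hqρ, hδη, hηη, hηm, hη0])
    (by
      have e : sq x y * (((⟨0, 0, 0, 0, 0⟩ : Jt).add
          (Jt.smul (δ1 / ρ' ^ 2) ⟨2 * (x.1 - xh.1), 2 * (x.2 - xh.2), 2, 0, 2⟩))).p2 =
          2 * (δ1 / ρ' ^ 2 * q) * (x.2 - xh.2) := by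
        simp only [Jt.add, Jt.smul, ← hqdef]; ring
      refine (le_of_eq e).trans ?_
      show _ ≤ η * m * x.2
      have h1 : 2 * (δ1 / ρ' ^ 2 * q) * (x.2 - xh.2) ≤ 2 * (δ1 / ρ' ^ 2 * q) * x.2 :=
        mul_le_mul_of_nonneg_left (by linarith only [hxh]) (by positivity)
      exact h1.trans (mul_le_mul_of_nonneg_right
        (by linarith only [hqρ, hδη, hηη, hηm, hη0]) hx.le))
    rfl rfl rfl
  obtain ⟨g1, g2, g3, g4, eng⟩ := eng
  simp only [Op.L_add, Op.L_smul] at eng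
  have B1 := L_bar ho hx hε (by linarith only [hε4]) hεκ
  have B2 := L_bar ho' hy hε (by linarith only [hε4]) hεκ
  simp only [Jt.add, Jt.smul, ← hqdef, ← hS] at g1 g2 g3 g4
  set N := K * γ * S * m with hN
  have hNq : K * S * m ≤ 2 * N := by
    have : K * S * m * (1 / 2) ≤ K * S * m * γ := mul_le_mul_of_nonneg_left hγ2 (by positivity)
    linarith only [this, hN]
  have hp2 : (N * √q) ^ 2 = N ^ 2 * q := by rw [mul_pow, Real.sq_sqrt hq.le]
  have hqe : q = (x.1 - y.1) ^ 2 + (x.2 - y.2) ^ 2 := hqdef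
  have G1 := grad_close (θ := θ) (p := N * √q) (η' := 2 * η) (ζr := ζ * (1 / x.2)) ho hε (i := ix)
    (a1 := N * (x.1 - y.1)) (a2 := N * (x.2 - y.2))
    (e1 := K * (S * q) * (2 * δ1 / ρ' ^ 2 * (x.1 - xh.1)))
    (e2 := K * (S * q) * (2 * δ1 / ρ' ^ 2 * (x.2 - xh.2)) + -(ζ * (1 / x.2)))
    (by linear_combination g1) (by linear_combination g2) (by rw [hp2, hqe]; ring)
    (by
      have h1 := mul_le_mul_of_nonneg_left M1 (show 0 ≤ (K * S) ^ 2 * q by positivity)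
      have h2 : (K * S * m) ^ 2 ≤ (2 * N) ^ 2 := pow_le_pow_left₀ (by positivity) hNq 2
      have h3 := mul_le_mul_of_nonneg_right h2 (show 0 ≤ η ^ 2 * q by positivity)
      rw [mul_pow (2 * η), hp2]
      linarith only [h1, h3, sq_nonneg (K * (S * q) * (2 * δ1 / ρ' ^ 2 * (x.2 - xh.2)) + (ζ * (1 / x.2))),
        sq_nonneg (K * (S * q) * (2 * δ1 / ρ' ^ 2 * (x.1 - xh.1)))])
    hθ0 hθ4 (by
      have := pow_le_pow_left₀ (by positivity) hηθ 2
      linarith only [this, sq_nonneg η]) hεθ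
  have G2 := grad_close (θ := θ) (p := N * √q) (η' := 2 * η) (ζr := ζ * (1 / y.2)) ho' hε (i := iy)
    (a1 := N * (x.1 - y.1)) (a2 := N * (x.2 - y.2)) (e1 := 0) (e2 := ζ * (1 / y.2))
    (by linear_combination g3) (by linear_combination g4) (by rw [hp2, hqe]; ring)
    (by
      linarith only [sq_nonneg (2 * η * (N * √q)), sq_nonneg (ζ * (1 / y.2))])
    hθ0 hθ4 (by
      have := pow_le_pow_left₀ (by positivity) hηθ 2
      linarith only [this, sq_nonneg η]) hεθ
  have hF' : K * (S * q * m) < X - Y := hF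
  exact core2 (q := q) (S := S) (m := m) (s := √q) (N := N) (p := N * √q) (vx := v x) (vy := v y)
    hk hκ hK hν0.le hd (by linarith only [hX2]) (by linarith only [hY2]) hvx hvy hg hγ hγ2 hε hδ hδ1 hζ hθ hηg
    hετ hεK hτ hlo hσ hhi hσD hZ hζ1 hζ2 hYd (by linarith only [hD0]) hXm hq hqτ hS rfl hm1 hm2 hN rfl hF' hup
    hSq Hx Hy G1 G2 B1 B2 eng

end Deg

open Filter Topology

namespace Deg

noncomputable def nu (k K : ℝ) : ℝ := 1 / (4 * k * (k + 1) * K ^ 2)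

def Cl (v : ℝ × ℝ → ℝ) (z0 : ℝ × ℝ) (ρb k γ K ρ : ℝ) : Prop :=
  ∃ x y : ℝ × ℝ, 0 < x.2 ∧ 0 < y.2 ∧ sq x z0 ≤ ρ ^ 2 ∧ sq y z0 < ρb ^ 2 ∧
    K * (sq x y) ^ (γ / 2) < √(v x - nu k K) - √(v y - nu k K)

structure Par (κ0 k ε γ g d δ1 δ ρ' η τ σ Vm θ Kmin Kmax : ℝ) : Prop where
  hk : 0 < k
  hκ : 1 < κ0
  hK : 0 < Kmin
  hd : 0 < d
  hνd : nu k Kmin ≤ 1 - d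
  hg : g = 1 - γ
  hγ : γ < 1
  hγ2 : 1 / 2 ≤ γ
  hε : 0 < ε
  hε4 : ε ≤ 1 / 4
  hεκ : 6 * ε ≤ κ0 - 1
  hδ1 : δ1 ≤ 1 / 10
  hδ0 : 0 < δ
  hδd : (1 + δ) * (1 + δ / d) ≤ 1 + δ1
  hθ : θ * (96 * (4 * k + 3)) = g
  hρ : 0 < ρ'
  hτ : 0 < τ
  hη : η = τ / ρ'
  hηg : (24 + 2 * κ0) * η ≤ g / 8
  hηθ : 3 * η ≤ θ
  hετ : (31 + 6 * τ) * ε ≤ g / 8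
  hεθ : 8 * ε ≤ θ
  hεK : 128 * ε ≤ Kmin ^ 2 * g
  hlo : 1 - δ1 ≤ γ * (τ ^ 2) ^ ((γ - 1) / 2)
  hσ : 0 < σ
  hhi : σ ^ ((γ - 1) / 2) ≤ 1 + δ1
  hσD : 256 * (k + 1) * Kmax ^ 2 * (σ ^ (γ / 2)) ^ 2 < g * d
  hZ : (1 + κ0) * ((1 + δ1) / γ) ≤ 2 * k + 1 - 8 * (k + 1) * δ1
  hVm0 : 0 < Vm
  hVm : Vm ≤ Kmin * (τ ^ 2) ^ (γ / 2)

lemma nu_mono {k K K' : ℝ} (hk : 0 < k) (hK : 0 < K) (h : K ≤ K') : nu k K' ≤ nu k K := by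
  unfold nu
  have : K ^ 2 ≤ K' ^ 2 := pow_le_pow_left₀ hK.le h 2
  exact one_div_le_one_div_of_le (by positivity) (mul_le_mul_of_nonneg_left this (by positivity))

lemma nu_diff {k K δ : ℝ} (hk : 0 < k) (hK : 0 < K) (hδ : 0 < δ) (h1 : nu k K ≤ 1) :
    nu k K - nu k (K * (1 + δ)) ≤ 2 * δ := by
  have e : nu k (K * (1 + δ)) * (1 + δ) ^ 2 = nu k K := by unfold nu; field_simp
  have h0 : 0 < nu k (K * (1 + δ)) := by unfold nu; positivity
  have h3 : nu k K - nu k (K * (1 + δ)) = nu k (K * (1 + δ)) * (2 * δ + δ ^ 2) := by rw [← e]; ring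
  rw [h3]
  have h2 : nu k (K * (1 + δ)) * (1 + δ) ^ 2 * (2 * δ) ≤ 1 * (2 * δ) := by
    rw [e]; exact mul_le_mul_of_nonneg_right h1 (by linarith)
  have h4 : (2 * δ + δ ^ 2) ≤ (1 + δ) ^ 2 * (2 * δ) := by
    have : 0 ≤ δ ^ 2 := by positivity
    have : 0 ≤ δ ^ 3 := by positivity
    linarith
  have h5 := mul_le_mul_of_nonneg_left h4 h0.le
  linarith

theorem step {κ0 k ε γ g d δ1 δ ρ' η τ σ Vm θ Kmin Kmax : ℝ}
    (P : Par κ0 k ε γ g d δ1 δ ρ' η τ σ Vm θ Kmin Kmax) {v : ℝ × ℝ → ℝ} {z0 : ℝ × ℝ} {ρb ρ K : ℝ}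
    (H : VSol v z0 ρb κ0 k ε) (hv : ∀ z : ℝ × ℝ, 0 < z.2 → sq z z0 < ρb ^ 2 → v z ≤ Vm ^ 2)
    (hK1 : Kmin ≤ K) (hK2 : K ≤ Kmax) (hρ0 : 0 ≤ ρ) (hρb : ρ + 2 * ρ' < ρb)
    (hC : Cl v z0 ρb k γ K ρ) : Cl v z0 ρb k γ (K * (1 + δ)) (ρ + ρ') := by
  by_contra hcon
  obtain ⟨hk, hκ, hKm, hd, hνd, hg, hγ, hγ2, hε, hε4, hεκ, hδ1, hδ0, hδd, hθ, hρ, hτ, hη, hηg, hηθ,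
    hετ, hεθ, hεK, hlo, hσ, hhi, hσD, hZ, hVm0, hVm⟩ := P
  have hK : 0 < K := hKm.trans_le hK1
  have hg0 : 0 < g := by rw [hg]; linarith only [hγ]
  have hνd' : nu k K ≤ 1 - d := (nu_mono hk hKm hK1).trans hνd
  have hν0 : 0 < nu k K := by unfold nu; positivity
  have hδd0 : 0 < δ / d := by positivity
  have hδ10 : 0 ≤ δ1 := by
    have : 0 ≤ δ * (δ / d) := by positivity
    linarith only [this, hδd, hδ0, hδd0]
  have hθ0 : 0 < θ := by
    have h1 : 0 < θ * (96 * (4 * k + 3)) := by rw [hθ]; exact hg0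
    exact pos_of_mul_pos_left h1 (by positivity)
  have hτρ : τ ≤ ρ' := by
    have : η ≤ 1 := by
      have : 0 ≤ κ0 * η := by
        rw [hη]; have : 0 < κ0 := by linarith only [hκ]
        positivity
      linarith only [this, hηg, hg, hγ2]
    rw [hη, div_le_one hρ] at this
    exact this
  obtain ⟨xh, yh, hxh, hyh, hxh2, hyh2, hclaim⟩ := hC
  -- domain facts
  have dx : ∀ x : ℝ × ℝ, sq x xh ≤ ρ' ^ 2 → sq x z0 ≤ (ρ + ρ') ^ 2 := fun x hx => by
    have := sq_tri hρ.le hρ0 hx hxh2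
    rwa [add_comm] at this
  have db : ∀ x : ℝ × ℝ, sq x xh ≤ (2 * ρ') ^ 2 → sq x z0 < ρb ^ 2 := fun x hx =>
    (sq_tri (by positivity) hρ0 hx hxh2).trans_lt (by
      have : 2 * ρ' + ρ < ρb := by linarith only [hρb]
      exact pow_lt_pow_left₀ this (by positivity) two_ne_zero)
  have dx2 : ∀ x : ℝ × ℝ, sq x xh ≤ ρ' ^ 2 → sq x xh ≤ (2 * ρ') ^ 2 := fun x hx =>
    hx.trans (pow_le_pow_left₀ hρ.le (by linarith only [hρ]) 2)
  have Vb : ∀ x : ℝ × ℝ, 0 < x.2 → sq x z0 < ρb ^ 2 → √(v x - nu k K) ≤ Vm := fun x h1 h2 => by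
    rw [Real.sqrt_le_left hVm0.le]; linarith only [hv x h1 h2, hν0]
  -- bound from the failure of the next claim
  have hup : ∀ x y : ℝ × ℝ, 0 < x.2 → sq x xh ≤ ρ' ^ 2 → 0 < y.2 → sq y xh ≤ (2 * ρ') ^ 2 →
      √(v x - nu k K) - √(v y - nu k K) ≤ (1 + δ1) * (K * (sq x y) ^ (γ / 2)) := by
    intro x y hx hx2 hy hy2
    have hq0 : 0 ≤ (sq x y) ^ (γ / 2) := Real.rpow_nonneg (sq_nonneg' x y) _
    have h1 : √(v x - nu k (K * (1 + δ))) - √(v y - nu k (K * (1 + δ))) ≤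
        K * (1 + δ) * (sq x y) ^ (γ / 2) := by
      by_contra hn
      exact hcon ⟨x, y, hx, hy, dx x hx2, db y hy2, not_le.mp hn⟩
    have h2 := change_nu (c := δ / d) (d := d) (nu_mono hk hK (by
        linarith only [mul_pos hK hδ0] : K ≤ K * (1 + δ)))
      (by linarith only [(H x hx (db x (dx2 x hx2))).2.1, hνd'])
      (by linarith only [(H y hy (db y hy2)).2.1, hνd']) hd hδd0.le (by
        have := nu_diff hk hK hδ0 (by linarith only [hνd', hd])
        have e : 2 * (δ / d) * d = 2 * δ := by field_simp
        rw [e]; exact this) h1 (by positivity)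
    refine h2.trans ?_
    have h3 := mul_le_mul_of_nonneg_right hδd (show 0 ≤ K * (sq x y) ^ (γ / 2) by positivity)
    linarith only [h3]
  -- s is small
  have big : ∀ x y : ℝ × ℝ, τ ^ 2 ≤ sq x y → Vm ≤ K * (sq x y) ^ (γ / 2) := fun x y h => by
    refine hVm.trans (mul_le_mul hK1 (Real.rpow_le_rpow (by positivity) h (by linarith only [hγ2]))
      (by positivity) hK.le)
  have hyx : sq yh xh ≤ (2 * ρ') ^ 2 := by
    by_contra hn
    have h1 : τ ^ 2 ≤ sq xh yh := by
      rw [sq_comm']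
      refine le_trans (pow_le_pow_left₀ hτ.le ?_ 2) (not_le.mp hn).le
      linarith only [hτρ, hρ]
    have := big xh yh h1
    have h3 := Vb xh hxh (db xh (by rw [sq_self]; positivity))
    have h4 := Real.sqrt_nonneg (v yh - nu k K)
    linarith only [this, h3, h4, hclaim]
  set c := Real.log (xh.2 + 2 * ρ') with hc
  have bn : ∀ z : ℝ × ℝ, 0 < z.2 → sq z xh ≤ (2 * ρ') ^ 2 → 0 ≤ bar c z := fun z hz h =>
    bar_nonneg hz (sq_snd_le (by positivity) h)
  have hb1 := bn xh hxh (by rw [sq_self]; positivity)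
  have hb2 := bn yh hyh hyx
  have hd0 : 0 < √d := Real.sqrt_pos.mpr hd
  have hκ2 : 0 < (κ0 - 1) / 2 := by linarith only [hκ]
  obtain ⟨ζ, hζ, hζ0, hζB⟩ := exists_small (bar c xh + bar c yh)
    (√(v xh - nu k K) - √(v yh - nu k K) - K * (sq xh yh) ^ (γ / 2))
    (min ((κ0 - 1) / 2 * √d / ((4 * k + 3) * (4 / θ))) (ε / (2 * Vm)))
    (by linarith only [hb1, hb2]) (by linarith only [hclaim]) (lt_min (by positivity) (by positivity))
  have hζ1 : (4 * k + 3) * (4 / θ) * ζ ≤ (κ0 - 1) / 2 * √d := by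
    have := hζ0.trans (min_le_left _ _)
    rwa [le_div_iff₀ (by positivity), mul_comm] at this
  have hζ2 : 2 * ζ * Vm ≤ ε := by
    have := hζ0.trans (min_le_right _ _)
    rw [le_div_iff₀ (by positivity)] at this
    linarith only [this]
  clear hζ0
  have hcρ : 0 ≤ δ1 / ρ' ^ 2 := by positivity
  obtain ⟨x, y, hx2, hy2, hxl, hyl, hFp, hmax⟩ := two_point_max (c := xh) (p := xh) (p' := yh)
    (F := fun p : (ℝ × ℝ) × (ℝ × ℝ) =>
      (fun z => √(v z - nu k K) + (-ζ) * bar c z) p.1 - (fun z => √(v z - nu k K) + ζ * bar c z) p.2 -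
        K * ((sq p.1 p.2) ^ (γ / 2) * (fun z => 1 + δ1 / ρ' ^ 2 * sq z xh) p.1))
    (l := ρ' ^ 2) (l' := (2 * ρ') ^ 2) (r0 := Real.exp (c - Vm / ζ)) (Real.exp_pos _)
    (by
      intro x y hx hxl hy hyl
      have w1 := (H x hx (db x (dx2 x hxl))).1
      have w2 := (H y hy (db y hyl)).1
      have b1 := bar_cont (c := c) hx
      have b2 := bar_cont (c := c) hy
      have q1 := (continuous_sq xh).continuousAt (x := x)
      have q2 := sqpow_cont (γ := γ) (by linarith only [hγ2]) (x, y)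
      have f1 : ContinuousAt (fun z => √(v z - nu k K) + (-ζ) * bar c z) x :=
        (w1.sub continuousAt_const).sqrt.add (b1.const_mul _)
      have f2 : ContinuousAt (fun z => √(v z - nu k K) + ζ * bar c z) y :=
        (w2.sub continuousAt_const).sqrt.add (b2.const_mul _)
      have f3 : ContinuousAt (fun z => 1 + δ1 / ρ' ^ 2 * sq z xh) x :=
        continuousAt_const.add (q1.const_mul _)
      refine ContinuousAt.sub (ContinuousAt.sub ?_ ?_) ?_
      · exact ContinuousAt.comp (f := Prod.fst) (x := (x, y)) f1 continuousAt_fst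
      · exact ContinuousAt.comp (f := Prod.snd) (x := (x, y)) f2 continuousAt_snd
      · refine (q2.mul ?_).const_mul _
        exact ContinuousAt.comp (f := Prod.fst) (x := (x, y)) f3 continuousAt_fst)
    (by
      intro x y hx hxl hy hyl h
      have w1 := Vb x hx (db x (dx2 x hxl))
      have w2 := Real.sqrt_nonneg (v y - nu k K)
      have b1 := mul_nonneg hζ.le (bn x hx (dx2 x hxl))
      have b2 := mul_nonneg hζ.le (bn y hy hyl)
      have q0 := mul_nonneg hcρ (sq_nonneg' x xh)
      have q2 : 0 ≤ K * (sq x y) ^ (γ / 2) := mul_nonneg hK.le (Real.rpow_nonneg (sq_nonneg' x y) _)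
      have q1 : K * (sq x y) ^ (γ / 2) * 1 ≤ K * (sq x y) ^ (γ / 2) * (1 + δ1 / ρ' ^ 2 * sq x xh) :=
        mul_le_mul_of_nonneg_left (by linarith only [q0]) q2
      simp only
      rcases h with h | h | h | h
      · have h1 := hup x y hx hxl hy hyl
        have h2 : δ1 / ρ' ^ 2 * ρ' ^ 2 = δ1 := by field_simp
        rw [h, h2]
        linarith only [h1, b1, b2]
      · have h1 : τ ^ 2 ≤ sq x y := by
          by_contra hlt
          push Not at hlt
          have := sq_tri_lt (x := y) (y := x) (z := xh) (s := τ) (t := ρ') hτ hρ.le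
            (by rw [sq_comm']; exact hlt) hxl
          rw [h] at this
          have h5 : (τ + ρ') ^ 2 ≤ (2 * ρ') ^ 2 :=
            pow_le_pow_left₀ (by positivity) (by linarith only [hτρ]) 2
          linarith only [this, h5]
        have h2 := big x y h1
        linarith only [h2, q1, w1, w2, b1, b2]
      · have := bar_large (M := Vm) hζ rfl hx h
        linarith only [this, q1, q2, w1, w2, b2]
      · have := bar_large (M := Vm) hζ rfl hy h
        linarith only [this, q1, q2, w1, w2, b1])
    hxh (by rw [sq_self]; positivity) hyh hyx
    (by simp only [sq_self]; linarith only [hζB])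
  simp only at hFp
  have hxb := db x (dx2 x hxl.le)
  have hyb := db y hyl.le
  obtain ⟨-, w1, jx, o, hjx, ho, hex⟩ := H x hx2 hxb
  obtain ⟨-, w3, jy, o', hjy, ho', hey⟩ := H y hy2 hyb
  have b1 := mul_nonneg hζ.le (bn x hx2 (dx2 x hxl.le))
  have b2 := mul_nonneg hζ.le (bn y hy2 hyl.le)
  have hF : K * ((sq x y) ^ (γ / 2) * (1 + δ1 / ρ' ^ 2 * sq x xh)) <
      √(v x - nu k K) - √(v y - nu k K) := by linarith only [hFp, b1, b2]
  have hqpos : 0 < sq x y := by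
    rcases (sq_nonneg' x y).lt_or_eq with h | h
    · exact h
    · have hxy' := sq_eq_zero h.symm
      subst hxy'
      rw [sq_self, Real.zero_rpow (by linarith only [hγ2])] at hF
      linarith only [hF]
  have hqτ : sq x y ≤ τ ^ 2 := by
    by_contra h
    push Not at h
    have h1 := big x y h.le
    have q0 := mul_nonneg hcρ (sq_nonneg' x xh)
    have q1 : K * (sq x y) ^ (γ / 2) * 1 ≤ K * (sq x y) ^ (γ / 2) * (1 + δ1 / ρ' ^ 2 * sq x xh) :=
      mul_le_mul_of_nonneg_left (by linarith only [q0]) (by positivity)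
    have := Vb x hx2 hxb
    have w2 := Real.sqrt_nonneg (v y - nu k K)
    linarith only [h1, q1, this, w2, hF]
  have hKK : Kmin ^ 2 * g ≤ K ^ 2 * g :=
    mul_le_mul_of_nonneg_right (pow_le_pow_left₀ hKm.le hK1 2) hg0.le
  have hKM : K ^ 2 ≤ Kmax ^ 2 := pow_le_pow_left₀ hK.le hK2 2
  have hKM2 := mul_le_mul_of_nonneg_right hKM
    (show 0 ≤ 256 * (k + 1) * (σ ^ (γ / 2)) ^ 2 by positivity)
  exact step_core hk hκ hK rfl hd hνd' hg hγ hγ2 hε.le hε4 hεκ hδ10 hδ1 hζ hθ hρ hτ hη hηg hηθ hετ hεθ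
    (hεK.trans hKK) hlo hσ hhi (by linarith only [hKM2, hσD]) hZ hζ1 hζ2 hx2 hy2 hxh hxl.le hqpos hqτ
    w1 w3 hjx hjy ho ho' hex hey (Vb x hx2 hxb) hF (hup x y hx2 hxl.le hy2 hyl.le) hmax

theorem iter {κ0 k ε γ g d δ1 δ ρ' η τ σ Vm θ Kmin Kmax : ℝ}
    (P : Par κ0 k ε γ g d δ1 δ ρ' η τ σ Vm θ Kmin Kmax) {v : ℝ × ℝ → ℝ} {z0 : ℝ × ℝ} {ρb ρ : ℝ}
    (H : VSol v z0 ρb κ0 k ε) (hv : ∀ z : ℝ × ℝ, 0 < z.2 → sq z z0 < ρb ^ 2 → v z ≤ Vm ^ 2)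
    (hρ0 : 0 ≤ ρ) (n : ℕ) (hK2 : Kmin * (1 + δ) ^ n ≤ Kmax) (hρb : ρ + (n + 1) * ρ' < ρb)
    (hC : Cl v z0 ρb k γ Kmin ρ) : ∀ j : ℕ, j ≤ n →
      Cl v z0 ρb k γ (Kmin * (1 + δ) ^ j) (ρ + j * ρ') := by
  have hδ0 := P.hδ0
  have hKm := P.hK
  have hρ := P.hρ
  intro j
  induction j with
  | zero => intro _; simpa using hC
  | succ j ih =>
    intro hj
    have h1 := ih (by omega)
    have e1 : Kmin * (1 + δ) ^ (j + 1) = Kmin * (1 + δ) ^ j * (1 + δ) := by ring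
    have e2 : ρ + ((j + 1 : ℕ) : ℝ) * ρ' = ρ + j * ρ' + ρ' := by push_cast; ring
    have hjn : ((j + 1 : ℕ) : ℝ) ≤ n := by exact_mod_cast hj
    push_cast at hjn
    rw [e1, e2]
    refine step P H hv ?_ ?_ (by positivity) ?_ h1
    · exact le_mul_of_one_le_right hKm.le (one_le_pow₀ (by linarith))
    · refine le_trans (mul_le_mul_of_nonneg_left (pow_le_pow_right₀ (by linarith) ?_) hKm.le) hK2
      omega
    · have := mul_le_mul_of_nonneg_right hjn hρ.le
      linarith

end Deg

open Filter Topology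

namespace Deg

lemma rpow_slope {p w0 a b : ℝ} (hp : p < 0) (hw : 0 < w0) (ha : w0 ≤ a) (hab : a < b) :
    a ^ p - b ^ p ≤ (-p) * w0 ^ (p - 1) * (b - a) := by
  obtain ⟨c, hc, he⟩ := exists_hasDerivAt_eq_slope (fun t : ℝ => t ^ p) (fun t => p * t ^ (p - 1)) hab
    (ContinuousOn.rpow_const continuousOn_id fun x hx => Or.inl (by
      have := hx.1; exact ne_of_gt (by show 0 < x; linarith)))
    (fun x hx => Real.hasDerivAt_rpow_const (Or.inl (by have := hx.1; linarith)))
  have h1 : c ^ (p - 1) ≤ w0 ^ (p - 1) :=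
    Real.rpow_le_rpow_of_nonpos hw (by linarith [hc.1]) (by linarith)
  have hba : 0 < b - a := by linarith
  have h2 : a ^ p - b ^ p = (-p) * c ^ (p - 1) * (b - a) := by
    rw [eq_div_iff hba.ne'] at he
    linear_combination he
  rw [h2]
  have : 0 ≤ -p := by linarith
  gcongr

theorem terminal {W : ℝ × ℝ → ℝ} {z0 : ℝ × ℝ} {κ0 k ε γ w0 d K ρ ρb Vm : ℝ} (hk : 0 < k)
    (H : Sol W z0 (3 + ρb) κ0 (1 + 2 / k) ε) (hκ : 1 < κ0) (hγ2 : 1 / 2 ≤ γ) (hγ : γ < 1)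
    (hε : 0 ≤ ε) (hε1 : 6 * ε ≤ κ0 - 1) (hε2 : 200 * ε ≤ 1 - γ) (hw0 : 0 < w0) (hd : 0 < d)
    (hρ0 : 0 ≤ ρ) (hρ : ρ < ρb)
    (hw : ∀ z : ℝ × ℝ, 0 < z.2 → sq z z0 < ρb ^ 2 → w0 ≤ W z)
    (hVm0 : 0 < Vm)
    (hv : ∀ z : ℝ × ℝ, 0 < z.2 → sq z z0 < ρb ^ 2 → W z ^ (-(1 / k)) ≤ Vm ^ 2)
    (hν : nu k K ≤ 1 - d) (hν0 : 0 ≤ nu k K) (hK1 : Vm ≤ K)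
    (hK2 : (1 / k) * w0 ^ (-(1 / k) - 1) * ((8 * (40 + 8 * κ0) + 1) / (1 - γ)) ≤ K * (2 * √d))
    (hC : Cl (fun z => W z ^ (-(1 / k))) z0 ρb k γ K ρ) : False := by
  obtain ⟨x, y, hx, hy, hxr, hyr, hlt⟩ := hC
  simp only at hlt
  have hxr' : sq x z0 < ρb ^ 2 := lt_of_le_of_lt hxr (pow_lt_pow_left₀ hρ hρ0 two_ne_zero)
  have hs0 := sq_nonneg' x y
  have hKp : 0 < K := by linarith
  have hs : 0 ≤ (sq x y) ^ (γ / 2) := Real.rpow_nonneg hs0 _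
  have hrp : ∀ z : ℝ × ℝ, 0 < z.2 → sq z z0 < ρb ^ 2 → 1 ≤ W z ^ (-(1 / k)) := by
    intro z hz hzr
    have hh : sq z z0 < (3 + ρb) ^ 2 := by nlinarith
    obtain ⟨-, w1, w2, -⟩ := H z hz hh
    exact Real.one_le_rpow_of_pos_of_le_one_of_nonpos w1 w2 (by
      have : 0 < 1 / k := by positivity
      linarith)
  set vx := W x ^ (-(1 / k)) with hvx
  set vy := W y ^ (-(1 / k)) with hvy
  have hb0 := Real.sqrt_nonneg (vy - nu k K)
  rcases le_or_gt (sq x y) 1 with h1 | h1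
  · have hWx := hw x hx hxr'
    have hWy := hw y hy hyr
    have hxv := hrp x hx hxr'
    have hyv := hrp y hy hyr
    have ha : √d ≤ √(vx - nu k K) := Real.sqrt_le_sqrt (by linarith)
    have hb : √d ≤ √(vy - nu k K) := Real.sqrt_le_sqrt (by linarith)
    have ha2 := Real.mul_self_sqrt (show 0 ≤ vx - nu k K by linarith)
    have hb2 := Real.mul_self_sqrt (show 0 ≤ vy - nu k K by linarith)
    have hd2 := Real.sqrt_pos.mpr hd
    set a := √(vx - nu k K)
    set b := √(vy - nu k K)
    have hKs : 0 ≤ K * sq x y ^ (γ / 2) := mul_nonneg hKp.le hs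
    have hab : 0 < a - b := by linarith
    have e1 : vx - vy = (a - b) * (a + b) := by linear_combination hb2 - ha2
    have e2 : (a - b) * (2 * √d) ≤ vx - vy := by
      rw [e1]; apply mul_le_mul_of_nonneg_left _ hab.le; linarith
    have e3 : 0 < vx - vy := lt_of_lt_of_le (by positivity) e2
    have hlt' : W x < W y := by
      by_contra hc
      push Not at hc
      have : vx ≤ vy := Real.rpow_le_rpow_of_nonpos (by linarith) hc (by
        have : 0 < 1 / k := by positivity
        linarith)
      linarith
    have e4 := rpow_slope (p := -(1 / k)) (by have : 0 < 1 / k := by positivity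
                                              linarith) hw0 hWx hlt'
    have e5 := holder1 (W := W) (x1 := y) (y1 := x) (Sol.mono H (by norm_num) (by linarith) hyr.le le_rfl)
      (by positivity) hκ hγ2 hγ hε hε1 hε2 hy hx h1
    rw [sq_comm'] at e5
    rw [neg_neg] at e4
    have hc : 0 ≤ 1 / k * w0 ^ (-(1 / k) - 1) := by positivity
    have e6 := mul_le_mul_of_nonneg_left e5 hc
    have e7 := mul_le_mul_of_nonneg_right hK2 hs
    have e8 := mul_lt_mul_of_pos_right hlt (show 0 < 2 * √d by positivity)
    linarith
  · have e1 : √(vx - nu k K) ≤ Vm := Real.sqrt_le_iff.mpr ⟨hVm0.le, by linarith [hv x hx hxr']⟩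
    have e2 : 1 ≤ (sq x y) ^ (γ / 2) := Real.one_le_rpow h1.le (by linarith)
    have e3 := mul_le_mul_of_nonneg_left e2 hKp.le
    linarith

end Deg

open Filter Topology

namespace Deg

lemma ev_small (c : ℝ) {d : ℝ} (hd : 0 < d) : ∀ᶠ ε in 𝓝[>] (0:ℝ), c * ε < d := by
  have : Tendsto (fun ε : ℝ => c * ε) (𝓝[>] 0) (𝓝 (c * 0)) :=
    ((continuous_const.mul continuous_id).tendsto 0).mono_left nhdsWithin_le_nhds
  rw [mul_zero] at this
  exact this.eventually_lt_const hd

lemma exp_beats {a : ℝ} (ha : 0 < a) (C : ℝ) : ∀ᶠ t in atTop, C * (1 + t) ^ 2 < Real.exp (a * t) := by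
  have h := (Real.tendsto_pow_mul_exp_neg_atTop_nhds_zero 2).comp
    (tendsto_id.const_mul_atTop (show 0 < a / 2 by positivity))
  have h2 := h.eventually_lt_const (show (0:ℝ) < 1 by norm_num)
  have h3 := (Real.tendsto_exp_atTop.comp
    (tendsto_id.const_mul_atTop (show 0 < a / 2 by positivity))).eventually_gt_atTop (|C| * (4 / a ^ 2 * 4))
  filter_upwards [h2, h3, eventually_ge_atTop 1] with t h2 h3 h4
  simp only [Function.comp_apply, id] at h2 h3
  rw [Real.exp_neg, ← div_eq_mul_inv, div_lt_one (Real.exp_pos _)] at h2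
  have e : Real.exp (a * t) = Real.exp (a / 2 * t) * Real.exp (a / 2 * t) := by
    rw [← Real.exp_add]; congr 1; ring
  have h5 : (1 + t) ^ 2 ≤ (4 / a ^ 2 * 4) * (a / 2 * t) ^ 2 := by
    have : (4 / a ^ 2 * 4) * (a / 2 * t) ^ 2 = (2 * t) ^ 2 := by field_simp; ring
    rw [this]
    exact pow_le_pow_left₀ (by linarith) (by linarith) 2
  calc C * (1 + t) ^ 2 ≤ |C| * (1 + t) ^ 2 := by gcongr; exact le_abs_self C
    _ ≤ |C| * ((4 / a ^ 2 * 4) * (a / 2 * t) ^ 2) := by gcongr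
    _ = |C| * (4 / a ^ 2 * 4) * (a / 2 * t) ^ 2 := by ring
    _ ≤ |C| * (4 / a ^ 2 * 4) * Real.exp (a / 2 * t) := by gcongr
    _ < Real.exp (a / 2 * t) * Real.exp (a / 2 * t) := by gcongr
    _ = _ := e.symm

lemma sq_exp_rpow (x y : ℝ) : (Real.exp x ^ 2) ^ (y / 2) = Real.exp (x * y) := by
  rw [← Real.exp_nat_mul, ← Real.exp_mul]; congr 1; push_cast; ring

/-- phase 1 constants -/
lemma phase1 {κ0 k : ℝ} (hk : 0 < k) (hκ : 1 < κ0) (hκk : κ0 < 2 * k) :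
    ∃ l ρ0 d K γ1 εA : ℝ, 0 < l ∧ 0 < ρ0 ∧ ρ0 ≤ 1 ∧ 0 < d ∧ d < 1 ∧ 0 < K ∧ γ1 < 1 ∧ 0 < εA ∧
      nu k K = 1 - d ∧
      (∀ γ, γ1 ≤ γ → γ < 1 → (√(2 * d) + K * (ρ0 ^ 2) ^ (γ / 2)) ^ 2 ≤ l * ρ0 ^ 2) ∧
      (∀ ε, 0 < ε → ε ≤ εA → l * (4 + 2 * κ0 + 10 * ε) * (1 + l * ρ0 ^ 2) < 1 / k - ε) := by
  have h1 : 1 / (4 * k * (k + 1)) < 1 / (k * (4 + 2 * κ0)) := by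
    apply one_div_lt_one_div_of_lt (by positivity)
    have := mul_lt_mul_of_pos_left (show 4 + 2 * κ0 < 4 * (k + 1) by linarith) hk
    linarith
  obtain ⟨l, hl1, hl2⟩ := exists_between h1
  have hl : 0 < l := lt_trans (by positivity) hl1
  have hlk : l * (4 + 2 * κ0) < 1 / k := by
    rw [lt_div_iff₀ (by positivity)] at hl2 ⊢
    linarith
  have c1 : ∀ᶠ ρ in 𝓝[>] (0:ℝ), l * (4 + 2 * κ0) * (1 + l * ρ ^ 2) < 1 / k := by
    have : Tendsto (fun ρ : ℝ => l * (4 + 2 * κ0) * (1 + l * ρ ^ 2)) (𝓝[>] 0)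
        (𝓝 (l * (4 + 2 * κ0) * (1 + l * 0 ^ 2))) :=
      (Continuous.tendsto (by fun_prop) 0).mono_left nhdsWithin_le_nhds
    exact this.eventually_lt_const (by simpa using hlk)
  obtain ⟨ρ0, h2, h3, hρ⟩ := (c1.and ((ev_small 1 (show (0:ℝ) < 1 by norm_num)).and
    self_mem_nhdsWithin)).exists
  have hρ : 0 < ρ0 := hρ
  have c2 : ∀ᶠ d in 𝓝[>] (0:ℝ), (√(2 * d) + √(1 / (4 * k * (k + 1) * (1 - d))) * ρ0) ^ 2 < l * ρ0 ^ 2 := by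
    have : Tendsto (fun d : ℝ => (√(2 * d) + √(1 / (4 * k * (k + 1) * (1 - d))) * ρ0) ^ 2) (𝓝[>] 0)
        (𝓝 ((√(2 * 0) + √(1 / (4 * k * (k + 1) * (1 - 0))) * ρ0) ^ 2)) := by
      apply (ContinuousAt.tendsto _).mono_left nhdsWithin_le_nhds
      have : ContinuousAt (fun d : ℝ => 1 / (4 * k * (k + 1) * (1 - d))) 0 :=
        ContinuousAt.div continuousAt_const (by fun_prop) (by simp; constructor <;> positivity)
      exact ((by fun_prop : ContinuousAt (fun d : ℝ => √(2 * d)) 0).add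
        ((this.sqrt).mul continuousAt_const)).pow 2
    refine this.eventually_lt_const ?_
    have e : (√(2 * 0) + √(1 / (4 * k * (k + 1) * (1 - 0))) * ρ0) ^ 2
        = (1 / (4 * k * (k + 1))) * ρ0 ^ 2 := by
      rw [mul_zero, Real.sqrt_zero, zero_add, mul_pow, Real.sq_sqrt (by norm_num; positivity)]
      simp
    rw [e]
    gcongr
  obtain ⟨d, h4, h5, hd⟩ := (c2.and ((ev_small 1 (show (0:ℝ) < 1 by norm_num)).and
    self_mem_nhdsWithin)).exists
  have hd : 0 < d := hd
  have hd1 : 0 < 1 - d := by linarith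
  set K := √(1 / (4 * k * (k + 1) * (1 - d))) with hKdef
  have hK : 0 < K := Real.sqrt_pos.mpr (by positivity)
  have hK2 : K ^ 2 = 1 / (4 * k * (k + 1) * (1 - d)) := Real.sq_sqrt (by positivity)
  have c3 : ∀ᶠ γ in 𝓝 (1:ℝ), (√(2 * d) + K * (ρ0 ^ 2) ^ (γ / 2)) ^ 2 < l * ρ0 ^ 2 := by
    have : Tendsto (fun γ : ℝ => (√(2 * d) + K * (ρ0 ^ 2) ^ (γ / 2)) ^ 2) (𝓝 1)
        (𝓝 ((√(2 * d) + K * (ρ0 ^ 2) ^ ((1:ℝ) / 2)) ^ 2)) := by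
      apply Continuous.tendsto
      have : Continuous (fun γ : ℝ => (ρ0 ^ 2) ^ (γ / 2)) :=
        Continuous.rpow continuous_const (by fun_prop) (fun _ => Or.inl (by positivity))
      fun_prop
    refine this.eventually_lt_const ?_
    rw [← Real.sqrt_eq_rpow, Real.sqrt_sq hρ.le]
    exact h4
  obtain ⟨γ1, hγ1, hγ2⟩ : ∃ γ1 < (1:ℝ), ∀ γ, γ1 ≤ γ → γ < 1 →
      (√(2 * d) + K * (ρ0 ^ 2) ^ (γ / 2)) ^ 2 ≤ l * ρ0 ^ 2 := by
    obtain ⟨r, hr, hh⟩ := Metric.eventually_nhds_iff.mp c3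
    refine ⟨1 - r / 2, by linarith, fun γ h1 h2 => (hh ?_).le⟩
    rw [Real.dist_eq, abs_lt]; constructor <;> linarith
  have c4 := ev_small (l * 10 * (1 + l * ρ0 ^ 2) + 1)
    (show 0 < 1 / k - l * (4 + 2 * κ0) * (1 + l * ρ0 ^ 2) by linarith)
  obtain ⟨εA, h6, hεA⟩ := (c4.and self_mem_nhdsWithin).exists
  have hεA : 0 < εA := hεA
  refine ⟨l, ρ0, d, K, γ1, εA, hl, hρ, by linarith, hd, by linarith, hK, hγ1, hεA, ?_, hγ2, ?_⟩
  · rw [nu, hK2]; field_simp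
  · intro ε h0 h1
    have : (l * 10 * (1 + l * ρ0 ^ 2) + 1) * ε ≤ (l * 10 * (1 + l * ρ0 ^ 2) + 1) * εA := by gcongr
    linarith

end Deg

open Filter Topology

namespace Deg

lemma phase2 {κ0 k d : ℝ} (hκk : κ0 < 2 * k) :
    ∃ δ1 δ γ2 : ℝ, 0 < δ1 ∧ δ1 ≤ 1 / 10 ∧ 0 < δ ∧ (1 + δ) * (1 + δ / d) ≤ 1 + δ1 ∧ γ2 < 1 ∧
      ∀ γ, γ2 ≤ γ → γ < 1 → (1 + κ0) * ((1 + δ1) / γ) ≤ 2 * k + 1 - 8 * (k + 1) * δ1 := by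
  have c1 : ∀ᶠ x in 𝓝[>] (0:ℝ), (1 + κ0) * (1 + x) + 8 * (k + 1) * x < 2 * k + 1 := by
    have : Tendsto (fun x : ℝ => (1 + κ0) * (1 + x) + 8 * (k + 1) * x) (𝓝[>] 0)
        (𝓝 ((1 + κ0) * (1 + 0) + 8 * (k + 1) * 0)) :=
      (Continuous.tendsto (by fun_prop) 0).mono_left nhdsWithin_le_nhds
    exact this.eventually_lt_const (by linarith)
  obtain ⟨δ1, h1, h2, h3⟩ := (c1.and ((ev_small 1 (show (0:ℝ) < 1 / 10 by norm_num)).and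
    self_mem_nhdsWithin)).exists
  have h3 : 0 < δ1 := h3
  have c2 : ∀ᶠ x in 𝓝[>] (0:ℝ), (1 + x) * (1 + x / d) < 1 + δ1 := by
    have : Tendsto (fun x : ℝ => (1 + x) * (1 + x / d)) (𝓝[>] 0) (𝓝 ((1 + 0) * (1 + 0 / d))) :=
      (Continuous.tendsto (by fun_prop) 0).mono_left nhdsWithin_le_nhds
    exact this.eventually_lt_const (by simp [h3])
  obtain ⟨δ, h4, h5⟩ := (c2.and self_mem_nhdsWithin).exists
  have c3 : ∀ᶠ γ in 𝓝 (1:ℝ), (1 + κ0) * ((1 + δ1) / γ) < 2 * k + 1 - 8 * (k + 1) * δ1 := by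
    have : Tendsto (fun γ : ℝ => (1 + κ0) * ((1 + δ1) / γ)) (𝓝 1) (𝓝 ((1 + κ0) * ((1 + δ1) / 1))) :=
      ContinuousAt.tendsto (f := fun γ : ℝ => (1 + κ0) * ((1 + δ1) / γ))
        (continuousAt_const.mul (continuousAt_const.div continuousAt_id one_ne_zero))
    exact this.eventually_lt_const (by rw [div_one]; linarith)
  obtain ⟨r, hr, hh⟩ := Metric.eventually_nhds_iff.mp c3
  refine ⟨δ1, δ, 1 - r / 2, h3, by linarith, h5, h4.le, by linarith, fun γ h1 h2 => (hh ?_).le⟩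
  rw [Real.dist_eq, abs_lt]; constructor <;> linarith

set_option maxHeartbeats 1000000 in
/-- phase 3: choice of the scale `R = exp t`. -/
lemma phase3 {κ0 k q d K γ1 εA cw : ℝ} (hk : 0 < k) (hκ : 1 < κ0) (hκq : κ0 < q) (hq : q < 2 * k)
    (hd : 0 < d) (hK : 0 < K) (hν : nu k K = 1 - d) (hγ1 : γ1 < 1) (hεA : 0 < εA) (hcw : 0 < cw) :
    ∃ (t γ ε g δ1 δ ρ' η τ σ Vm θ : ℝ) (n : ℕ), 0 ≤ t ∧ γ1 ≤ γ ∧ ε ≤ εA ∧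
      Par κ0 k ε γ g d δ1 δ ρ' η τ σ Vm θ K (K * (1 + δ) ^ n) ∧
      Vm ^ 2 = (cw * Real.exp (-(q * t))) ^ (-(1 / k)) ∧
      1 + (n + 1) * ρ' < 4 * Real.exp t ∧ Vm ≤ K * (1 + δ) ^ n ∧
      (1 / k) * (cw * Real.exp (-(q * t))) ^ (-(1 / k) - 1) * ((8 * (40 + 8 * κ0) + 1) / (1 - γ))
        ≤ K * (1 + δ) ^ n * (2 * √d) := by
  obtain ⟨δ1, δ, γ2, hδ1, hδ1', hδ, hδd, hγ2, hZ⟩ := phase2 (κ0 := κ0) (k := k) (d := d) (by linarith)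
  have hq0 : 0 < q := by linarith
  -- rates
  set s := q / (2 * k) with hs
  have hs1 : s < 1 := by rw [hs, div_lt_one (by positivity)]; exact hq
  have hs0 : 0 < s := by positivity
  obtain ⟨s', hss, hs'1⟩ := exists_between hs1
  set L := Real.log (1 + δ) with hL
  have hL0 : 0 < L := Real.log_pos (by linarith)
  set A3 := (1 / k + 1) * q + 1 with hA3
  have hA30 : 0 < A3 := by positivity
  have hsA : s < A3 := by
    have : s = (1 / k) * q / 2 := by rw [hs]; field_simp
    have h2 : 0 < (1 / k) * q := by positivity
    rw [this, hA3]; linarith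
  set A' := A3 + 1 with hA'
  have hLδ : 0 < Real.log (1 + δ1) := Real.log_pos (by linarith)
  set c1 := min (δ1 / 2) (Real.log (1 + δ1) / A') with hc1
  have hc10 : 0 < c1 := lt_min (by linarith) (by positivity)
  have hc1a : c1 ≤ δ1 / 2 := min_le_left _ _
  have hc1b : A' * c1 ≤ Real.log (1 + δ1) := by
    have : c1 ≤ Real.log (1 + δ1) / A' := min_le_right _ _
    rw [le_div_iff₀ (by positivity)] at this; linarith
  set Cv := cw ^ (-(1 / (2 * k))) with hCv
  have hCv0 : 0 < Cv := by positivity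
  set c2 := A3 / L + 2 with hc2
  have hc20 : 0 < c2 := by positivity
  clear_value A' c1 c2 Cv A3 s L
  have E1 := exp_beats (a := s' - s) (by linarith) (Cv * Real.exp (c1 * s') / K)
  have E2 := exp_beats (a := 1 - s') (by linarith) (c2 * (24 + 2 * κ0) * 8 / c1)
  have E3 := exp_beats (a := 1 - s') (by linarith) (c2 * 3 * (96 * (4 * k + 3)) / c1)
  have E4 := exp_beats (a := 2) (by norm_num)
    (256 * (k + 1) * (K * (1 + δ)) ^ 2 * Real.exp (2 * (A' * c1)) / (c1 * d))
  have E5 := exp_beats (a := A3 - s) (by linarith) (Cv / K)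
  have E6 := exp_beats (a := 1) (by norm_num)
    ((1 / k) * cw ^ (-(1 / k) - 1) * (8 * (40 + 8 * κ0) + 1) / c1 / (K * (2 * √d)))
  have E7 : ∀ᶠ t : ℝ in atTop, c1 / t ≤ min (1 - γ1) (min (1 - γ2) (1 / 2)) := by
    have : Tendsto (fun t : ℝ => c1 / t) atTop (𝓝 0) := tendsto_const_nhds.div_atTop tendsto_id
    exact this.eventually_le_const (lt_min (by linarith) (lt_min (by linarith) (by norm_num)))
  obtain ⟨t, E1, E2, E3, E4, E5, E6, E7, E8⟩ :=
    (E1.and (E2.and (E3.and (E4.and (E5.and (E6.and (E7.and (eventually_ge_atTop 1)))))))).exists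
  have ht : 0 < t := by linarith
  obtain ⟨E7a, E7b⟩ := le_min_iff.mp E7
  obtain ⟨E7b, E7c⟩ := le_min_iff.mp E7b
  clear E7
  set g := c1 / t with hg
  have hg0 : 0 < g := by positivity
  have hgt : g * t = c1 := by rw [hg]; field_simp
  set γ := 1 - g with hγ
  set n := ⌈A3 * t / L⌉₊ with hn
  have hn1 : A3 * t / L ≤ n := Nat.le_ceil _
  have hn2 : (n:ℝ) < A3 * t / L + 1 := Nat.ceil_lt_add_one (by positivity)
  have hnL : A3 * t ≤ n * L := by rwa [div_le_iff₀ hL0] at hn1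
  have hnL2 : n * L ≤ A3 * t + L := by
    have := mul_lt_mul_of_pos_right hn2 hL0
    rw [add_mul, div_mul_cancel₀ _ hL0.ne'] at this; linarith
  have hpow : (1 + δ) ^ n = Real.exp (n * L) := by
    rw [Real.exp_nat_mul, hL, Real.exp_log (by linarith)]
  have hpow1 : Real.exp (A3 * t) ≤ (1 + δ) ^ n := by rw [hpow]; exact Real.exp_le_exp.mpr hnL
  have hpow2 : (1 + δ) ^ n ≤ (1 + δ) * Real.exp (A3 * t) := by
    rw [hpow]; refine (Real.exp_le_exp.mpr hnL2).trans ?_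
    rw [Real.exp_add, hL, Real.exp_log (by linarith)]; linarith
  have hnc : (n:ℝ) + 1 ≤ c2 * (1 + t) := by
    have h0 : 0 < A3 / L := by positivity
    have : A3 * t / L = A3 / L * t := by ring
    rw [hc2]; rw [this] at hn2; linarith
  have ht2 : 1 + t ≤ (1 + t) ^ 2 := by rw [pow_two]; exact le_mul_of_one_le_left (by linarith) (by linarith)
  have ht3 : 1 ≤ (1 + t) ^ 2 := by linarith
  set Vm := Cv * Real.exp (s * t) with hVm
  clear_value Vm n γ g
  have hη0 : Real.exp (s' * t) / (Real.exp t / (n + 1)) = (n + 1) / Real.exp ((1 - s') * t) := by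
    rw [show s' * t = t - (1 - s') * t by ring, Real.exp_sub]; field_simp
  have hη1 : ∀ M : ℝ, 0 < M → c2 * M / c1 * (1 + t) ^ 2 < Real.exp ((1 - s') * t) →
      M * ((n + 1) / Real.exp ((1 - s') * t)) ≤ g := by
    intro M hM h1
    rw [← mul_div_assoc, div_le_iff₀ (Real.exp_pos _)]
    have h2 : M * ((n:ℝ) + 1) ≤ M * (c2 * (1 + t)) := by gcongr
    have h3 := mul_lt_mul_of_pos_left h1 hg0
    have h4 : M * (c2 * (1 + t)) ≤ g * (c2 * M / c1 * (1 + t) ^ 2) := by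
      have : g * (c2 * M / c1 * (1 + t) ^ 2) = M * (c2 * (1 + t)) * ((1 + t) / t) := by
        rw [hg]; field_simp
      rw [this]
      exact le_mul_of_one_le_right (by positivity) (by rw [le_div_iff₀ ht]; linarith)
    linarith
  have hw : ∀ e : ℝ, (cw * Real.exp (-(q * t))) ^ e = cw ^ e * Real.exp (-(q * t) * e) := fun e => by
    rw [Real.mul_rpow hcw.le (Real.exp_pos _).le, ← Real.exp_mul]
  obtain ⟨ε, e1, e2, e3, e4, e5, e6, e7⟩ := ((ev_small 1 hεA).and ((ev_small 1 (show (0:ℝ) < 1 / 4 by norm_num)).and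
    ((ev_small 6 (show 0 < κ0 - 1 by linarith)).and ((ev_small (31 + 6 * Real.exp (s' * t)) (show 0 < g / 8 by positivity)).and
    ((ev_small 8 (show 0 < g / (96 * (4 * k + 3)) by positivity)).and
    ((ev_small 128 (show 0 < K ^ 2 * g by positivity)).and self_mem_nhdsWithin)))))).exists
  refine ⟨t, γ, ε, g, δ1, δ, Real.exp t / (n + 1), Real.exp (s' * t) / (Real.exp t / (n + 1)),
    Real.exp (s' * t), Real.exp (-(A' * t)) ^ 2, Vm, g / (96 * (4 * k + 3)), n, ht.le, by linarith,
    by linarith, ?_, ?_, ?_, ?_, ?_⟩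
  · refine ⟨hk, hκ, hK, hd, hν.le, (by rw [hγ]; ring), (by linarith), (by linarith), e7, (by linarith),
      e3.le, hδ1', hδ, hδd, (by field_simp), (by positivity), (by positivity), rfl, ?_, ?_, e4.le, e5.le,
      e6.le, ?_, (by positivity), ?_, ?_, hZ γ (by linarith) (by linarith), (by rw [hVm]; positivity), ?_⟩
    · rw [hη0]
      have := hη1 ((24 + 2 * κ0) * 8) (by positivity) (by
        rw [← mul_assoc]; exact E2)
      linarith
    · rw [hη0, le_div_iff₀ (by positivity)]
      have := hη1 (3 * (96 * (4 * k + 3))) (by positivity) (by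
        rw [← mul_assoc]; exact E3)
      linarith
    · rw [sq_exp_rpow]
      have h1 : s' * t * (γ - 1) = -(c1 * s') := by rw [hγ]; linear_combination -s' * hgt
      rw [h1]
      have h2 : 1 - c1 ≤ Real.exp (-(c1 * s')) := by
        have h3 := Real.add_one_le_exp (-(c1 * s'))
        have : c1 * s' ≤ c1 * 1 := by gcongr
        linarith
      have h3 : g ≤ c1 := by rw [← hgt]; exact le_mul_of_one_le_right hg0.le E8
      have h4 : (1 - c1) * (1 - c1) ≤ γ * Real.exp (-(c1 * s')) :=
        mul_le_mul (by rw [hγ]; linarith) h2 (by linarith) (by linarith)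
      have h5 := sq_nonneg c1
      linarith
    · rw [sq_exp_rpow]
      have h1 : -(A' * t) * (γ - 1) = A' * c1 := by rw [hγ]; linear_combination A' * hgt
      rw [h1, ← Real.le_log_iff_exp_le (by linarith)]
      exact hc1b
    · rw [sq_exp_rpow]
      have h1 : -(A' * t) * γ = -(A' * t) + A' * c1 := by rw [hγ]; linear_combination A' * hgt
      rw [h1, ← Real.exp_nat_mul]
      have h2 : (K * (1 + δ) ^ n) ^ 2 ≤ (K * ((1 + δ) * Real.exp (A3 * t))) ^ 2 := by gcongr
      have h3 : (K * ((1 + δ) * Real.exp (A3 * t))) ^ 2 = (K * (1 + δ)) ^ 2 * Real.exp (2 * (A3 * t)) := by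
        rw [show (2:ℝ) * (A3 * t) = ((2:ℕ):ℝ) * (A3 * t) by push_cast; ring, Real.exp_nat_mul]; ring
      have h4 : Real.exp (2 * (A3 * t)) * Real.exp (((2:ℕ):ℝ) * (-(A' * t) + A' * c1)) * Real.exp (2 * t) = Real.exp (2 * (A' * c1)) := by
        rw [← Real.exp_add, ← Real.exp_add]; congr 1; rw [hA']; push_cast; ring
      have h5 : 256 * (k + 1) * (K * (1 + δ)) ^ 2 * Real.exp (2 * (A' * c1)) < g * d * Real.exp (2 * t) := by
        have := mul_lt_mul_of_pos_left E4 (show 0 < g * d by positivity)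
        refine lt_of_le_of_lt ?_ this
        have e : g * d * (256 * (k + 1) * (K * (1 + δ)) ^ 2 * Real.exp (2 * (A' * c1)) / (c1 * d) * (1 + t) ^ 2) = 256 * (k + 1) * (K * (1 + δ)) ^ 2 * Real.exp (2 * (A' * c1)) * ((1 + t) ^ 2 / t) := by
          rw [hg]; field_simp
        rw [e]
        exact le_mul_of_one_le_right (by positivity) (by rw [le_div_iff₀ ht]; linarith)
      have h6 := Real.exp_pos (2 * t)
      refine lt_of_mul_lt_mul_right (a := Real.exp (2 * t)) ?_ h6.le
      refine lt_of_le_of_lt ?_ h5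
      calc 256 * (k + 1) * (K * (1 + δ) ^ n) ^ 2 * Real.exp (((2:ℕ):ℝ) * (-(A' * t) + A' * c1)) * Real.exp (2 * t)
          ≤ 256 * (k + 1) * ((K * (1 + δ)) ^ 2 * Real.exp (2 * (A3 * t))) * Real.exp (((2:ℕ):ℝ) * (-(A' * t) + A' * c1)) * Real.exp (2 * t) := by
            rw [h3] at h2; gcongr
        _ = 256 * (k + 1) * (K * (1 + δ)) ^ 2 * (Real.exp (2 * (A3 * t)) * Real.exp (((2:ℕ):ℝ) * (-(A' * t) + A' * c1)) * Real.exp (2 * t)) := by ring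
        _ = _ := by rw [h4]
        _ ≤ _ := le_rfl
    · rw [sq_exp_rpow]
      have h1 : s' * t * γ = s * t + (s' - s) * t - c1 * s' := by rw [hγ]; linear_combination -s' * hgt
      rw [h1, Real.exp_sub, Real.exp_add]
      have h2 : Cv * Real.exp (c1 * s') / K ≤ Real.exp ((s' - s) * t) :=
        le_trans (le_mul_of_one_le_right (by positivity) ht3) E1.le
      rw [div_le_iff₀ hK] at h2
      rw [← mul_div_assoc, le_div_iff₀ (Real.exp_pos _)]
      have := mul_le_mul_of_nonneg_left h2 (Real.exp_pos (s * t)).le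
      rw [hVm]; linarith
  · rw [hw, hVm, mul_pow, ← Real.exp_nat_mul, hCv, ← Real.rpow_mul_natCast hcw.le]
    congr 2
    · push_cast; field_simp
    · rw [hs]; push_cast; field_simp
  · rw [mul_div_cancel₀ _ (by positivity : (n:ℝ) + 1 ≠ 0)]
    have := Real.add_one_le_exp t
    linarith
  · have h2 : Cv / K ≤ Real.exp ((A3 - s) * t) :=
      le_trans (le_mul_of_one_le_right (by positivity) ht3) E5.le
    rw [div_le_iff₀ hK] at h2
    calc Vm ≤ Real.exp ((A3 - s) * t) * K * Real.exp (s * t) := by rw [hVm]; gcongr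
      _ = K * Real.exp (A3 * t) := by
        rw [show A3 * t = (A3 - s) * t + s * t by ring, Real.exp_add]; ring
      _ ≤ _ := by gcongr
  · rw [hw, show 1 - γ = g by rw [hγ]; ring]
    have h1 : Real.exp (-(q * t) * (-(1 / k) - 1)) * Real.exp (1 * t) = Real.exp (A3 * t) := by
      rw [← Real.exp_add]; congr 1; rw [hA3]; ring
    have hKd : 0 < K * (2 * √d) := by have := Real.sqrt_pos.mpr hd; positivity
    have h2 := (div_le_iff₀ hKd).mp
      (show (1 / k) * cw ^ (-(1 / k) - 1) * ((8 * (40 + 8 * κ0) + 1) / g) / (K * (2 * √d)) ≤ Real.exp (1 * t) by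
        refine le_trans ?_ E6.le
        have : (1 / k) * cw ^ (-(1 / k) - 1) * ((8 * (40 + 8 * κ0) + 1) / g) / (K * (2 * √d)) =
          ((1 / k) * cw ^ (-(1 / k) - 1) * (8 * (40 + 8 * κ0) + 1) / c1 / (K * (2 * √d))) * t := by
            rw [hg]; field_simp
        rw [this]
        exact mul_le_mul_of_nonneg_left (by linarith) (by positivity))
    calc (1 / k) * (cw ^ (-(1 / k) - 1) * Real.exp (-(q * t) * (-(1 / k) - 1))) * ((8 * (40 + 8 * κ0) + 1) / g)
        = (1 / k) * cw ^ (-(1 / k) - 1) * ((8 * (40 + 8 * κ0) + 1) / g) * Real.exp (-(q * t) * (-(1 / k) - 1)) := by ring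
      _ ≤ Real.exp (1 * t) * (K * (2 * √d)) * Real.exp (-(q * t) * (-(1 / k) - 1)) := by gcongr
      _ = K * Real.exp (A3 * t) * (2 * √d) := by rw [← h1]; ring
      _ ≤ _ := by gcongr

end Deg

open Filter Topology

namespace Deg

/-- Local bound: an almost solution on a large half ball is not close to its maximum at the centre. -/
theorem local_thm {κ0 k : ℝ} (hk : 0 < k) (hκ : 1 < κ0) (hκk : κ0 < 2 * k) :
    ∃ ρ ε δ : ℝ, 0 < ρ ∧ 0 < ε ∧ 0 < δ ∧ δ < 1 ∧ ∀ (W : ℝ × ℝ → ℝ) (z0 : ℝ × ℝ), 0 < z0.2 →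
      Sol W z0 ρ κ0 (1 + 2 / k) ε → W z0 < 1 - δ := by
  obtain ⟨l, ρ0, d, K, γ1, εA, hl, hρ0, hρ01, hd, hd1, hK, hγ1, hεA, hν, hB, hA⟩ := phase1 hk hκ hκk
  obtain ⟨q, hq1, hq2⟩ := exists_between hκk
  have hq0 : 0 < q := by linarith
  -- Hölder radius
  set M := (8 * (40 + 8 * κ0) + 1) / (1 - 1 / 2) with hM
  have hM0 : 0 < M := by rw [hM]; exact div_pos (by positivity) (by norm_num)
  obtain ⟨ρ1, hρ1a, hρ1b, hρ10⟩ : ∃ ρ1 : ℝ, M * (ρ1 ^ 2) ^ ((1:ℝ) / 2 / 2) < 1 / 4 ∧ ρ1 ≤ 1 ∧ 0 < ρ1 := by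
    have hc : Tendsto (fun x : ℝ => M * (x ^ 2) ^ ((1:ℝ) / 2 / 2)) (𝓝[>] 0)
        (𝓝 (M * ((0:ℝ) ^ 2) ^ ((1:ℝ) / 2 / 2))) := by
      apply (Continuous.tendsto _ 0).mono_left nhdsWithin_le_nhds
      exact continuous_const.mul ((continuous_pow 2).rpow_const fun _ => Or.inr (by norm_num))
    rw [zero_pow two_ne_zero, Real.zero_rpow (by norm_num), mul_zero] at hc
    obtain ⟨x, h1, h2, h3⟩ := ((hc.eventually_lt_const (show (0:ℝ) < 1 / 4 by norm_num)).and
      ((ev_small 1 (show (0:ℝ) < 1 by norm_num)).and self_mem_nhdsWithin)).exists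
    exact ⟨x, h1, by linarith, h3⟩
  set cw := (ρ1 ^ 2) ^ (q / 2) / 4 * ((16:ℝ) ^ (-(q / 2)) - (64:ℝ) ^ (-(q / 2))) with hcw
  have hcw0 : 0 < cw := by
    have : (64:ℝ) ^ (-(q / 2)) < (16:ℝ) ^ (-(q / 2)) :=
      Real.rpow_lt_rpow_of_neg (by norm_num) (by norm_num) (by linarith)
    have h2 : 0 < (16:ℝ) ^ (-(q / 2)) - (64:ℝ) ^ (-(q / 2)) := by linarith
    rw [hcw]; positivity
  obtain ⟨t, γ, ε1, g, δ1, δ, ρ', η, τ, σ, Vm, θ, n, ht, hγ, hε1A, P, hVm2, hn, hVmK, hterm⟩ :=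
    phase3 hk hκ hq1 hq2 hd hK hν hγ1 hεA hcw0
  set R := Real.exp t with hR
  have hR1 : 1 ≤ R := Real.one_le_exp ht
  have hR0 : 0 < R := by linarith
  set w0 := cw * Real.exp (-(q * t)) with hw0
  have hw00 : 0 < w0 := by positivity
  have hRq : ∀ c : ℝ, 0 < c → (c * R ^ 2) ^ (-(q / 2)) = c ^ (-(q / 2)) * Real.exp (-(q * t)) := by
    intro c hc
    rw [Real.mul_rpow hc.le (by positivity), hR, ← neg_div, sq_exp_rpow]
    congr 2; ring
  have hw0eq : (ρ1 ^ 2) ^ (q / 2) / 4 * ((16 * R ^ 2) ^ (-(q / 2)) - (64 * R ^ 2) ^ (-(q / 2))) = w0 := by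
    rw [hRq 16 (by norm_num), hRq 64 (by norm_num), hw0, hcw]; ring
  have hg0 : 0 < 1 - γ := by linarith [P.hγ]
  have hε10 := P.hε
  obtain ⟨ε, e1, e2, e3, e4, e5, e6, e7, e8⟩ :=
    ((ev_small 6 (show 0 < κ0 - 1 by linarith)).and ((ev_small 1 (show (0:ℝ) < 1 / 4 by norm_num)).and
    ((ev_small (14 + 4 * q + 32 * R) (show 0 < q - κ0 by linarith)).and
    ((ev_small 1 (show 0 < (ρ1 ^ 2) ^ (q / 2) / 4 * (q / 2 * (64 * R ^ 2) ^ (-(q / 2) - 1) * (q - κ0)) by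
      have : 0 < q - κ0 := by linarith
      positivity)).and
    ((ev_small 400 hg0).and ((ev_small 1 hε10).and ((ev_small (w0 ^ (-(2 / k) - 1)) (show 0 < k * ε1 by positivity)).and
    self_mem_nhdsWithin))))))).exists
  have e8 : 0 < ε := e8
  have h200 : 200 * ε ≤ 1 - 1 / 2 := by linarith [P.hγ2]
  set ω := max (1 / 2) ((1 + d) ^ (-k)) with hω
  have hω1 : ω < 1 := max_lt (by norm_num) (Real.rpow_lt_one_of_one_lt_of_neg (by linarith) (by linarith))
  have hω2 : 1 / 2 ≤ ω := le_max_left _ _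
  refine ⟨9 * R, ε, 1 - ω, by positivity, e8, by linarith, by linarith, fun W z0 hz0 H => ?_⟩
  by_contra hcon
  push Not at hcon
  have hWω : ω ≤ W z0 := by linarith
  -- step a
  have hW4 : ∀ z : ℝ × ℝ, 0 < z.2 → sq z z0 ≤ ρ1 ^ 2 → 1 / 4 ≤ W z := by
    intro z hz hzr
    have h1 := holder1 (γ := 1 / 2) (Sol.mono H (ρ1 := 3) (t := 0) (by norm_num) le_rfl (by rw [sq_self]; norm_num)
      (by linarith)) (by positivity) hκ le_rfl (by norm_num) e8.le e1.le h200 hz0 hz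
      (hzr.trans (pow_le_one₀ hρ10.le hρ1b))
    rw [sq_comm', ← hM] at h1
    have h2 : sq z z0 ^ ((1:ℝ) / 2 / 2) ≤ (ρ1 ^ 2) ^ ((1:ℝ) / 2 / 2) :=
      Real.rpow_le_rpow (sq_nonneg' _ _) hzr (by norm_num)
    have h3 := mul_le_mul_of_nonneg_left h2 hM0.le
    linarith only [h1, h3, hρ1a, hWω, hω2]
  have hWl : ∀ z : ℝ × ℝ, 0 < z.2 → sq z z0 < (4 * R) ^ 2 → w0 ≤ W z := by
    intro z hz hzr
    rw [← hw0eq]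
    refine lower_bound H hκ hq1 hR1 hρ10 hρ1b hz0 hW4 e8.le e1.le (by linarith only [e2]) e3.le
      (by linarith only [e4]) hz ?_
    linarith only [hzr]
  have hSol4 : Sol W z0 (4 * R) κ0 (1 + 2 / k) ε :=
    Sol.mono H (t := 0) (by positivity) le_rfl (by rw [sq_self]; norm_num) (by linarith only [hR0])
  have hV : VSol (fun z => W z ^ (-(1 / k))) z0 (4 * R) κ0 k ε1 :=
    toV hk hSol4 hw00 e8.le (by linarith only [e6]) hWl e7.le
  have hvb : ∀ z : ℝ × ℝ, 0 < z.2 → sq z z0 < (4 * R) ^ 2 → W z ^ (-(1 / k)) ≤ Vm ^ 2 := by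
    intro z hz hzr
    rw [hVm2]
    exact Real.rpow_le_rpow_of_nonpos hw00 (hWl z hz hzr) (by
      have : 0 < 1 / k := by positivity
      linarith only [this])
  have hv0 : W z0 ^ (-(1 / k)) ≤ 1 + d := by
    have h1 : (1 + d) ^ (-k) ≤ W z0 := (le_max_right _ _).trans hWω
    have h2 := Real.rpow_le_rpow_of_nonpos (z := -(1 / k)) (by positivity) h1 (by
      have : 0 < 1 / k := by positivity
      linarith only [this])
    rw [← Real.rpow_mul (by linarith only [hd])] at h2
    rwa [show -k * -(1 / k) = 1 by field_simp, Real.rpow_one] at h2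
  -- step b
  have hV2 : VSol (fun z => W z ^ (-(1 / k))) z0 2 κ0 k ε1 := fun z hz hzr => hV z hz (by
    refine hzr.trans_le (pow_le_pow_left₀ (by norm_num) (by linarith only [hR1]) 2))
  have h4R : 0 < 4 * R := by positivity
  have hC0 : Cl (fun z => W z ^ (-(1 / k))) z0 (4 * R) k γ K ρ0 := by
    obtain ⟨x, hx, hxr, hlt⟩ := claim0 (K := K) (γ := γ) (ρ0 := ρ0) (δ := d) (l := l) hk hV2 hκ P.hε.le P.hεκ P.hε4 hz0 hρ0 hρ01 hd hd1 hK
      (by linarith only [P.hγ2]) hl hv0 (hB γ hγ P.hγ) (hA ε1 P.hε hε1A)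
    refine ⟨x, z0, hx, hz0, hxr, by rw [sq_self]; positivity, ?_⟩
    rw [hν]; exact hlt
  have hn0 : (0:ℝ) ≤ n := Nat.cast_nonneg n
  have hCn := iter P hV hvb hρ0.le n le_rfl (by linarith only [hn, hρ01]) hC0 n le_rfl
  have hKn : K ≤ K * (1 + δ) ^ n :=
    le_mul_of_one_le_right hK.le (one_le_pow₀ (by linarith only [P.hδ0]))
  have hρ'n : 0 ≤ n * ρ' := mul_nonneg hn0 P.hρ.le
  refine terminal hk (Sol.mono H (ρ1 := 3 + 4 * R) (t := 0) (by positivity) le_rfl (by rw [sq_self]; norm_num)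
    (by linarith only [hR1])) hκ P.hγ2 P.hγ e8.le e1.le (by linarith only [e5, e8]) hw00 hd
    (by linarith only [hρ'n, hρ0]) (by linarith only [hn, hρ01, P.hρ]) hWl P.hVm0 hvb
    ((nu_mono hk hK hKn).trans hν.le) (by unfold nu; positivity) hVmK hterm hCn

end Deg

open Filter Topology

namespace Deg

abbrev E := Fin 2 → ℝ

lemma hasDerivAt_pd {F : E → ℝ} {x : E} (h : DifferentiableAt ℝ F x) (k : Fin 2) :
    HasDerivAt (fun t => F (Function.update x k t)) (pd k F x) (x k) := by
  have h1 : DifferentiableAt ℝ F (Function.update x k (x k)) := by rwa [Function.update_eq_self]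
  have := h1.hasFDerivAt.comp_hasDerivAt (x k) (hasDerivAt_update x k (x k))
  exact this.differentiableAt.hasDerivAt

lemma pd_eq {F : E → ℝ} {x : E} (h : DifferentiableAt ℝ F x) (k : Fin 2) :
    pd k F x = fderiv ℝ F x (Pi.single k 1) := by
  have h1 : DifferentiableAt ℝ F (Function.update x k (x k)) := by rwa [Function.update_eq_self]
  have := (h1.hasFDerivAt.comp_hasDerivAt (x k) (hasDerivAt_update x k (x k))).deriv
  rw [Function.update_eq_self] at this
  exact this

lemma fderiv_eq_pd {F : E → ℝ} {x : E} (h : DifferentiableAt ℝ F x) (v : E) :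
    fderiv ℝ F x v = v 0 * pd 0 F x + v 1 * pd 1 F x := by
  rw [pd_eq h, pd_eq h]
  have : v = v 0 • (Pi.single 0 1 : E) + v 1 • (Pi.single 1 1 : E) := by
    ext i; fin_cases i <;> simp
  conv_lhs => rw [this]
  rw [map_add, map_smul, map_smul, smul_eq_mul, smul_eq_mul]

lemma tendsto_update (x : E) (k : Fin 2) :
    Tendsto (fun t => Function.update x k t) (𝓝 (x k)) (𝓝 x) := by
  have := (hasDerivAt_update x k (x k)).continuousAt.tendsto
  rwa [Function.update_eq_self] at this

lemma pd_congr {F G : E → ℝ} {x : E} (h : F =ᶠ[𝓝 x] G) (k : Fin 2) : pd k F x = pd k G x := by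
  unfold pd
  exact Filter.EventuallyEq.deriv_eq ((tendsto_update x k).eventually h)

lemma pd_congr' {F G : E → ℝ} {x : E} (h : F =ᶠ[𝓝 x] G) (k : Fin 2) : pd k F =ᶠ[𝓝 x] pd k G := by
  filter_upwards [h.eventually_nhds] with y hy using pd_congr hy k

lemma C2.diff {X : Type*} [NormedAddCommGroup X] [NormedSpace ℝ X] {F : X → ℝ} {x : X}
    (h : ContDiffAt ℝ 2 F x) : ∀ᶠ y in 𝓝 x, DifferentiableAt ℝ F y := by
  filter_upwards [h.eventually (by simp)] with y hy using hy.differentiableAt (by simp)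

lemma C2.fderiv {X : Type*} [NormedAddCommGroup X] [NormedSpace ℝ X] {F : X → ℝ} {x : X}
    (h : ContDiffAt ℝ 2 F x) (v : X) : ContDiffAt ℝ 1 (fun y => fderiv ℝ F y v) x :=
  (h.fderiv_right (m := 1) (by norm_num)).clm_apply contDiffAt_const

lemma C2.pd {F : E → ℝ} {x : E} (h : ContDiffAt ℝ 2 F x) (k : Fin 2) : ContDiffAt ℝ 1 (pd k F) x := by
  refine (C2.fderiv h (Pi.single k 1)).congr_of_eventuallyEq ?_
  filter_upwards [C2.diff h] with y hy using pd_eq hy k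

lemma hasDerivAt_pd' {F : E → ℝ} {x : E} {d : ℝ} {k : Fin 2}
    (h : HasDerivAt (fun t => F (Function.update x k t)) d (x k)) : pd k F x = d := h.deriv

lemma pair_eq (L : ℝ × ℝ →L[ℝ] ℝ) (a b : ℝ) : L (a, b) = a * L (1, 0) + b * L (0, 1) := by
  have : ((a, b) : ℝ × ℝ) = a • ((1:ℝ), (0:ℝ)) + b • ((0:ℝ), (1:ℝ)) := by simp
  rw [this, map_add, map_smul, map_smul, smul_eq_mul, smul_eq_mul]

lemma chain1' {F : ℝ × ℝ → ℝ} {T1 T2 : E → ℝ} {x : E} (hF : DifferentiableAt ℝ F (T1 x, T2 x))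
    (h1 : DifferentiableAt ℝ T1 x) (h2 : DifferentiableAt ℝ T2 x) (k : Fin 2) :
    HasDerivAt (fun t => F (T1 (Function.update x k t), T2 (Function.update x k t)))
      (fderiv ℝ F (T1 x, T2 x) (1, 0) * pd k T1 x + fderiv ℝ F (T1 x, T2 x) (0, 1) * pd k T2 x) (x k) := by
  have hd := (hasDerivAt_pd h1 k).prodMk (hasDerivAt_pd h2 k)
  have hF' : HasFDerivAt F (fderiv ℝ F (T1 x, T2 x))
      (T1 (Function.update x k (x k)), T2 (Function.update x k (x k))) := by
    rw [Function.update_eq_self]; exact hF.hasFDerivAt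
  have := hF'.comp_hasDerivAt (x k) hd
  refine this.congr_deriv ?_
  rw [pair_eq]; ring

lemma chain1 {F : ℝ × ℝ → ℝ} {T1 T2 : E → ℝ} {x : E} (hF : DifferentiableAt ℝ F (T1 x, T2 x))
    (h1 : DifferentiableAt ℝ T1 x) (h2 : DifferentiableAt ℝ T2 x) (k : Fin 2) :
    pd k (fun y => F (T1 y, T2 y)) x =
      fderiv ℝ F (T1 x, T2 x) (1, 0) * pd k T1 x + fderiv ℝ F (T1 x, T2 x) (0, 1) * pd k T2 x :=
  (chain1' hF h1 h2 k).deriv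

/-- jet of a `C²` function -/
noncomputable def jt (F : ℝ × ℝ → ℝ) (z : ℝ × ℝ) : Jt :=
  ⟨fderiv ℝ F z (1, 0), fderiv ℝ F z (0, 1), fderiv ℝ (fun y => fderiv ℝ F y (1, 0)) z (1, 0),
    fderiv ℝ (fun y => fderiv ℝ F y (1, 0)) z (0, 1), fderiv ℝ (fun y => fderiv ℝ F y (0, 1)) z (0, 1)⟩

lemma jt_symm {F : ℝ × ℝ → ℝ} {z : ℝ × ℝ} (h : ContDiffAt ℝ 2 F z) :
    fderiv ℝ (fun y => fderiv ℝ F y (0, 1)) z (1, 0) = fderiv ℝ (fun y => fderiv ℝ F y (1, 0)) z (0, 1) := by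
  have hd : DifferentiableAt ℝ (fderiv ℝ F) z :=
    (h.fderiv_right (m := 1) (by norm_num)).differentiableAt (by simp)
  have e : ∀ v w : ℝ × ℝ, fderiv ℝ (fun y => fderiv ℝ F y v) z w = fderiv ℝ (fderiv ℝ F) z w v := by
    intro v w
    rw [fderiv_clm_apply hd (differentiableAt_const v)]
    simp
  rw [e, e]
  exact (h.isSymmSndFDerivAt (by simp)) _ _

lemma jet_jt {F : ℝ × ℝ → ℝ} {z : ℝ × ℝ} (h : ContDiffAt ℝ 2 F z) : Jet F z (jt F z) := by
  intro a1 a2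
  have hline : ∀ t : ℝ, HasDerivAt (fun t : ℝ => (z.1 + t * a1, z.2 + t * a2)) (a1, a2) t := by
    intro t
    have := (((hasDerivAt_id t).mul_const a1).const_add z.1).prodMk
      (((hasDerivAt_id t).mul_const a2).const_add z.2)
    simpa using this
  have h0 : ((z.1 + 0 * a1, z.2 + 0 * a2) : ℝ × ℝ) = z := by simp
  have hc : Tendsto (fun t : ℝ => ((z.1 + t * a1, z.2 + t * a2) : ℝ × ℝ)) (𝓝 0) (𝓝 z) := by
    have := (hline 0).continuousAt.tendsto
    rwa [h0] at this
  refine ⟨fun t => a1 * fderiv ℝ F (z.1 + t * a1, z.2 + t * a2) (1, 0) +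
    a2 * fderiv ℝ F (z.1 + t * a1, z.2 + t * a2) (0, 1), ?_, ?_, ?_⟩
  · filter_upwards [hc.eventually (C2.diff h)] with t ht
    refine (ht.hasFDerivAt.comp_hasDerivAt t (hline t)).congr_deriv ?_
    rw [pair_eq]
  · simp only [h0]; rfl
  · have g : ∀ v : ℝ × ℝ, HasDerivAt (fun t : ℝ => fderiv ℝ F (z.1 + t * a1, z.2 + t * a2) v)
        (fderiv ℝ (fun y => fderiv ℝ F y v) z (a1, a2)) 0 := by
      intro v
      have hd : DifferentiableAt ℝ (fun y => fderiv ℝ F y v) (z.1 + 0 * a1, z.2 + 0 * a2) := by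
        rw [h0]; exact (C2.fderiv h v).differentiableAt (by simp)
      have := hd.hasFDerivAt.comp_hasDerivAt (0:ℝ) (hline 0)
      rwa [h0] at this
    refine (((g (1, 0)).const_mul a1).add ((g (0, 1)).const_mul a2)).congr_deriv ?_
    rw [pair_eq (fderiv ℝ (fun y => fderiv ℝ F y (1, 0)) z), pair_eq (fderiv ℝ (fun y => fderiv ℝ F y (0, 1)) z), jt_symm h]
    simp only [jt]; ring

/-- the linear operator -/
noncomputable def Lop (A : Fin 2 → Fin 2 → E → ℝ) (B : Fin 2 → E → ℝ) (u : E → ℝ) (x : E) : ℝ :=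
  (∑ i, ∑ j, A i j x * pd2 i j u x) + ∑ i, B i x * pd i u x

noncomputable def Bil (A : Fin 2 → Fin 2 → E → ℝ) (u v : E → ℝ) (x : E) : ℝ :=
  ∑ i, ∑ j, A i j x * pd i u x * pd j v x

lemma chain2 {F : ℝ × ℝ → ℝ} {u T1 T2 : E → ℝ} {x : E} (hF : ContDiffAt ℝ 2 F (T1 x, T2 x))
    (h1 : ContDiffAt ℝ 2 T1 x) (h2 : ContDiffAt ℝ 2 T2 x)
    (hu : u =ᶠ[𝓝 x] fun y => F (T1 y, T2 y)) (i j : Fin 2) :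
    pd i u x = (jt F (T1 x, T2 x)).p1 * pd i T1 x + (jt F (T1 x, T2 x)).p2 * pd i T2 x ∧
    pd2 i j u x = ((jt F (T1 x, T2 x)).h11 * pd i T1 x + (jt F (T1 x, T2 x)).h12 * pd i T2 x) * pd j T1 x
      + (jt F (T1 x, T2 x)).p1 * pd2 i j T1 x
      + ((jt F (T1 x, T2 x)).h12 * pd i T1 x + (jt F (T1 x, T2 x)).h22 * pd i T2 x) * pd j T2 x
      + (jt F (T1 x, T2 x)).p2 * pd2 i j T2 x := by
  have d1 := h1.differentiableAt (by simp)
  have d2 := h2.differentiableAt (by simp)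
  have hcont : Tendsto (fun y => (T1 y, T2 y)) (𝓝 x) (𝓝 (T1 x, T2 x)) :=
    (d1.continuousAt.prodMk d2.continuousAt).tendsto
  refine ⟨?_, ?_⟩
  · rw [pd_congr hu, chain1 (hF.differentiableAt (by simp)) d1 d2]; rfl
  · have e : (fun y => pd j u y) =ᶠ[𝓝 x] fun y => fderiv ℝ F (T1 y, T2 y) (1, 0) * pd j T1 y +
        fderiv ℝ F (T1 y, T2 y) (0, 1) * pd j T2 y := by
      filter_upwards [pd_congr' hu j, hcont.eventually (C2.diff hF), C2.diff h1, C2.diff h2] with y a b c d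
      rw [a, chain1 b c d]
    unfold pd2
    rw [pd_congr e]
    have g1 := chain1' ((C2.fderiv hF (1, 0)).differentiableAt (by simp)) d1 d2 i
    have g2 := chain1' ((C2.fderiv hF (0, 1)).differentiableAt (by simp)) d1 d2 i
    have k1 := hasDerivAt_pd ((C2.pd h1 j).differentiableAt (by simp)) i
    have k2 := hasDerivAt_pd ((C2.pd h2 j).differentiableAt (by simp)) i
    have := (g1.mul k1).add (g2.mul k2)
    rw [Function.update_eq_self, jt_symm hF] at this
    rw [hasDerivAt_pd' this]
    simp only [jt]; ring

lemma push {A : Fin 2 → Fin 2 → E → ℝ} {B : Fin 2 → E → ℝ} {F : ℝ × ℝ → ℝ} {u T1 T2 : E → ℝ} {x : E}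
    (hA : A 0 1 x = A 1 0 x) (hF : ContDiffAt ℝ 2 F (T1 x, T2 x))
    (h1 : ContDiffAt ℝ 2 T1 x) (h2 : ContDiffAt ℝ 2 T2 x)
    (hu : u =ᶠ[𝓝 x] fun y => F (T1 y, T2 y)) :
    (⟨Bil A T1 T1 x, Bil A T1 T2 x, Bil A T2 T2 x, Lop A B T1 x, Lop A B T2 x⟩ : Op).L (jt F (T1 x, T2 x))
      = Lop A B u x := by
  have c := fun i j => chain2 hF h1 h2 hu i j
  simp only [Lop, Bil, Op.L, Fin.sum_univ_two, (c 0 0).1, (c 1 0).1, (c 0 0).2, (c 0 1).2, (c 1 0).2, (c 1 1).2, hA]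
  ring

end Deg

open Filter Topology

namespace Deg

def OC (o : Op) (r κ0 ε Bd : ℝ) : Prop :=
  |o.a11 - 1| ≤ ε ∧ |o.a12| ≤ ε ∧ |o.a22 - 1| ≤ ε ∧ |o.b1| ≤ Bd ∧
    ∃ κ β, o.b2 = κ / r + β ∧ |κ - κ0| ≤ ε ∧ |β| ≤ Bd

def Chart (Ω : Set E) (A : Fin 2 → Fin 2 → E → ℝ) (B : Fin 2 → E → ℝ) (xb : E) (κ0 : ℝ) : Prop :=
  ∀ ε > 0, ∀ U ∈ 𝓝 xb, ∃ O ∈ 𝓝 xb, ∃ ρ > 0, ∃ Bd : ℝ, ∃ G : ℝ × ℝ → E, ∀ x0 ∈ O ∩ Ω, ∃ z0 : ℝ × ℝ,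
    0 < z0.2 ∧ G z0 = x0 ∧ ∀ z : ℝ × ℝ, 0 < z.2 → sq z z0 < ρ ^ 2 → G z ∈ Ω ∩ U ∧
      ∀ u : E → ℝ, ContDiffOn ℝ 2 u Ω → ContinuousAt (fun z => u (G z)) z ∧
        ∃ j o, Jet (fun z => u (G z)) z j ∧ o.L j = Lop A B u (G z) ∧ OC o z.2 κ0 ε Bd

lemma jet_scale {F : ℝ × ℝ → ℝ} {ξ ℓ M : ℝ} {z : ℝ × ℝ} {j : Jt}
    (h : Jet F (ξ + ℓ * z.1, ℓ * z.2) j) :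
    Jet (fun z => F (ξ + ℓ * z.1, ℓ * z.2) / M) z
      ⟨ℓ * j.p1 / M, ℓ * j.p2 / M, ℓ ^ 2 * j.h11 / M, ℓ ^ 2 * j.h12 / M, ℓ ^ 2 * j.h22 / M⟩ := by
  intro a1 a2
  have := (h (ℓ * a1) (ℓ * a2)).const_mul (1 / M)
  have h2 := this.congr (g := fun t => F (ξ + ℓ * (z.1 + t * a1), ℓ * (z.2 + t * a2)) / M)
    (Eventually.of_forall fun t => by
      show F _ / M = 1 / M * F _
      rw [show ξ + ℓ * (z.1 + t * a1) = ξ + ℓ * z.1 + t * (ℓ * a1) by ring,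
        show ℓ * (z.2 + t * a2) = ℓ * z.2 + t * (ℓ * a2) by ring]
      ring)
  exact h2.congr_vals (by ring) (by ring)

theorem chart_bound {Ω : Set E} {A : Fin 2 → Fin 2 → E → ℝ} {B : Fin 2 → E → ℝ} {xb : E} {κ0 k hb : ℝ}
    {f : E → ℝ → ℝ} (hk : 0 < k) (hκ : 1 < κ0) (hκk : κ0 < 2 * k) (hhb : 0 < hb)
    (hC : Chart Ω A B xb κ0)
    (hf : ∀ ε > 0, ∃ U ∈ 𝓝 xb, ∃ M0 : ℝ, ∀ M ≥ M0, ∀ x ∈ Ω ∩ U, ∀ w : ℝ, 0 < w → w ≤ 1 →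
      |f x (M * w) / (hb * M ^ (1 + 2 / k)) - w ^ (1 + 2 / k)| ≤ ε) :
    ∃ O ∈ 𝓝 xb, ∃ δ : ℝ, 0 < δ ∧ δ < 1 ∧ ∃ M0 : ℝ, ∀ (u : E → ℝ) (M : ℝ), ContDiffOn ℝ 2 u Ω →
      (∀ x ∈ Ω, 0 < u x) → (∀ x ∈ Ω, Lop A B u x + f x (u x) = 0) → (∀ x ∈ Ω, u x ≤ M) → M0 ≤ M →
      ∀ x ∈ O ∩ Ω, u x < (1 - δ) * M := by
  obtain ⟨R, ε, δ, hR, hε, hδ, hδ1, hloc⟩ := local_thm hk hκ hκk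
  obtain ⟨U, hU, M1, hfU⟩ := hf ε hε
  obtain ⟨O, hO, ρ, hρ, Bd, G, hG⟩ := hC ε hε U hU
  have hlim : Tendsto (fun M : ℝ => √(1 / (hb * M ^ (2 / k)))) atTop (𝓝 0) := by
    have h1 : Tendsto (fun M : ℝ => hb * M ^ (2 / k)) atTop atTop :=
      (tendsto_rpow_atTop (by positivity)).const_mul_atTop hhb
    have h2 := (tendsto_const_nhds (x := (1:ℝ))).div_atTop h1
    simpa using h2.sqrt
  have hev : ∀ᶠ M : ℝ in atTop, R * √(1 / (hb * M ^ (2 / k))) < ρ ∧ |Bd| * √(1 / (hb * M ^ (2 / k))) < ε ∧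
      M1 ≤ M ∧ 0 < M := by
    have h1 := hlim.const_mul R
    have h2 := hlim.const_mul |Bd|
    rw [mul_zero] at h1 h2
    filter_upwards [h1.eventually_lt_const hρ, h2.eventually_lt_const hε, eventually_ge_atTop M1,
      eventually_gt_atTop 0] with M a b c d using ⟨a, b, c, d⟩
  obtain ⟨M0, hM0⟩ := eventually_atTop.mp hev
  refine ⟨O, hO, δ, hδ, hδ1, M0, fun u M hu hpos hsol huM hM x0 hx0 => ?_⟩
  obtain ⟨m1, m2, m3, m4⟩ := hM0 M hM
  set ℓ := √(1 / (hb * M ^ (2 / k))) with hℓ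
  have hℓ0 : 0 < ℓ := Real.sqrt_pos.mpr (by positivity)
  have hℓ2 : ℓ ^ 2 = 1 / (hb * M ^ (2 / k)) := Real.sq_sqrt (by positivity)
  have hMa : M ^ (1 + 2 / k) = M * M ^ (2 / k) := by rw [Real.rpow_add m4, Real.rpow_one]
  obtain ⟨z0, hz0, hGz, hz⟩ := hG x0 hx0
  have key := hloc (fun z => u (G (z0.1 + ℓ * z.1, ℓ * z.2)) / M) (0, z0.2 / ℓ) (by positivity) ?_
  · simp only [mul_zero, add_zero, mul_div_cancel₀ _ hℓ0.ne'] at key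
    have hzz : G (z0.1, z0.2) = x0 := hGz
    rw [hzz, div_lt_iff₀ m4] at key
    exact key
  · intro z hz2 hzr
    have hsq : sq (z0.1 + ℓ * z.1, ℓ * z.2) z0 < ρ ^ 2 := by
      have e : sq (z0.1 + ℓ * z.1, ℓ * z.2) z0 = ℓ ^ 2 * sq z (0, z0.2 / ℓ) := by
        simp only [sq]; field_simp; ring
      rw [e]
      calc ℓ ^ 2 * sq z (0, z0.2 / ℓ) ≤ ℓ ^ 2 * R ^ 2 := by gcongr
        _ = (R * ℓ) ^ 2 := by ring
        _ < ρ ^ 2 := pow_lt_pow_left₀ m1 (by positivity) two_ne_zero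
    obtain ⟨⟨hGΩ, hGU⟩, hju⟩ := hz (z0.1 + ℓ * z.1, ℓ * z.2) (by positivity) hsq
    obtain ⟨hcont, j, o, hj, hL, o1, o2, o3, o4, κ, β, o5, o6, o7⟩ := hju u hu
    set x := G (z0.1 + ℓ * z.1, ℓ * z.2) with hx
    have hux := hpos x hGΩ
    have huM' := huM x hGΩ
    have hw1 : u x / M ≤ 1 := by rw [div_le_one m4]; exact huM'
    have hw0 : 0 < u x / M := by positivity
    refine ⟨?_, hw0, hw1, _, ⟨o.a11, o.a12, o.a22, ℓ * o.b1, ℓ * o.b2⟩, jet_scale (F := fun z => u (G z)) hj, ?_, ?_⟩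
    · have hmap : ContinuousAt (fun z : ℝ × ℝ => (z0.1 + ℓ * z.1, ℓ * z.2)) z := by fun_prop
      exact (ContinuousAt.comp (f := fun z : ℝ × ℝ => (z0.1 + ℓ * z.1, ℓ * z.2)) (g := fun z => u (G z)) hcont hmap).div_const M
    · have hb : |Bd| * ℓ ≤ ε := m2.le
      have hle : ∀ b : ℝ, |b| ≤ Bd → |ℓ * b| ≤ ε := fun b hb' => by
        rw [abs_mul, abs_of_pos hℓ0]
        calc ℓ * |b| ≤ ℓ * |Bd| := mul_le_mul_of_nonneg_left (hb'.trans (le_abs_self _)) hℓ0.le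
          _ ≤ ε := by linarith
      refine ⟨o1, o2, o3, hle _ o4, κ, ℓ * β, ?_, o6, hle _ o7⟩
      simp only [o5]
      field_simp
    · have e1 : (⟨o.a11, o.a12, o.a22, ℓ * o.b1, ℓ * o.b2⟩ : Op).L
          ⟨ℓ * j.p1 / M, ℓ * j.p2 / M, ℓ ^ 2 * j.h11 / M, ℓ ^ 2 * j.h12 / M, ℓ ^ 2 * j.h22 / M⟩
          = ℓ ^ 2 / M * o.L j := by
        simp only [Op.L]; ring
      have e2 : Lop A B u x = - f x (u x) := by linarith [hsol x hGΩ]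
      have e3 := hfU M m3 x ⟨hGΩ, hGU⟩ (u x / M) hw0 hw1
      rw [mul_div_cancel₀ _ m4.ne'] at e3
      rw [e1, hL, e2, hℓ2]
      show |1 / (hb * M ^ (2 / k)) / M * -f x (u x) + (u x / M) ^ (1 + 2 / k)| ≤ ε
      rw [show 1 / (hb * M ^ (2 / k)) / M * -f x (u x) + (u x / M) ^ (1 + 2 / k)
        = -(f x (u x) / (hb * M ^ (1 + 2 / k)) - (u x / M) ^ (1 + 2 / k)) by
          rw [hMa]; field_simp; ring, abs_neg]
      exact e3

end Deg

open Filter Topology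

namespace Deg

lemma f_est {Ω : Set E} {xb : E} {α : ℝ} {f : E → ℝ → ℝ} {h : E → ℝ} (hα : 1 < α)
    (hcpt : IsCompact (closure Ω)) (hxb : xb ∈ closure Ω)
    (hf : ContinuousOn (fun q : E × ℝ => f q.1 q.2) (closure Ω ×ˢ Set.Ici 0))
    (hh : ContinuousOn h (closure Ω)) (hhpos : 0 < h xb)
    (hlim : ∀ ε > 0, ∃ T : ℝ, 0 < T ∧ ∀ t ≥ T, ∀ x ∈ closure Ω, |f x t / t ^ α - h x| < ε) :
    ∀ ε > 0, ∃ U ∈ 𝓝 xb, ∃ M0 : ℝ, ∀ M ≥ M0, ∀ x ∈ Ω ∩ U, ∀ w : ℝ, 0 < w → w ≤ 1 →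
      |f x (M * w) / (h xb * M ^ α) - w ^ α| ≤ ε := by
  intro ε hε
  set hb := h xb
  obtain ⟨T, hT, hT2⟩ := hlim (ε * hb / 2) (by positivity)
  have hcpt2 : IsCompact (closure Ω ×ˢ Set.Icc 0 T) := hcpt.prod isCompact_Icc
  obtain ⟨K, hK⟩ := hcpt2.exists_bound_of_continuousOn
    (hf.mono (Set.prod_mono_right Set.Icc_subset_Ici_self))
  have hU : ∀ᶠ x in 𝓝[closure Ω] xb, |h x - hb| < ε * hb / 2 := by
    have := (hh xb hxb).eventually (Metric.ball_mem_nhds hb (show 0 < ε * hb / 2 by positivity))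
    simpa [Metric.mem_ball, Real.dist_eq] using this
  rw [eventually_nhdsWithin_iff] at hU
  have t1 : Tendsto (fun M : ℝ => |K| / (hb * M ^ α)) atTop (𝓝 0) :=
    tendsto_const_nhds.div_atTop ((tendsto_rpow_atTop (by linarith)).const_mul_atTop hhpos)
  have t2 : Tendsto (fun M : ℝ => T ^ α / M ^ α) atTop (𝓝 0) :=
    tendsto_const_nhds.div_atTop (tendsto_rpow_atTop (by linarith))
  have hev : ∀ᶠ M : ℝ in atTop, |K| / (hb * M ^ α) < ε / 2 ∧ T ^ α / M ^ α < ε / 2 ∧ 0 < M := by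
    filter_upwards [t1.eventually_lt_const (half_pos hε), t2.eventually_lt_const (half_pos hε),
      eventually_gt_atTop 0] with M a b c using ⟨a, b, c⟩
  obtain ⟨M0, hM0⟩ := eventually_atTop.mp hev
  refine ⟨_, hU, M0, fun M hM x hx w hw hw1 => ?_⟩
  obtain ⟨m1, m2, m3⟩ := hM0 M hM
  have hxc : x ∈ closure Ω := subset_closure hx.1
  have hMa : 0 < M ^ α := Real.rpow_pos_of_pos m3 _
  have hwa : 0 < w ^ α := Real.rpow_pos_of_pos hw _
  rcases le_total T (M * w) with hc | hc
  · have e1 := hT2 _ hc x hxc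
    have e2 : |h x - hb| < ε * hb / 2 := hx.2 hxc
    rw [Real.mul_rpow m3.le hw.le] at e1
    have hw1' : w ^ α ≤ 1 := Real.rpow_le_one hw.le hw1 (by linarith)
    have e3 : |f x (M * w) / (M ^ α * w ^ α) - hb| < ε * hb := by
      calc _ = |(f x (M * w) / (M ^ α * w ^ α) - h x) + (h x - hb)| := by congr 1; ring
        _ ≤ _ := abs_add_le _ _
        _ < _ := by linarith
    have e4 : f x (M * w) / (hb * M ^ α) - w ^ α = w ^ α / hb * (f x (M * w) / (M ^ α * w ^ α) - hb) := by
      field_simp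
    rw [e4, abs_mul, abs_of_pos (by positivity)]
    calc _ ≤ w ^ α / hb * (ε * hb) := by gcongr
      _ = w ^ α * ε := by field_simp
      _ ≤ 1 * ε := by gcongr
      _ = ε := one_mul _
  · have e1 : |f x (M * w)| ≤ |K| := (hK (x, M * w) ⟨hxc, by positivity, hc⟩).trans (le_abs_self _)
    have e2 : w ^ α ≤ T ^ α / M ^ α := by
      rw [le_div_iff₀ hMa, mul_comm, ← Real.mul_rpow m3.le hw.le]
      exact Real.rpow_le_rpow (by positivity) hc (by linarith)
    have e3 : |f x (M * w) / (hb * M ^ α)| ≤ |K| / (hb * M ^ α) := by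
      rw [abs_div, abs_of_pos (show 0 < hb * M ^ α by positivity)]; gcongr
    have := abs_sub (f x (M * w) / (hb * M ^ α)) (w ^ α)
    rw [abs_of_pos hwa] at this
    linarith

end Deg

open Filter Topology

namespace Deg

lemma chart_pt {Ω : Set E} {A : Fin 2 → Fin 2 → E → ℝ} {B : Fin 2 → E → ℝ} {G : ℝ × ℝ → E} {T1 T2 u : E → ℝ}
    {z : ℝ × ℝ} (hΩ : IsOpen Ω) (hA : ∀ x, A 0 1 x = A 1 0 x) (hGΩ : G z ∈ Ω) (hG : ContDiffAt ℝ 2 G z)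
    (t1 : T1 (G z) = z.1) (t2 : T2 (G z) = z.2) (h1 : ContDiffAt ℝ 2 T1 (G z)) (h2 : ContDiffAt ℝ 2 T2 (G z))
    (hinv : ∀ᶠ y in 𝓝 (G z), G (T1 y, T2 y) = y) (hu : ContDiffOn ℝ 2 u Ω) :
    ContinuousAt (fun z => u (G z)) z ∧ ∃ j, Jet (fun z => u (G z)) z j ∧
      (⟨Bil A T1 T1 (G z), Bil A T1 T2 (G z), Bil A T2 T2 (G z), Lop A B T1 (G z), Lop A B T2 (G z)⟩ : Op).L j
        = Lop A B u (G z) := by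
  have hF : ContDiffAt ℝ 2 (fun z => u (G z)) z := (hu.contDiffAt (hΩ.mem_nhds hGΩ)).comp z hG
  have hz : (T1 (G z), T2 (G z)) = z := by rw [t1, t2]
  refine ⟨hF.continuousAt, jt (fun z => u (G z)) z, jet_jt hF, ?_⟩
  have := push (A := A) (B := B) (u := u) (F := fun z => u (G z)) (hA (G z)) (by rw [hz]; exact hF) h1 h2 (by
    filter_upwards [hinv] with y hy
    rw [hy])
  rwa [hz] at this

lemma mk_chart {Ω : Set E} {A : Fin 2 → Fin 2 → E → ℝ} {B : Fin 2 → E → ℝ} {G : ℝ × ℝ → E} {T1 T2 κ β : E → ℝ}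
    {xb : E} {zb : ℝ × ℝ} {κ0 Bd : ℝ} (hΩ : IsOpen Ω) (hA : ∀ x, A 0 1 x = A 1 0 x)
    (hG0 : ∀ᶠ z in 𝓝[{z | 0 < z.2}] zb, G z ∈ Ω ∧ ContDiffAt ℝ 2 G z ∧ T1 (G z) = z.1 ∧ T2 (G z) = z.2 ∧
      ContDiffAt ℝ 2 T1 (G z) ∧ ContDiffAt ℝ 2 T2 (G z) ∧ ∀ᶠ y in 𝓝 (G z), G (T1 y, T2 y) = y)
    (hGt : Tendsto G (𝓝[{z | 0 < z.2}] zb) (𝓝 xb))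
    (hT : Tendsto (fun x => (T1 x, T2 x)) (𝓝[Ω] xb) (𝓝 zb))
    (hT2 : ∀ᶠ x in 𝓝[Ω] xb, 0 < T2 x ∧ G (T1 x, T2 x) = x)
    (h11 : Tendsto (Bil A T1 T1) (𝓝[Ω] xb) (𝓝 1)) (h12 : Tendsto (Bil A T1 T2) (𝓝[Ω] xb) (𝓝 0))
    (h22 : Tendsto (Bil A T2 T2) (𝓝[Ω] xb) (𝓝 1)) (hl1 : ∀ᶠ x in 𝓝[Ω] xb, |Lop A B T1 x| ≤ Bd)
    (hl2 : ∀ᶠ x in 𝓝[Ω] xb, Lop A B T2 x = κ x / T2 x + β x ∧ |β x| ≤ Bd)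
    (hκ : Tendsto κ (𝓝[Ω] xb) (𝓝 κ0)) : Chart Ω A B xb κ0 := by
  intro ε hε U hU
  have hGt' : Tendsto G (𝓝[{z | 0 < z.2}] zb) (𝓝[Ω] xb) :=
    tendsto_nhdsWithin_iff.mpr ⟨hGt, hG0.mono fun z hz => hz.1⟩
  have cl : ∀ {g : E → ℝ} {a : ℝ}, Tendsto g (𝓝[Ω] xb) (𝓝 a) → ∀ᶠ x in 𝓝[Ω] xb, |g x - a| ≤ ε := by
    intro g a hg
    filter_upwards [hg.eventually (Metric.closedBall_mem_nhds a hε)] with x hx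
    simpa [Metric.mem_closedBall, Real.dist_eq] using hx
  have hall : ∀ᶠ x in 𝓝[Ω] xb, x ∈ U ∧ OC ⟨Bil A T1 T1 x, Bil A T1 T2 x, Bil A T2 T2 x, Lop A B T1 x, Lop A B T2 x⟩ (T2 x) κ0 ε Bd := by
    filter_upwards [cl h11, cl h12, cl h22, cl hκ, hl1, hl2, mem_nhdsWithin_of_mem_nhds hU] with x a b c d e g i
    rw [sub_zero] at b
    exact ⟨i, a, b, c, e, κ x, β x, g.1, d, g.2⟩
  have hz := hG0.and (hGt'.eventually hall)
  rw [eventually_nhdsWithin_iff, Metric.eventually_nhds_iff] at hz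
  obtain ⟨R, hR, hz⟩ := hz
  have hO : ∀ᶠ x in 𝓝[Ω] xb, 0 < T2 x ∧ G (T1 x, T2 x) = x ∧ dist (T1 x, T2 x) zb < R / 2 := by
    filter_upwards [hT2, hT.eventually (Metric.ball_mem_nhds zb (half_pos hR))] with x a b
    exact ⟨a.1, a.2, b⟩
  rw [eventually_nhdsWithin_iff] at hO
  refine ⟨_, hO, R / 2, half_pos hR, Bd, G, fun x0 hx0 => ?_⟩
  obtain ⟨o1, o2, o3⟩ := hx0.1 hx0.2
  refine ⟨(T1 x0, T2 x0), o1, o2, fun z hz2 hsq => ?_⟩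
  have hd : dist z (T1 x0, T2 x0) < R / 2 := by
    rw [Prod.dist_eq, max_lt_iff, Real.dist_eq, Real.dist_eq]
    simp only [sq] at hsq
    constructor
    · exact abs_lt_of_sq_lt_sq (by linarith [sq_nonneg (z.2 - T2 x0)]) (by positivity)
    · exact abs_lt_of_sq_lt_sq (by linarith [sq_nonneg (z.1 - T1 x0)]) (by positivity)
  have hd2 : dist z zb < R := by linarith [dist_triangle z (T1 x0, T2 x0) zb]
  obtain ⟨⟨g1, g2, g3, g4, g5, g6, g7⟩, g8, g9⟩ := hz hd2 hz2
  refine ⟨⟨g1, g8⟩, fun u hu => ?_⟩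
  obtain ⟨q1, j, q2, q3⟩ := chart_pt (B := B) hΩ hA g1 g2 g3 g4 g5 g6 g7 hu
  rw [g4] at g9
  exact ⟨q1, j, _, q2, q3, g9⟩

end Deg

open Filter Topology

namespace Deg

/-- affine functions -/
def aff (y : E) (c l0 l1 : ℝ) (x : E) : ℝ := c + l0 * (x 0 - y 0) + l1 * (x 1 - y 1)

lemma aff_smooth (y : E) (c l0 l1 : ℝ) {n : WithTop ℕ∞} : ContDiff ℝ n (aff y c l0 l1) := by
  unfold aff; fun_prop

lemma pd_aff (y : E) (c l0 l1 : ℝ) (k : Fin 2) (x : E) : pd k (aff y c l0 l1) x = if k = 0 then l0 else l1 := by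
  apply hasDerivAt_pd'
  fin_cases k
  · have := ((((hasDerivAt_id (x 0)).sub_const (y 0)).const_mul l0).const_add c).add_const (l1 * (x 1 - y 1))
    simpa [aff] using this
  · have := (((hasDerivAt_id (x 1)).sub_const (y 1)).const_mul l1).const_add (c + l0 * (x 0 - y 0))
    simpa [aff] using this

lemma pd2_aff (y : E) (c l0 l1 : ℝ) (i j : Fin 2) (x : E) : pd2 i j (aff y c l0 l1) x = 0 := by
  have : (fun z => pd j (aff y c l0 l1) z) = fun _ => if j = 0 then l0 else l1 := by
    funext z; exact pd_aff y c l0 l1 j z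
  unfold pd2
  rw [this]; unfold pd; simp

lemma Lop_aff (A : Fin 2 → Fin 2 → E → ℝ) (B : Fin 2 → E → ℝ) (y : E) (c l0 l1 : ℝ) (x : E) :
    Lop A B (aff y c l0 l1) x = B 0 x * l0 + B 1 x * l1 := by
  simp [Lop, pd2_aff, pd_aff]

lemma ev_bdd {X : Type*} {l : Filter X} {g : X → ℝ} {a Bd : ℝ} (h : Tendsto g l (𝓝 a)) (hB : |a| + 1 ≤ Bd) :
    ∀ᶠ x in l, |g x| ≤ Bd := by
  filter_upwards [h.abs.eventually_lt_const (show |a| < Bd by linarith)] with x hx using hx.le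

theorem interior_chart {Ω : Set E} {A : Fin 2 → Fin 2 → E → ℝ} {B : Fin 2 → E → ℝ} {xb : E} {κ0 : ℝ}
    (hΩ : IsOpen Ω) (hA : ∀ x, A 0 1 x = A 1 0 x) (hx : xb ∈ Ω) (hAc : ∀ i j, ContinuousAt (A i j) xb)
    (hBc : ∀ i, ContinuousAt (B i) xb) (ha : 0 < A 0 0 xb) (hd : 0 < A 0 0 xb * A 1 1 xb - A 0 1 xb ^ 2) :
    Chart Ω A B xb κ0 := by
  set a := A 0 0 xb with ha'
  set b := A 0 1 xb with hb'
  set d := A 1 1 xb with hd'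
  set s := √(a / (a * d - b ^ 2)) with hs
  have hs0 : 0 < s := Real.sqrt_pos.mpr (by positivity)
  have hs2 : s ^ 2 = a / (a * d - b ^ 2) := Real.sq_sqrt (by positivity)
  set q := √a with hq
  have hq0 : 0 < q := Real.sqrt_pos.mpr ha
  have hq2 : q ^ 2 = a := Real.sq_sqrt ha.le
  set T1 := aff xb 0 (1 / q) 0 with hT1
  set T2 := aff xb 1 (-(s * b / a)) s with hT2
  set G : ℝ × ℝ → E := fun z => ![xb 0 + q * z.1, xb 1 + (z.2 - 1) / s + b / a * q * z.1] with hG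
  have e1 : ∀ z, T1 (G z) = z.1 := fun z => by
    simp only [hT1, aff, hG, Matrix.cons_val_zero, Matrix.cons_val_one]; field_simp; ring
  have e2 : ∀ z, T2 (G z) = z.2 := fun z => by
    simp only [hT2, aff, hG, Matrix.cons_val_zero, Matrix.cons_val_one]; field_simp; ring
  have e3 : ∀ x, G (T1 x, T2 x) = x := fun x => by
    ext i
    fin_cases i
    · simp only [hT1, aff, hG]
      show xb 0 + q * _ = x 0
      field_simp; ring
    · simp only [hT1, hT2, aff, hG]
      show xb 1 + _ + _ = x 1
      field_simp; ring
  have hGs : ContDiff ℝ 2 G := by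
    rw [contDiff_pi]
    intro i
    fin_cases i
    · show ContDiff ℝ 2 (fun z : ℝ × ℝ => xb 0 + q * z.1); fun_prop
    · show ContDiff ℝ 2 (fun z : ℝ × ℝ => xb 1 + (z.2 - 1) / s + b / a * q * z.1); fun_prop
  have t1 : T1 xb = 0 := by simp [hT1, aff]
  have t2 : T2 xb = 1 := by simp [hT2, aff]
  have g0 : G (0, 1) = xb := by rw [← e3 xb, t1, t2]
  have s1 : ContDiff ℝ 2 T1 := aff_smooth ..
  have s2 : ContDiff ℝ 2 T2 := aff_smooth ..
  have hGt : Tendsto G (𝓝 (0, 1)) (𝓝 xb) := by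
    have := hGs.continuous.tendsto (0, 1); rwa [g0] at this
  have hT2c : Tendsto T2 (𝓝 xb) (𝓝 1) := by
    have := s2.continuous.tendsto xb; rwa [t2] at this
  have hT1c : Tendsto T1 (𝓝 xb) (𝓝 0) := by
    have := s1.continuous.tendsto xb; rwa [t1] at this
  have A00 : Tendsto (A 0 0) (𝓝 xb) (𝓝 a) := hAc 0 0
  have A01 : Tendsto (A 0 1) (𝓝 xb) (𝓝 b) := hAc 0 1
  have A10 : Tendsto (A 1 0) (𝓝 xb) (𝓝 b) := by rw [hb', hA]; exact hAc 1 0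
  have A11 : Tendsto (A 1 1) (𝓝 xb) (𝓝 d) := hAc 1 1
  have bil : ∀ c l0 l1 c' m0 m1 : ℝ, Tendsto (Bil A (aff xb c l0 l1) (aff xb c' m0 m1)) (𝓝 xb)
      (𝓝 (a * l0 * m0 + b * l0 * m1 + (b * l1 * m0 + d * l1 * m1))) := by
    intro c l0 l1 c' m0 m1
    have : Bil A (aff xb c l0 l1) (aff xb c' m0 m1) = fun x => A 0 0 x * l0 * m0 + A 0 1 x * l0 * m1 +
        (A 1 0 x * l1 * m0 + A 1 1 x * l1 * m1) := by
      funext x; simp [Bil, pd_aff]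
    rw [this]
    exact (((A00.mul_const l0).mul_const m0).add ((A01.mul_const l0).mul_const m1)).add
      (((A10.mul_const l1).mul_const m0).add ((A11.mul_const l1).mul_const m1))
  have lop : ∀ c l0 l1 : ℝ, Tendsto (Lop A B (aff xb c l0 l1)) (𝓝 xb) (𝓝 (B 0 xb * l0 + B 1 xb * l1)) := by
    intro c l0 l1
    have : Lop A B (aff xb c l0 l1) = fun x => B 0 x * l0 + B 1 x * l1 := by
      funext x; exact Lop_aff ..
    rw [this]
    exact ((hBc 0).tendsto.mul_const l0).add ((hBc 1).tendsto.mul_const l1)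
  have l2 := (lop 1 (-(s * b / a)) s).sub ((tendsto_const_nhds (x := κ0)).div hT2c one_ne_zero)
  have l1 := lop 0 (1 / q) 0
  refine mk_chart (G := G) (T1 := T1) (T2 := T2) (κ := fun _ => κ0) (β := fun x => Lop A B T2 x - κ0 / T2 x)
    (zb := (0, 1)) (Bd := max (|B 0 xb * (1 / q) + B 1 xb * 0| + 1)
      (|B 0 xb * -(s * b / a) + B 1 xb * s - κ0 / 1| + 1)) hΩ hA ?_ (hGt.mono_left nhdsWithin_le_nhds)
    ((hT1c.prodMk_nhds hT2c).mono_left nhdsWithin_le_nhds) ?_ ?_ ?_ ?_ ?_ ?_ tendsto_const_nhds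
  · refine Filter.Eventually.filter_mono nhdsWithin_le_nhds ?_
    filter_upwards [hGt.eventually (hΩ.mem_nhds hx)] with z hz
    exact ⟨hz, hGs.contDiffAt, e1 z, e2 z, s1.contDiffAt, s2.contDiffAt, Eventually.of_forall e3⟩
  · refine Filter.Eventually.filter_mono nhdsWithin_le_nhds ?_
    filter_upwards [hT2c.eventually_const_lt one_pos] with x hx using ⟨hx, e3 x⟩
  · refine Tendsto.mono_left ?_ nhdsWithin_le_nhds
    convert bil 0 (1 / q) 0 0 (1 / q) 0 using 2
    field_simp; linarith
  · refine Tendsto.mono_left ?_ nhdsWithin_le_nhds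
    convert bil 0 (1 / q) 0 1 (-(s * b / a)) s using 2
    field_simp; ring
  · refine Tendsto.mono_left ?_ nhdsWithin_le_nhds
    convert bil 1 (-(s * b / a)) s 1 (-(s * b / a)) s using 2
    have : s ^ 2 * (a * d - b ^ 2) = a := by rw [hs2]; field_simp
    field_simp
    linear_combination -this
  · exact Filter.Eventually.filter_mono nhdsWithin_le_nhds (ev_bdd l1 (le_max_left _ _))
  · refine Filter.Eventually.filter_mono nhdsWithin_le_nhds ?_
    filter_upwards [ev_bdd l2 (le_max_right _ _)] with x hx
    exact ⟨by ring, hx⟩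

end Deg

open Filter Topology

namespace Deg

/-- boundary flattening -/
structure Flat (Ω : Set E) (φ : E → ℝ) (xb : E) (t0 t1 : ℝ) (S : ℝ × ℝ → E) : Prop where
  left : ∀ᶠ y in 𝓝 xb, S (aff xb 0 t0 t1 y, φ y) = y
  right : ∀ᶠ w in 𝓝 ((0, 0) : ℝ × ℝ), aff xb 0 t0 t1 (S w) = w.1 ∧ φ (S w) = w.2
  smooth : ContDiffAt ℝ 2 S (0, 0)
  base : S (0, 0) = xb
  inside : ∀ᶠ w in 𝓝 ((0, 0) : ℝ × ℝ), 0 < w.2 → S w ∈ Ω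
  bdry : ∀ᶠ w in 𝓝 ((0, 0) : ℝ × ℝ), w.2 = 0 → S w ∈ frontier Ω

lemma exists_flat {Ω N : Set E} {φ : E → ℝ} {xb : E} {t0 t1 : ℝ} (hΩ : IsOpen Ω) (hN : IsOpen N)
    (hfr : frontier Ω ⊆ N) (hφ : ContDiffOn ℝ 2 φ N) (hφ0 : ∀ x ∈ frontier Ω, φ x = 0)
    (hpos : ∀ x ∈ Ω ∩ N, 0 < φ x) (hxb : xb ∈ frontier Ω)
    (hdet : t0 * pd 1 φ xb - t1 * pd 0 φ xb ≠ 0) : ∃ S, Flat Ω φ xb t0 t1 S := by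
  have hxN := hfr hxb
  have hφc : ContDiffAt ℝ 2 φ xb := hφ.contDiffAt (hN.mem_nhds hxN)
  set T := aff xb 0 t0 t1 with hT
  have hTs : ContDiff ℝ 2 T := aff_smooth ..
  have hΨ : ContDiffAt ℝ 2 (fun y => (T y, φ y)) xb := hTs.contDiffAt.prodMk hφc
  have hTd : DifferentiableAt ℝ T xb := hTs.contDiffAt.differentiableAt (by simp)
  have hφd : DifferentiableAt ℝ φ xb := hφc.differentiableAt (by simp)
  have hΨd := hTd.hasFDerivAt.prodMk hφd.hasFDerivAt
  set L := (fderiv ℝ T xb).prod (fderiv ℝ φ xb) with hL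
  have hLinj : Function.Injective (L : E →ₗ[ℝ] ℝ × ℝ) := by
    rw [← LinearMap.ker_eq_bot, LinearMap.ker_eq_bot']
    intro v hv
    have hv' : L v = 0 := hv
    rw [hL, ContinuousLinearMap.prod_apply, fderiv_eq_pd hTd, fderiv_eq_pd hφd, hT, pd_aff, pd_aff] at hv'
    obtain ⟨v1, v2⟩ := Prod.mk_inj.mp hv'
    simp only [if_true, one_ne_zero, if_false] at v1
    have w0 : (t0 * pd 1 φ xb - t1 * pd 0 φ xb) * v 0 = 0 := by
      linear_combination pd 1 φ xb * v1 - t1 * v2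
    have w1 : (t0 * pd 1 φ xb - t1 * pd 0 φ xb) * v 1 = 0 := by
      linear_combination -pd 0 φ xb * v1 + t0 * v2
    ext i
    fin_cases i
    · exact (mul_eq_zero.mp w0).resolve_left hdet
    · exact (mul_eq_zero.mp w1).resolve_left hdet
  let Le : E ≃L[ℝ] ℝ × ℝ := (LinearMap.linearEquivOfInjective (L : E →ₗ[ℝ] ℝ × ℝ) hLinj (by simp)).toContinuousLinearEquiv
  have hLe : (Le : E →L[ℝ] ℝ × ℝ) = L := by
    ext v <;> rfl
  rw [← hLe] at hΨd
  have hst := hΨ.hasStrictFDerivAt' hΨd (by simp)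
  set S := hΨ.localInverse hΨd (by simp) with hS
  have hx0 : (T xb, φ xb) = (0, 0) := by rw [hφ0 xb hxb]; simp [hT, aff]
  have left : ∀ᶠ y in 𝓝 xb, S (T y, φ y) = y := hst.eventually_left_inverse
  have right : ∀ᶠ w in 𝓝 ((0, 0) : ℝ × ℝ), T (S w) = w.1 ∧ φ (S w) = w.2 := by
    have := hst.eventually_right_inverse
    rw [hx0] at this
    filter_upwards [this] with w hw
    exact Prod.mk_inj.mp (show (T (S w), φ (S w)) = (w.1, w.2) from hw)
  have smooth : ContDiffAt ℝ 2 S (0, 0) := by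
    have := hΨ.to_localInverse hΨd (by simp); rwa [hx0] at this
  have base : S (0, 0) = xb := by rw [← hx0]; exact left.self_of_nhds
  have hSt : Tendsto S (𝓝 (0, 0)) (𝓝 xb) := by have := smooth.continuousAt.tendsto; rwa [base] at this
  have hev : ∀ᶠ w in 𝓝 ((0, 0) : ℝ × ℝ), ContinuousAt S w ∧ S w ∈ N ∧ φ (S w) = w.2 := by
    filter_upwards [smooth.eventually (by simp), hSt.eventually (hN.mem_nhds hxN), right] with w a b c
    exact ⟨a.continuousAt, b, c.2⟩
  rw [Metric.eventually_nhds_iff_ball] at hev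
  obtain ⟨R, hR, hw⟩ := hev
  have hQ : IsPreconnected (S '' (Metric.ball (0, 0) R ∩ {w | 0 < w.2})) := by
    apply IsPreconnected.image
    · apply Convex.isPreconnected
      exact (convex_ball _ _).inter (convex_halfSpace_gt (IsLinearMap.mk (fun _ _ => rfl) (fun _ _ => rfl)) 0)
    · intro w hw'
      exact (hw w hw'.1).1.continuousWithinAt
  have hΨt : Tendsto (fun y => (T y, φ y)) (𝓝 xb) (𝓝 (0, 0)) := by
    have := hΨ.continuousAt.tendsto; rwa [hx0] at this
  have hin : S '' (Metric.ball (0, 0) R ∩ {w | 0 < w.2}) ⊆ Ω := by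
    apply hQ.subset_left_of_subset_union hΩ isClosed_closure.isOpen_compl
    · exact Set.disjoint_compl_right_iff_subset.mpr subset_closure
    · rintro _ ⟨w, ⟨w1, w2⟩, rfl⟩
      by_contra hcon
      rw [Set.mem_union, not_or, Set.mem_compl_iff, not_not] at hcon
      have : S w ∈ frontier Ω := by rw [hΩ.frontier_eq]; exact ⟨hcon.2, hcon.1⟩
      have h0 := hφ0 _ this
      rw [(hw w w1).2.2] at h0
      exact (ne_of_gt w2) h0
    · have hcl : xb ∈ closure Ω := frontier_subset_closure hxb
      have : ∃ᶠ y in 𝓝 xb, y ∈ Ω := mem_closure_iff_frequently.mp hcl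
      have h2 : ∀ᶠ y in 𝓝 xb, S (T y, φ y) = y ∧ (T y, φ y) ∈ Metric.ball ((0, 0) : ℝ × ℝ) R ∧ y ∈ N := by
        filter_upwards [left, hΨt.eventually (Metric.ball_mem_nhds _ hR), hN.mem_nhds hxN] with y a b c
          using ⟨a, b, c⟩
      obtain ⟨y, y1, y2, y3, y4⟩ := (this.and_eventually h2).exists
      exact ⟨y, ⟨_, ⟨y3, hpos y ⟨y1, y4⟩⟩, y2⟩, y1⟩
  have inside : ∀ w ∈ Metric.ball ((0, 0) : ℝ × ℝ) R, 0 < w.2 → S w ∈ Ω :=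
    fun w a b => hin ⟨w, ⟨a, b⟩, rfl⟩
  refine ⟨S, left, right, smooth, base, ?_, ?_⟩
  · filter_upwards [Metric.ball_mem_nhds _ hR] with w hw' using inside w hw'
  · filter_upwards [Metric.ball_mem_nhds _ hR] with w hw' hw0
    obtain ⟨c1, c2, c3⟩ := hw w hw'
    have hcl : S w ∈ closure Ω := by
      have ht : Tendsto (fun t : ℝ => ((w.1, t) : ℝ × ℝ)) (𝓝[>] 0) (𝓝 w) := by
        have : Continuous (fun t : ℝ => ((w.1, t) : ℝ × ℝ)) := by fun_prop
        have := this.tendsto 0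
        rw [← hw0] at this
        rw [← hw0]
        exact this.mono_left nhdsWithin_le_nhds
      refine mem_closure_of_tendsto (c1.tendsto.comp ht) ?_
      filter_upwards [ht.eventually (Metric.isOpen_ball.mem_nhds hw'), self_mem_nhdsWithin] with t a b
      exact inside _ a b
    rw [hΩ.frontier_eq]
    refine ⟨hcl, fun hΩm => ?_⟩
    have := hpos _ ⟨hΩm, c2⟩
    rw [c3, hw0] at this
    exact lt_irrefl _ this

lemma ratio {Ω N : Set E} {φ : E → ℝ} {xb : E} {t0 t1 : ℝ} {S : ℝ × ℝ → E} (hS : Flat Ω φ xb t0 t1 S)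
    (hN : N ∈ 𝓝 xb) (hφ : ContDiffAt ℝ 2 φ xb) (hpos : ∀ x ∈ Ω ∩ N, 0 < φ x)
    (hφ0 : φ xb = 0) {H : E → ℝ} (hH : ContDiffAt ℝ 1 H xb) (hH0 : ∀ x ∈ frontier Ω, H x = 0) :
    ∃ μ, Tendsto (fun x => H x / φ x) (𝓝[Ω] xb) (𝓝 μ) ∧ ∀ k, pd k H xb = μ * pd k φ xb := by
  have hTs : ContDiff ℝ 2 (aff xb 0 t0 t1) := aff_smooth ..
  have hHd : DifferentiableAt ℝ H xb := hH.differentiableAt (by simp)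
  have hφd : DifferentiableAt ℝ φ xb := hφ.differentiableAt (by simp)
  have hTd : DifferentiableAt ℝ (aff xb 0 t0 t1) xb := hTs.contDiffAt.differentiableAt (by simp)
  have hSd : HasFDerivAt S (fderiv ℝ S (0, 0)) (0, 0) := (hS.smooth.differentiableAt (by simp)).hasFDerivAt
  have comp : ∀ F : E → ℝ, DifferentiableAt ℝ F xb →
      HasFDerivAt (fun w => F (S w)) ((fderiv ℝ F xb).comp (fderiv ℝ S (0, 0))) (0, 0) := fun F hF => by
    have : HasFDerivAt F (fderiv ℝ F xb) (S (0, 0)) := by rw [hS.base]; exact hF.hasFDerivAt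
    exact this.comp _ hSd
  have hφS := (comp φ hφd).unique (hasFDerivAt_snd.congr_of_eventuallyEq (hS.right.mono fun w hw => hw.2))
  have hTS := (comp _ hTd).unique (hasFDerivAt_fst.congr_of_eventuallyEq (hS.right.mono fun w hw => hw.1))
  have hK : ContDiffAt ℝ 1 (fun w => H (S w)) (0, 0) :=
    ContDiffAt.comp (f := S) (g := H) _ (by rw [hS.base]; exact hH) (hS.smooth.of_le (by norm_num))
  have hKs := hK.hasStrictFDerivAt' (comp H hHd) (by simp)
  have ev : ∀ (F : E → ℝ), DifferentiableAt ℝ F xb → ∀ v, ((fderiv ℝ F xb).comp (fderiv ℝ S (0, 0))) v =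
      fderiv ℝ S (0, 0) v 0 * pd 0 F xb + fderiv ℝ S (0, 0) v 1 * pd 1 F xb := fun F hF v => by
    rw [ContinuousLinearMap.comp_apply, fderiv_eq_pd hF]
  have a1 : fderiv ℝ S (0, 0) (1, 0) 0 * pd 0 φ xb + fderiv ℝ S (0, 0) (1, 0) 1 * pd 1 φ xb = 0 := by
    rw [← ev φ hφd, hφS]; rfl
  have a2 : fderiv ℝ S (0, 0) (0, 1) 0 * pd 0 φ xb + fderiv ℝ S (0, 0) (0, 1) 1 * pd 1 φ xb = 1 := by
    rw [← ev φ hφd, hφS]; rfl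
  have hz0 : ∀ᶠ w in 𝓝 ((0, 0) : ℝ × ℝ), H (S (w.1, 0)) = 0 := by
    have : Tendsto (fun w : ℝ × ℝ => (w.1, (0:ℝ))) (𝓝 (0, 0)) (𝓝 (0, 0)) :=
      Continuous.tendsto (by fun_prop : Continuous (fun w : ℝ × ℝ => (w.1, (0:ℝ)))) (0, 0)
    filter_upwards [this.eventually hS.bdry] with w hw using hH0 _ (hw rfl)
  have a3 : fderiv ℝ S (0, 0) (1, 0) 0 * pd 0 H xb + fderiv ℝ S (0, 0) (1, 0) 1 * pd 1 H xb = 0 := by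
    rw [← ev H hHd]
    have hl : HasDerivAt (fun t : ℝ => ((t, 0) : ℝ × ℝ)) (1, 0) 0 :=
      (hasDerivAt_id (0:ℝ)).prodMk (hasDerivAt_const (0:ℝ) (0:ℝ))
    have h1 := HasFDerivAt.comp_hasDerivAt (f := fun t : ℝ => ((t, 0) : ℝ × ℝ)) (0:ℝ) (comp H hHd) hl
    refine h1.unique ((hasDerivAt_const (0:ℝ) (0:ℝ)).congr_of_eventuallyEq ?_)
    filter_upwards [hl.continuousAt.tendsto.eventually hz0] with t ht using ht
  have hsn : fderiv ℝ S (0, 0) (1, 0) 0 ≠ 0 ∨ fderiv ℝ S (0, 0) (1, 0) 1 ≠ 0 := by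
    by_contra! hcon
    have := ev _ hTd (1, 0)
    rw [hTS, hcon.1, hcon.2] at this
    simp at this
  set s0 := fderiv ℝ S (0, 0) (1, 0) 0
  set s1 := fderiv ℝ S (0, 0) (1, 0) 1
  set y0 := fderiv ℝ S (0, 0) (0, 1) 0
  set y1 := fderiv ℝ S (0, 0) (0, 1) 1
  refine ⟨y0 * pd 0 H xb + y1 * pd 1 H xb, ?_, ?_⟩
  · have hlim : Tendsto (fun w : ℝ × ℝ => H (S w) / w.2) (𝓝[{w | 0 < w.2}] (0, 0))
        (𝓝 (y0 * pd 0 H xb + y1 * pd 1 H xb)) := by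
      have hlo := hKs.isLittleO
      have hmap : Tendsto (fun w : ℝ × ℝ => (w, ((w.1, 0) : ℝ × ℝ))) (𝓝[{w | 0 < w.2}] (0, 0))
          (𝓝 (((0, 0), (0, 0)) : (ℝ × ℝ) × (ℝ × ℝ))) :=
        (Continuous.tendsto (by fun_prop : Continuous (fun w : ℝ × ℝ => (w, ((w.1, 0) : ℝ × ℝ)))) (0, 0)).mono_left
          nhdsWithin_le_nhds
      have h1 := hlo.comp_tendsto hmap
      rw [Asymptotics.isLittleO_iff] at h1
      rw [Metric.tendsto_nhds]
      intro ε hε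
      filter_upwards [h1 (half_pos hε), nhdsWithin_le_nhds hz0, self_mem_nhdsWithin] with w b1 b2 b3
      have b3' : 0 < w.2 := b3
      have e : w - (w.1, 0) = (0, w.2) := by ext <;> simp
      have e2 : ((fderiv ℝ H xb).comp (fderiv ℝ S (0, 0))) (0, w.2) = w.2 * (y0 * pd 0 H xb + y1 * pd 1 H xb) := by
        rw [pair_eq, ev H hHd (0, 1)]; ring
      simp only [Function.comp_apply] at b1
      rw [e, e2, b2, sub_zero] at b1
      have e3 : ‖((0, w.2) : ℝ × ℝ)‖ = w.2 := by
        simp [Prod.norm_def, abs_of_pos b3', b3'.le]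
      rw [e3, Real.norm_eq_abs] at b1
      rw [Real.dist_eq, show H (S w) / w.2 - (y0 * pd 0 H xb + y1 * pd 1 H xb)
        = (H (S w) - w.2 * (y0 * pd 0 H xb + y1 * pd 1 H xb)) / w.2 by field_simp, abs_div, abs_of_pos b3',
        div_lt_iff₀ b3']
      exact b1.trans_lt (by apply mul_lt_mul_of_pos_right (by linarith) b3')
    have hΨt : Tendsto (fun y => (aff xb 0 t0 t1 y, φ y)) (𝓝[Ω] xb) (𝓝[{w | 0 < w.2}] (0, 0)) := by
      rw [tendsto_nhdsWithin_iff]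
      constructor
      · have := (hTd.continuousAt.prodMk hφd.continuousAt).tendsto
        rw [hφ0, show aff xb 0 t0 t1 xb = 0 by simp [aff]] at this
        exact this.mono_left nhdsWithin_le_nhds
      · filter_upwards [self_mem_nhdsWithin, nhdsWithin_le_nhds hN] with y a b using hpos y ⟨a, b⟩
    refine (hlim.comp hΨt).congr' ?_
    filter_upwards [nhdsWithin_le_nhds hS.left] with y hy
    simp only [Function.comp_apply]
    rw [hy]
  · have key : ∀ p q h0 h1 : ℝ, s0 * p + s1 * q = 0 → y0 * p + y1 * q = 1 → s0 * h0 + s1 * h1 = 0 →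
        h0 = (y0 * h0 + y1 * h1) * p ∧ h1 = (y0 * h0 + y1 * h1) * q := by
      intro p q h0 h1 e1 e2 e3
      have c : h0 * q = h1 * p := by
        rcases hsn with hs | hs
        · apply mul_left_cancel₀ hs; linear_combination q * e3 - h1 * e1
        · apply mul_left_cancel₀ hs; linear_combination h0 * e1 - p * e3
      constructor
      · linear_combination -h0 * e2 + y1 * c
      · linear_combination -h1 * e2 - y0 * c
    have := key _ _ _ _ a1 a2 a3
    intro k
    fin_cases k
    · exact this.1
    · exact this.2

end Deg

open Filter Topology

namespace Deg

lemma C1.pd {F : E → ℝ} {x : E} (h : ContDiffAt ℝ 1 F x) (k : Fin 2) : ContinuousAt (pd k F) x := by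
  have h1 : ContinuousAt (fun y => fderiv ℝ F y (Pi.single k 1)) x :=
    ((h.fderiv_right (m := 0) (by norm_num)).clm_apply contDiffAt_const).continuousAt
  refine h1.congr ?_
  filter_upwards [h.eventually (by simp)] with y hy using (pd_eq (hy.differentiableAt (by simp)) k).symm

lemma pd_ma {F G H K : E → ℝ} {x : E} (hF : DifferentiableAt ℝ F x) (hG : DifferentiableAt ℝ G x)
    (hH : DifferentiableAt ℝ H x) (hK : DifferentiableAt ℝ K x) (k : Fin 2) :
    pd k (fun y => F y * G y + H y * K y) x = pd k F x * G x + F x * pd k G x + (pd k H x * K x + H x * pd k K x) := by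
  have := (((hasDerivAt_pd hF k).mul (hasDerivAt_pd hG k))).add ((hasDerivAt_pd hH k).mul (hasDerivAt_pd hK k))
  rw [Function.update_eq_self] at this
  exact hasDerivAt_pd' this

lemma pd_sqrt {φ : E → ℝ} {x : E} (h : DifferentiableAt ℝ φ x) (hp : 0 < φ x) (c : ℝ) (k : Fin 2) :
    pd k (fun y => c * √(φ y)) x = c * (pd k φ x / (2 * √(φ x))) := by
  have h1 := hasDerivAt_pd h k
  have h2 := (h1.sqrt (by rw [Function.update_eq_self]; exact hp.ne')).const_mul c
  rw [Function.update_eq_self] at h2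
  exact hasDerivAt_pd' h2

lemma pd2_sqrt {φ : E → ℝ} {x : E} (h : ContDiffAt ℝ 2 φ x) (hp : 0 < φ x) (c : ℝ) (i j : Fin 2) :
    pd2 i j (fun y => c * √(φ y)) x =
      c * (pd2 i j φ x / (2 * √(φ x)) - pd i φ x * pd j φ x / (4 * φ x * √(φ x))) := by
  have e : (fun y => pd j (fun y => c * √(φ y)) y) =ᶠ[𝓝 x] fun y => c * (pd j φ y / (2 * √(φ y))) := by
    filter_upwards [C2.diff h, h.continuousAt.tendsto.eventually_const_lt hp] with y a b using pd_sqrt a b c j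
  unfold pd2
  rw [pd_congr e]
  have h1 := hasDerivAt_pd (h.differentiableAt (by simp)) i
  have h2 := (h1.sqrt (by rw [Function.update_eq_self]; exact hp.ne')).const_mul 2
  have h3 := hasDerivAt_pd ((C2.pd h j).differentiableAt (by simp)) i
  have hs : 0 < √(φ x) := Real.sqrt_pos.mpr hp
  have h4 := (h3.div h2 (by rw [Function.update_eq_self]; positivity)).const_mul c
  rw [Function.update_eq_self] at h4
  rw [hasDerivAt_pd' h4]
  have hss : √(φ x) ^ 2 = φ x := Real.sq_sqrt hp.le
  congr 1
  set s := √(φ x)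
  rw [← hss]
  show (pd i (fun z => pd j φ z) x * (2 * s) - pd j φ x * (2 * (pd i φ x / (2 * s)))) / (2 * s) ^ 2 = _
  field_simp
  ring

end Deg

open Filter Topology

namespace Deg

theorem boundary_chart {Ω N V : Set E} {φ : E → ℝ} {A : Fin 2 → Fin 2 → E → ℝ} {B : Fin 2 → E → ℝ} {xb : E}
    (hΩ : IsOpen Ω) (hN : IsOpen N) (hfr : frontier Ω ⊆ N) (hV : IsOpen V) (hVΩ : closure Ω ⊆ V)
    (hφ : ContDiffOn ℝ 2 φ N) (hφ0 : ∀ x ∈ frontier Ω, φ x = 0) (hpos : ∀ x ∈ Ω ∩ N, 0 < φ x)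
    (hxb : xb ∈ frontier Ω) (hgrad : ∃ k, pd k φ xb ≠ 0)
    (hAreg : ∀ i j, ContDiffOn ℝ 2 (A i j) V) (hBreg : ∀ i, ContDiffOn ℝ 1 (B i) V)
    (hA : ∀ x, A 0 1 x = A 1 0 x)
    (hApos : ∀ x ∈ Ω, ∀ v : Fin 2 → ℝ, v ≠ 0 → 0 < ∑ i, ∑ j, A i j x * v i * v j)
    (hchar : ∀ x ∈ frontier Ω, ∑ i, ∑ j, A i j x * pd i φ x * pd j φ x = 0)
    (hcharnd : ∃ k, pd k (fun z => ∑ i, ∑ j, A i j z * pd i φ z * pd j φ z) xb ≠ 0)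
    (hdet : ∀ x ∈ frontier Ω, A 0 0 x * A 1 1 x - A 0 1 x * A 1 0 x = 0)
    (htr : 0 < A 0 0 xb + A 1 1 xb) : Chart Ω A B xb (2 * ficheraG A B φ xb + 1) := by
  have hxN : N ∈ 𝓝 xb := hN.mem_nhds (hfr hxb)
  have hxV : V ∈ 𝓝 xb := hV.mem_nhds (hVΩ (frontier_subset_closure hxb))
  have hφc : ContDiffAt ℝ 2 φ xb := hφ.contDiffAt hxN
  have hAc : ∀ i j, ContDiffAt ℝ 1 (A i j) xb := fun i j => ((hAreg i j).contDiffAt hxV).of_le (by norm_num)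
  have hBc : ∀ i, ContinuousAt (B i) xb := fun i => ((hBreg i).contDiffAt hxV).continuousAt
  have hAd : ∀ i j, DifferentiableAt ℝ (A i j) xb := fun i j => (hAc i j).differentiableAt (by simp)
  have hpc : ∀ k, ContDiffAt ℝ 1 (pd k φ) xb := fun k => C2.pd hφc k
  have hpd : ∀ k, DifferentiableAt ℝ (pd k φ) xb := fun k => (hpc k).differentiableAt (by simp)
  set p := pd 0 φ xb with hp
  set q := pd 1 φ xb with hq
  have hn : 0 < p ^ 2 + q ^ 2 := by
    obtain ⟨k, hk⟩ := hgrad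
    fin_cases k
    · have : 0 < p ^ 2 := by positivity
      positivity
    · have : 0 < q ^ 2 := by positivity
      positivity
  -- the conormal field vanishes on the boundary
  set Z : Fin 2 → E → ℝ := fun j x => A 0 j x * pd 0 φ x + A 1 j x * pd 1 φ x with hZ
  have hZ0 : ∀ j, ∀ x ∈ frontier Ω, Z j x = 0 := by
    intro j x hx
    have e1 := hchar x hx
    have e2 := hdet x hx
    simp only [Fin.sum_univ_two, hA x] at e1 e2
    fin_cases j
    · show A 0 0 x * pd 0 φ x + A 1 0 x * pd 1 φ x = 0
      apply pow_eq_zero_iff (two_ne_zero) |>.mp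
      linear_combination A 0 0 x * e1 - pd 1 φ x ^ 2 * e2
    · show A 0 1 x * pd 0 φ x + A 1 1 x * pd 1 φ x = 0
      rw [hA x]
      apply pow_eq_zero_iff (two_ne_zero) |>.mp
      linear_combination A 1 1 x * e1 - pd 0 φ x ^ 2 * e2
  have hZc : ∀ j, ContDiffAt ℝ 1 (Z j) xb := fun j =>
    ((hAc 0 j).mul (hpc 0)).add ((hAc 1 j).mul (hpc 1))
  have hZd : ∀ j, DifferentiableAt ℝ (Z j) xb := fun j => (hZc j).differentiableAt (by simp)
  have z0 : A 0 0 xb * p + A 1 0 xb * q = 0 := hZ0 0 xb hxb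
  have z1 : A 0 1 xb * p + A 1 1 xb * q = 0 := hZ0 1 xb hxb
  set T := A 0 0 xb + A 1 1 xb with hT
  set ℓ := 1 / √(T * (p ^ 2 + q ^ 2)) with hℓ
  have hℓ0 : 0 < ℓ := by positivity
  have hℓ2 : ℓ ^ 2 * (T * (p ^ 2 + q ^ 2)) = 1 := by
    rw [hℓ, div_pow, Real.sq_sqrt (by positivity)]; field_simp
  obtain ⟨S, hS⟩ := exists_flat (t0 := -(ℓ * q)) (t1 := ℓ * p) hΩ hN hfr hφ hφ0 hpos hxb (by
    have : 0 < ℓ * (p ^ 2 + q ^ 2) := by positivity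
    intro h0
    simp only [← hp, ← hq] at h0
    linarith only [this, h0])
  set T1 := aff xb 0 (-(ℓ * q)) (ℓ * p) with hT1
  have rat := fun j => ratio hS hxN hφc hpos (hφ0 xb hxb) (hZc j) (hZ0 j)
  choose ζ hζ1 hζ2 using rat
  set μ := ζ 0 * p + ζ 1 * q with hμ
  have hbil : Bil A φ φ = fun x => Z 0 x * pd 0 φ x + Z 1 x * pd 1 φ x := by
    funext x; simp only [Bil, Fin.sum_univ_two, hZ]; ring
  have ppc : ∀ k, Tendsto (pd k φ) (𝓝[Ω] xb) (𝓝 (pd k φ xb)) := fun k =>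
    (hpc k).continuousAt.tendsto.mono_left nhdsWithin_le_nhds
  have hG2 : Tendsto (fun x => Bil A φ φ x / φ x) (𝓝[Ω] xb) (𝓝 μ) := by
    rw [hbil]
    refine (((hζ1 0).mul (ppc 0)).add ((hζ1 1).mul (ppc 1))).congr fun x => ?_
    ring
  have hφev : ∀ᶠ x in 𝓝[Ω] xb, 0 < φ x := by
    filter_upwards [self_mem_nhdsWithin, nhdsWithin_le_nhds hxN] with x a b using hpos x ⟨a, b⟩
  have hne : (𝓝[Ω] xb).NeBot := mem_closure_iff_nhdsWithin_neBot.mp (frontier_subset_closure hxb)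
  have hμ0 : 0 ≤ μ := by
    refine ge_of_tendsto hG2 ?_
    filter_upwards [hφev, self_mem_nhdsWithin] with x a b
    apply div_nonneg _ a.le
    by_cases hv : (fun i => pd i φ x) = (0 : Fin 2 → ℝ)
    · have : ∀ i, pd i φ x = 0 := fun i => congrFun hv i
      simp [Bil, this]
    · exact (hApos x b _ hv).le
  have hμne : μ ≠ 0 := by
    intro h0
    obtain ⟨k, hk⟩ := hcharnd
    apply hk
    have e : (fun z => ∑ i, ∑ j, A i j z * pd i φ z * pd j φ z) = fun x => Z 0 x * pd 0 φ x + Z 1 x * pd 1 φ x := hbil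
    rw [e, pd_ma (hZd 0) (hpd 0) (hZd 1) (hpd 1),
      hζ2, hζ2, hZ0 0 xb hxb, hZ0 1 xb hxb]
    linear_combination pd k φ xb * h0
  have hμp : 0 < μ := lt_of_le_of_ne hμ0 hμne.symm
  have hE : ∀ k j, pd k (A 0 j) xb * p + A 0 j xb * pd2 k 0 φ xb + (pd k (A 1 j) xb * q + A 1 j xb * pd2 k 1 φ xb)
      = ζ j * pd k φ xb := by
    intro k j
    rw [← hζ2 j k, hZ]
    simp only
    rw [pd_ma (hAd 0 j) (hpd 0) (hAd 1 j) (hpd 1)]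
    rfl
  have hAxb := hA xb
  have hAfun : A 0 1 = A 1 0 := funext hA
  -- the Fichera function
  have hD : (∑ k, ∑ i, ∑ j, pd k (A i j) xb * pd i φ xb * pd j φ xb * (pd k φ xb / ∑ l, (pd l φ xb) ^ 2)) = μ := by
    have hk : ∀ k, pd k (A 0 0) xb * p * p + pd k (A 0 1) xb * p * q + (pd k (A 1 0) xb * q * p + pd k (A 1 1) xb * q * q)
        = μ * pd k φ xb := fun k => by
      have a := hE k 0
      have b := hE k 1
      rw [hAxb] at z1 b
      linear_combination p * a + q * b - pd2 k 0 φ xb * z0 - pd2 k 1 φ xb * z1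
    have k0 := hk 0
    have k1 := hk 1
    rw [← hp] at k0
    rw [← hq] at k1
    simp only [Fin.sum_univ_two, ← hp, ← hq]
    rw [← mul_left_inj' hn.ne']
    have hn' := hn.ne'
    field_simp
    linear_combination p * k0 + q * k1
  have hLφ : Lop A B φ xb = μ * (ficheraG A B φ xb + 1) := by
    have hg : μ * ficheraG A B φ xb = (∑ i, B i xb * pd i φ xb) - ∑ i, ∑ j, pd j (A i j) xb * pd i φ xb := by
      unfold ficheraG
      rw [hD]; field_simp
    rw [mul_add, hg, mul_one]
    have a := hE 0 0
    have b := hE 1 1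
    simp only [Lop, Fin.sum_univ_two, ← hp, ← hq] at a b ⊢
    rw [hAfun] at b ⊢
    linear_combination a + b
  have pd2c : ∀ i j, Tendsto (pd2 i j φ) (𝓝 xb) (𝓝 (pd2 i j φ xb)) := fun i j => (C1.pd (hpc j) i).tendsto
  have hLc : Tendsto (Lop A B φ) (𝓝[Ω] xb) (𝓝 (μ * (ficheraG A B φ xb + 1))) := by
    rw [← hLφ]
    refine Tendsto.mono_left ?_ nhdsWithin_le_nhds
    unfold Lop
    refine Tendsto.add (tendsto_finset_sum _ fun i _ => tendsto_finset_sum _ fun j _ => ?_)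
      (tendsto_finset_sum _ fun i _ => ?_)
    · exact (hAc i j).continuousAt.tendsto.mul (pd2c i j)
    · exact (hBc i).tendsto.mul (hpc i).continuousAt.tendsto
  set C := 2 / √μ with hC
  have hC0 : 0 < C := by positivity
  have hC2 : C ^ 2 = 4 / μ := by rw [hC, div_pow, Real.sq_sqrt hμp.le]; norm_num
  set T2 : E → ℝ := fun x => C * √(φ x) with hT2
  have T1s : ContDiff ℝ 2 T1 := aff_smooth ..
  have hφt : Tendsto φ (𝓝 xb) (𝓝 0) := by
    have := hφc.continuousAt.tendsto; rwa [hφ0 xb hxb] at this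
  have hT1t : Tendsto T1 (𝓝 xb) (𝓝 0) := by
    have := T1s.continuous.tendsto xb
    rwa [show T1 xb = 0 by simp [hT1, aff]] at this
  have hT2t : Tendsto T2 (𝓝 xb) (𝓝 0) := by
    have := hφt.sqrt.const_mul C; simpa using this
  set G : ℝ × ℝ → E := fun z => S (z.1, z.2 ^ 2 / C ^ 2) with hG
  have hpt : Tendsto (fun z : ℝ × ℝ => ((z.1, z.2 ^ 2 / C ^ 2) : ℝ × ℝ)) (𝓝 (0, 0)) (𝓝 (0, 0)) := by
    have := Continuous.tendsto (by fun_prop : Continuous (fun z : ℝ × ℝ => ((z.1, z.2 ^ 2 / C ^ 2) : ℝ × ℝ))) (0, 0)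
    simpa using this
  have hSt : Tendsto S (𝓝 (0, 0)) (𝓝 xb) := by
    have := hS.smooth.continuousAt.tendsto; rwa [hS.base] at this
  have hGt : Tendsto G (𝓝 (0, 0)) (𝓝 xb) := hSt.comp hpt
  have hGT : ∀ y, 0 < φ y → S (T1 y, φ y) = y → G (T1 y, T2 y) = y := by
    intro y hy hs
    simp only [hG, hT2]
    rw [mul_pow, Real.sq_sqrt hy.le, mul_div_cancel_left₀ _ (by positivity), hs]
  have pdT2 : ∀ x, DifferentiableAt ℝ φ x → 0 < φ x → ∀ k, pd k T2 x = C * (pd k φ x / (2 * √(φ x))) :=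
    fun x a b k => pd_sqrt a b C k
  have hLT1 : Tendsto (Lop A B T1) (𝓝 xb) (𝓝 (B 0 xb * -(ℓ * q) + B 1 xb * (ℓ * p))) := by
    have : Lop A B T1 = fun x => B 0 x * -(ℓ * q) + B 1 x * (ℓ * p) := by funext x; exact Lop_aff ..
    rw [this]
    exact ((hBc 0).tendsto.mul_const _).add ((hBc 1).tendsto.mul_const _)
  have hφdev : ∀ᶠ x in 𝓝[Ω] xb, ContDiffAt ℝ 2 φ x := nhdsWithin_le_nhds (hφc.eventually (by simp))
  refine mk_chart (G := G) (T1 := T1) (T2 := T2)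
    (κ := fun x => C ^ 2 * (Lop A B φ x / 2 - Bil A φ φ x / φ x / 4)) (β := fun _ => 0)
    (zb := (0, 0)) (Bd := |B 0 xb * -(ℓ * q) + B 1 xb * (ℓ * p)| + 1) hΩ hA ?_
    (hGt.mono_left nhdsWithin_le_nhds)
    ((hT1t.prodMk_nhds hT2t).mono_left nhdsWithin_le_nhds) ?_ ?_ ?_ ?_ ?_ ?_ ?_
  · have ev1 := hpt.eventually (hS.inside.and (hS.right.and (hS.smooth.eventually (by simp))))
    have ev2 := hGt.eventually ((hS.left.eventually_nhds).and ((hφc.eventually (by simp)).and hxN))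
    filter_upwards [nhdsWithin_le_nhds ev1, nhdsWithin_le_nhds ev2, self_mem_nhdsWithin] with z a b hz
    have hz' : 0 < z.2 := hz
    obtain ⟨a1, ⟨a2, a3⟩, a4⟩ := a
    obtain ⟨b1, b2, b3⟩ := b
    have a1' : G z ∈ Ω := a1 (by positivity)
    have hφz : 0 < φ (G z) := hpos _ ⟨a1', b3⟩
    have a3' : φ (G z) = z.2 ^ 2 / C ^ 2 := a3
    refine ⟨a1', ?_, a2, ?_, T1s.contDiffAt, ?_, ?_⟩
    · exact ContDiffAt.comp (g := S) (f := fun z : ℝ × ℝ => ((z.1, z.2 ^ 2 / C ^ 2) : ℝ × ℝ)) z a4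
        (by fun_prop)
    · simp only [hT2]
      rw [a3', ← div_pow, Real.sqrt_sq (by positivity)]; field_simp
    · exact contDiffAt_const.mul (b2.sqrt hφz.ne')
    · filter_upwards [b1, b2.continuousAt.tendsto.eventually_const_lt hφz] with y c d using hGT y d c
  · filter_upwards [hφev, nhdsWithin_le_nhds hS.left] with x a b
    exact ⟨by simp only [hT2]; positivity, hGT x a b⟩
  · refine Tendsto.mono_left ?_ nhdsWithin_le_nhds
    have : Bil A T1 T1 = fun x => A 0 0 x * -(ℓ * q) * -(ℓ * q) + A 0 1 x * -(ℓ * q) * (ℓ * p) +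
        (A 1 0 x * (ℓ * p) * -(ℓ * q) + A 1 1 x * (ℓ * p) * (ℓ * p)) := by
      funext x; simp [Bil, hT1, pd_aff]
    rw [this]
    have t := fun i j => (hAc i j).continuousAt.tendsto
    have := ((((t 0 0).mul_const (-(ℓ * q))).mul_const (-(ℓ * q))).add
      (((t 0 1).mul_const (-(ℓ * q))).mul_const (ℓ * p))).add
      ((((t 1 0).mul_const (ℓ * p)).mul_const (-(ℓ * q))).add
      (((t 1 1).mul_const (ℓ * p)).mul_const (ℓ * p)))
    convert this using 2
    rw [hAxb] at z1 ⊢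
    rw [← hℓ2, hT]
    linear_combination ℓ ^ 2 * p * z0 + ℓ ^ 2 * q * z1
  · have hsq : Tendsto (fun x => √(φ x)) (𝓝[Ω] xb) (𝓝 0) := by
      have := (hφt.mono_left nhdsWithin_le_nhds : Tendsto φ (𝓝[Ω] xb) (𝓝 0)).sqrt
      simpa using this
    have := ((((hζ1 0).const_mul (-(ℓ * q))).add ((hζ1 1).const_mul (ℓ * p))).mul hsq).const_mul (C / 2)
    rw [mul_zero, mul_zero] at this
    refine this.congr' ?_
    filter_upwards [hφev, hφdev] with x a b
    have d := b.differentiableAt (by simp)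
    have hs : 0 < √(φ x) := Real.sqrt_pos.mpr a
    have hss : √(φ x) ^ 2 = φ x := Real.sq_sqrt a.le
    simp only [Bil, Fin.sum_univ_two, hT1, pd_aff, pdT2 x d a, hZ, hA x]
    simp only [if_true, one_ne_zero, if_false]
    set s := √(φ x)
    rw [← hss]
    field_simp
    ring
  · have := hG2.const_mul (C ^ 2 / 4)
    have e : C ^ 2 / 4 * μ = 1 := by rw [hC2]; field_simp
    rw [e] at this
    refine this.congr' ?_
    filter_upwards [hφev, hφdev] with x a b
    have d := b.differentiableAt (by simp)
    have hs : 0 < √(φ x) := Real.sqrt_pos.mpr a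
    have hss : √(φ x) ^ 2 = φ x := Real.sq_sqrt a.le
    simp only [Bil, Fin.sum_univ_two, pdT2 x d a]
    set s := √(φ x)
    rw [← hss]
    field_simp
    ring
  · exact nhdsWithin_le_nhds (ev_bdd hLT1 le_rfl)
  · filter_upwards [hφev, hφdev] with x a b
    refine ⟨?_, by simp only [abs_zero]; positivity⟩
    have d := b.differentiableAt (by simp)
    have hs : 0 < √(φ x) := Real.sqrt_pos.mpr a
    have hss : √(φ x) ^ 2 = φ x := Real.sq_sqrt a.le
    have p2 : ∀ i j, pd2 i j T2 x = _ := fun i j => pd2_sqrt b a C i j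
    have hT2x : T2 x = C * √(φ x) := rfl
    simp only [Lop, Bil, Fin.sum_univ_two, pdT2 x d a, p2, hT2x]
    set s := √(φ x)
    rw [← hss]
    field_simp
    ring
  · have := ((hLc.div_const 2).sub (hG2.div_const 4)).const_mul (C ^ 2)
    convert this using 2
    rw [hC2]
    field_simp
    ring

end Deg

open Filter Topology

namespace Deg

lemma compact_bound {Ω : Set E} {Pu : (E → ℝ) → Prop} (hcpt : IsCompact (closure Ω)) (hne : Ω.Nonempty)
    (hloc : ∀ xb ∈ closure Ω, ∃ O ∈ 𝓝 xb, ∃ δ : ℝ, 0 < δ ∧ δ < 1 ∧ ∃ M0 : ℝ, ∀ (u : E → ℝ) (M : ℝ), Pu u →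
      (∀ x ∈ Ω, u x ≤ M) → M0 ≤ M → ∀ x ∈ O ∩ Ω, u x < (1 - δ) * M) :
    ∃ C : ℝ, 0 < C ∧ ∀ u, Pu u → BddAbove (u '' Ω) → ∀ x ∈ Ω, u x ≤ C := by
  have key : ∃ δ : ℝ, 0 < δ ∧ δ < 1 ∧ ∃ M0 : ℝ, 0 < M0 ∧ ∀ (u : E → ℝ) (M : ℝ), Pu u →
      (∀ x ∈ Ω, u x ≤ M) → M0 ≤ M → ∀ x ∈ closure Ω ∩ Ω, u x < (1 - δ) * M := by
    refine hcpt.induction_on (p := fun s => ∃ δ : ℝ, 0 < δ ∧ δ < 1 ∧ ∃ M0 : ℝ, 0 < M0 ∧ ∀ (u : E → ℝ) (M : ℝ), Pu u →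
      (∀ x ∈ Ω, u x ≤ M) → M0 ≤ M → ∀ x ∈ s ∩ Ω, u x < (1 - δ) * M) ?_ ?_ ?_ ?_
    · exact ⟨1 / 2, by norm_num, by norm_num, 1, one_pos, fun u M _ _ _ x hx => absurd hx.1 (Set.notMem_empty x)⟩
    · rintro s t hst ⟨δ, a, b, M0, c, d⟩
      exact ⟨δ, a, b, M0, c, fun u M e f g x hx => d u M e f g x ⟨hst hx.1, hx.2⟩⟩
    · rintro s t ⟨δ, a, b, M0, c, d⟩ ⟨δ', a', b', M0', c', d'⟩
      refine ⟨min δ δ', lt_min a a', (min_le_left _ _).trans_lt b, max M0 M0', lt_max_of_lt_left c,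
        fun u M e f g x hx => ?_⟩
      have hM : 0 < M := c.trans_le ((le_max_left _ _).trans g)
      rcases hx.1 with h1 | h1
      · refine (d u M e f ((le_max_left _ _).trans g) x ⟨h1, hx.2⟩).trans_le ?_
        exact mul_le_mul_of_nonneg_right (by linarith [min_le_left δ δ']) hM.le
      · refine (d' u M e f ((le_max_right _ _).trans g) x ⟨h1, hx.2⟩).trans_le ?_
        exact mul_le_mul_of_nonneg_right (by linarith [min_le_right δ δ']) hM.le
    · intro x hx
      obtain ⟨O, hO, δ, a, b, M0, d⟩ := hloc x hx
      exact ⟨O, mem_nhdsWithin_of_mem_nhds hO, δ, a, b, max M0 1, lt_max_of_lt_right one_pos,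
        fun u M e f g x hx => d u M e f ((le_max_left _ _).trans g) x hx⟩
  obtain ⟨δ, hδ, hδ1, M0, hM0, hk⟩ := key
  refine ⟨M0, hM0, fun u hu hb => ?_⟩
  by_contra! hcon
  obtain ⟨x1, hx1, hx1'⟩ := hcon
  set M := sSup (u '' Ω) with hM
  have hle : ∀ x ∈ Ω, u x ≤ M := fun x hx => le_csSup hb ⟨x, hx, rfl⟩
  have hMM : M0 ≤ M := hx1'.le.trans (hle x1 hx1)
  have h1 := hk u M hu hle hMM
  have : M ≤ (1 - δ) * M := csSup_le (hne.image u) (by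
    rintro _ ⟨x, hx, rfl⟩
    exact (h1 x ⟨subset_closure hx, hx⟩).le)
  have h2 : 0 < δ * M := mul_pos hδ (hM0.trans_le hMM)
  linarith

end Deg

end DegSec

/-- Theorem 1.2: a priori `L^∞` bound for positive bounded solutions of the semilinear
degenerate elliptic equation `aⁱʲ∂ᵢⱼu + bⁱ∂ᵢu + f(x,u) = 0` in a bounded planar domain
whose boundary is characteristic for the operator. -/
theorem apriori_bound_degenerate
    (Ω N N' V : Set (Fin 2 → ℝ))
    (hΩo : IsOpen Ω) (hΩb : IsBounded Ω) (hΩne : Ω.Nonempty)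
    (hN : IsOpen N) (hNfr : frontier Ω ⊆ N)
    (hN' : IsOpen N') (hN'fr : frontier Ω ⊆ N') (hN'N : N' ⊆ N)
    (hV : IsOpen V) (hVΩ : closure Ω ⊆ V)
    (φ : (Fin 2 → ℝ) → ℝ) (hφreg : ContDiffOn ℝ 2 φ N)
    (hφ0 : ∀ x ∈ frontier Ω, φ x = 0)
    (hφgrad : ∀ x ∈ frontier Ω, ∃ k, pd k φ x ≠ 0)
    (hφpos : ∀ x ∈ Ω ∩ N, 0 < φ x)
    (A : Fin 2 → Fin 2 → (Fin 2 → ℝ) → ℝ) (B : Fin 2 → (Fin 2 → ℝ) → ℝ)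
    (hAreg : ∀ i j, ContDiffOn ℝ 2 (A i j) V)
    (hBreg : ∀ i, ContDiffOn ℝ 1 (B i) V)
    (hAsymm : ∀ i j x, A i j x = A j i x)
    (hApos : ∀ x ∈ Ω, ∀ v : Fin 2 → ℝ, v ≠ 0 → 0 < ∑ i, ∑ j, A i j x * v i * v j)
    (hchar : ∀ x ∈ frontier Ω, ∑ i, ∑ j, A i j x * pd i φ x * pd j φ x = 0)
    (hcharnd : ∀ x ∈ frontier Ω,
      ∃ k, pd k (fun z => ∑ i, ∑ j, A i j z * pd i φ z * pd j φ z) x ≠ 0)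
    (lam₁ lam₂ m : (Fin 2 → ℝ) → ℝ) (c₀ : ℝ) (hc₀ : 0 < c₀)
    (hm : ContinuousOn m (closure Ω)) (hmpos : ∀ x ∈ closure Ω, 0 < m x)
    (heig : ∀ x ∈ closure Ω ∩ N',
      lam₁ x + lam₂ x = A 0 0 x + A 1 1 x ∧
      lam₁ x * lam₂ x = A 0 0 x * A 1 1 x - A 0 1 x * A 1 0 x ∧
      c₀ ≤ lam₁ x ∧ lam₂ x = m x * φ x)
    (aSup bInf : ℝ)
    (ha : IsLUB (ficheraG A B φ '' frontier Ω) (aSup - 1))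
    (hbinf : IsGLB (ficheraG A B φ '' frontier Ω) bInf) (hbInf : 1 < bInf)
    (α : ℝ) (hα₁ : 1 < α) (hα₂ : α < (3 + 2 * aSup) / (2 * aSup - 1))
    (f : (Fin 2 → ℝ) → ℝ → ℝ)
    (hf : ContinuousOn (fun q : (Fin 2 → ℝ) × ℝ => f q.1 q.2) (closure Ω ×ˢ Set.Ici 0))
    (h : (Fin 2 → ℝ) → ℝ)
    (hh : ContinuousOn h (closure Ω)) (hhpos : ∀ x ∈ closure Ω, 0 < h x)
    (hlim : ∀ ε > 0, ∃ T : ℝ, 0 < T ∧ ∀ t ≥ T, ∀ x ∈ closure Ω,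
      |f x t / t ^ α - h x| < ε) :
    ∃ C : ℝ, 0 < C ∧ ∀ u : (Fin 2 → ℝ) → ℝ,
      ContDiffOn ℝ 2 u Ω →
      (∀ x ∈ Ω, 0 < u x) →
      BddAbove (u '' Ω) →
      (∀ x ∈ Ω, (∑ i, ∑ j, A i j x * pd2 i j u x) + (∑ i, B i x * pd i u x) +
        f x (u x) = 0) →
      ∀ x ∈ Ω, u x ≤ C := by
  have hcpt : IsCompact (closure Ω) := hΩb.isCompact_closure
  have hfrne : (frontier Ω).Nonempty := by
    rw [Set.nonempty_iff_ne_empty]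
    intro he
    rcases frontier_eq_empty_iff.mp he with h1 | h1
    · exact hΩne.ne_empty h1
    · rw [h1] at hΩb
      exact NormedSpace.unbounded_univ ℝ (Fin 2 → ℝ) hΩb
  obtain ⟨y, hy⟩ := hfrne
  have hglo : ∀ x ∈ frontier Ω, 1 < ficheraG A B φ x := fun x hx =>
    hbInf.trans_le (hbinf.1 ⟨x, hx, rfl⟩)
  have hghi : ∀ x ∈ frontier Ω, ficheraG A B φ x ≤ aSup - 1 := fun x hx => ha.1 ⟨x, hx, rfl⟩
  have haS : 2 < aSup := by linarith [hglo y hy, hghi y hy]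
  have hd : 0 < 2 * aSup - 1 := by linarith
  set k := 2 / (α - 1) with hk
  have hα0 : 0 < α - 1 := by linarith
  have hk0 : 0 < k := by positivity
  have hαk : 1 + 2 / k = α := by rw [hk]; field_simp; ring
  have hkk : 2 * aSup - 1 < 2 * k := by
    rw [lt_div_iff₀ hd] at hα₂
    rw [hk, mul_div_assoc', lt_div_iff₀ hα0]
    linarith
  have hA : ∀ x, A 0 1 x = A 1 0 x := hAsymm 0 1
  obtain ⟨C, hC, hCu⟩ := Deg.compact_bound (Ω := Ω)
    (Pu := fun u => ContDiffOn ℝ 2 u Ω ∧ (∀ x ∈ Ω, 0 < u x) ∧ ∀ x ∈ Ω, Deg.Lop A B u x + f x (u x) = 0) hcpt hΩne (by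
    intro xb hxb
    have hfe := Deg.f_est hα₁ hcpt hxb hf hh (hhpos xb hxb) hlim
    have hchart : ∃ κ0, 1 < κ0 ∧ κ0 < 2 * k ∧ Deg.Chart Ω A B xb κ0 := by
      by_cases hx : xb ∈ Ω
      · refine ⟨2 * aSup - 1, by linarith, hkk, ?_⟩
        have hxV : V ∈ nhds xb := hV.mem_nhds (hVΩ hxb)
        have p1 : 0 < A 0 0 xb := by
          have := hApos xb hx ![1, 0] (by simp)
          simpa [Fin.sum_univ_two] using this
        have p2 := hApos xb hx ![-A 0 1 xb, A 0 0 xb] (by simp [p1.ne'])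
        refine Deg.interior_chart hΩo hA hx (fun i j => ((hAreg i j).contDiffAt hxV).continuousAt)
          (fun i => ((hBreg i).contDiffAt hxV).continuousAt) p1 ?_
        simp only [Fin.sum_univ_two, Matrix.cons_val_zero, Matrix.cons_val_one] at p2
        rw [← hA xb] at p2
        refine pos_of_mul_pos_right (a := A 0 0 xb) ?_ p1.le
        linarith only [p2]
      · have hfr : xb ∈ frontier Ω := by rw [hΩo.frontier_eq]; exact ⟨hxb, hx⟩
        refine ⟨2 * ficheraG A B φ xb + 1, by linarith [hglo xb hfr], by linarith [hghi xb hfr], ?_⟩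
        have eg := fun x (hx : x ∈ frontier Ω) => heig x ⟨frontier_subset_closure hx, hN'fr hx⟩
        refine Deg.boundary_chart hΩo hN hNfr hV hVΩ hφreg hφ0 hφpos hfr (hφgrad xb hfr) hAreg hBreg hA hApos hchar
          (hcharnd xb hfr) (fun x hx => ?_) ?_
        · obtain ⟨e1, e2, e3, e4⟩ := eg x hx
          rw [← e2, e4, hφ0 x hx]; ring
        · obtain ⟨e1, e2, e3, e4⟩ := eg xb hfr
          rw [hφ0 xb hfr, mul_zero] at e4
          rw [← e1, e4]; linarith
    obtain ⟨κ0, q1, q2, q3⟩ := hchart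
    obtain ⟨O, hO, δ, d1, d2, M0, hM⟩ := Deg.chart_bound (f := f) hk0 q1 q2 (hhpos xb hxb) q3 (by rw [hαk]; exact hfe)
    exact ⟨O, hO, δ, d1, d2, M0, fun u M hu => hM u M hu.1 hu.2.1 hu.2.2⟩)
  exact ⟨C, hC, fun u h1 h2 h3 h4 => hCu u ⟨h1, h2, h4⟩ h3⟩
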